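/- Let L be a positive-definite integral ternary lattice and q a prime with gcd(q, 2d_L) = 1. For any n ∈ ℕ that is locally represented by L (i.e., represented by L_p over ℤ_p for every prime p), and for any f ∈ ℕ with gcd(f,q) = 1 and H(4 d_L n / f²) ≠ 0, one has r(nq², gen(L)) / r(n, gen(L)) = H(4 d_L n q² / f²) / H(4 d_L n / f²). -/

import Mathlib

open scoped BigOperators Classical
open Matrix Filter

noncomputable section

/-! ## Binary quadratic forms, class numbers, and Hurwitz class numbers -/

/-- `(a,b,c)` represents the primitive positive-definite binary quadratic form
`a x² + b x y + c y²` of discriminant `d`. -/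
def IsPrimPosDefBQF (d : ℤ) (f : ℤ × ℤ × ℤ) : Prop :=
  f.2.1 ^ 2 - 4 * f.1 * f.2.2 = d ∧ Int.gcd f.1 (Int.gcd f.2.1 f.2.2) = 1 ∧ 0 < f.1

/-- `SL₂(ℤ)`-equivalence of binary quadratic forms. -/
def BQFEquiv (f g : ℤ × ℤ × ℤ) : Prop :=
  ∃ M : Matrix.SpecialLinearGroup (Fin 2) ℤ,
    g.1 = f.1 * M 0 0 ^ 2 + f.2.1 * M 0 0 * M 1 0 + f.2.2 * M 1 0 ^ 2 ∧
    g.2.1 = 2 * f.1 * M 0 0 * M 0 1 + f.2.1 * (M 0 0 * M 1 1 + M 0 1 * M 1 0) +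
        2 * f.2.2 * M 1 0 * M 1 1 ∧
    g.2.2 = f.1 * M 0 1 ^ 2 + f.2.1 * M 0 1 * M 1 1 + f.2.2 * M 1 1 ^ 2

/-- The class number `h(d)`: the number of `SL₂(ℤ)`-classes of primitive positive-definite
binary quadratic forms of discriminant `d`. -/
def classNum (d : ℤ) : ℕ :=
  Nat.card (Quot fun f g : {f : ℤ × ℤ × ℤ // IsPrimPosDefBQF d f} => BQFEquiv f.1 g.1)

/-- The number of automorphs `w_d`. -/
def wAut (d : ℤ) : ℕ := if d = -3 then 6 else if d = -4 then 4 else 2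

def hurwitzNat (N : ℕ) : ℚ :=
  if 0 < N ∧ (N % 4 = 0 ∨ N % 4 = 3) then
    ∑ f ∈ N.divisors.filter fun f => f ^ 2 ∣ N,
      (classNum (-((N / f ^ 2 : ℕ) : ℤ)) : ℚ) / ((wAut (-((N / f ^ 2 : ℕ) : ℤ)) : ℚ) / 2)
  else 0

/-- Hurwitz class number, with the convention `H(x) = 0` unless `x` is a positive integer
congruent to `0` or `3 (mod 4)`. -/
def hurwitz (x : ℚ) : ℚ := if x.den = 1 ∧ 0 ≤ x.num then hurwitzNat x.num.toNat else 0

/-! ## Kronecker symbol and fundamental discriminants -/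

def kron2 (a : ℤ) : ℤ := if a % 2 = 0 then 0 else if a % 8 = 1 ∨ a % 8 = 7 then 1 else -1

/-- The Kronecker symbol `(a / n)` for `n ∈ ℕ`. -/
def kroneckerSym (a : ℤ) (n : ℕ) : ℤ :=
  kron2 a ^ padicValNat 2 n * jacobiSym a (n / 2 ^ padicValNat 2 n)

/-- Fundamental discriminants. -/
def IsFundamentalDisc (d : ℤ) : Prop :=
  d % 4 = 1 ∧ Squarefree d ∨ d % 4 = 0 ∧ Squarefree (d / 4) ∧ (d / 4 % 4 = 2 ∨ d / 4 % 4 = 3)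

/-! ## Ternary quadratic lattices via Gram matrices -/

abbrev TernMat := Matrix (Fin 3) (Fin 3) ℤ

/-- The quadratic form attached to a Gram matrix. -/
def quadVal {R : Type*} [CommRing R] {k : ℕ} (M : Matrix (Fin k) (Fin k) R) (x : Fin k → R) : R :=
  ∑ i, ∑ j, x i * M i j * x j

/-- `A` is the Gram matrix of a positive-definite integral ternary lattice. -/
def IsLat (A : TernMat) : Prop := A.IsSymm ∧ ∀ x : Fin 3 → ℤ, x ≠ 0 → 0 < quadVal A x

/-- The number of representations of `n` by the lattice with Gram matrix `A`. -/
def rRep (n : ℤ) (A : TernMat) : ℕ := Nat.card {x : Fin 3 → ℤ // quadVal A x = n}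

/-- Isometry of ternary lattices via their Gram matrices. -/
def LatIsom (A B : TernMat) : Prop := ∃ U : TernMat, IsUnit U.det ∧ Uᵀ * A * U = B

/-- The number of automorphs `o(L)`. -/
def numAut (A : TernMat) : ℕ := Nat.card {U : TernMat // IsUnit U.det ∧ Uᵀ * A * U = A}

def padicMat (p : ℕ) [Fact p.Prime] {k : ℕ} (A : Matrix (Fin k) (Fin k) ℤ) :
    Matrix (Fin k) (Fin k) ℤ_[p] := A.map Int.cast

/-- Isometry of `ℤ_p`-lattices given by Gram matrices. -/
def PadicIsomP (p : ℕ) [Fact p.Prime] {k : ℕ} (M N : Matrix (Fin k) (Fin k) ℤ_[p]) : Prop :=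
  ∃ U : Matrix (Fin k) (Fin k) ℤ_[p], IsUnit U.det ∧ Uᵀ * M * U = N

/-- `A ⊗ ℤ_p ≅ B ⊗ ℤ_p`. -/
def PadicLatIsom (p : ℕ) (hp : p.Prime) (A B : TernMat) : Prop :=
  letI : Fact p.Prime := ⟨hp⟩
  PadicIsomP p (padicMat p A) (padicMat p B)

/-- `B` is (the Gram matrix of a lattice) in the genus of `A`. -/
def InGenus (A B : TernMat) : Prop :=
  IsLat B ∧ ∀ (p : ℕ) (hp : p.Prime), PadicLatIsom p hp A B

/-- The mass `w(L)` of the genus of `A`. -/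
def massOf (A : TernMat) : ℝ :=
  ∑ᶠ c : Quot fun B C : {B : TernMat // InGenus A B} => LatIsom B.1 C.1,
    ((numAut (Quot.out c).1 : ℝ))⁻¹

/-- The Siegel–Weil average `r(n, gen(L))`. -/
def rGenus (n : ℤ) (A : TernMat) : ℝ :=
  (massOf A)⁻¹ *
    ∑ᶠ c : Quot fun B C : {B : TernMat // InGenus A B} => LatIsom B.1 C.1,
      (rRep n (Quot.out c).1 : ℝ) / (numAut (Quot.out c).1 : ℝ)

/-! ## Local invariants -/

/-- `L_p` is isotropic. -/
def IsotropicP (p : ℕ) [Fact p.Prime] (A : TernMat) : Prop :=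
  ∃ x : Fin 3 → ℤ_[p], x ≠ 0 ∧ quadVal (padicMat p A) x = 0

/-- The modified Hasse symbol `S_p*(L)`: `1` if `L_p` is isotropic, `-1` if anisotropic. -/
def SpStar (p : ℕ) (A : TernMat) : ℤ :=
  if h : p.Prime then
    letI : Fact p.Prime := ⟨h⟩
    if IsotropicP p A then 1 else -1
  else 1

/-- The lattice is even: all represented numbers are even. -/
def IsEvenLat (A : TernMat) : Prop := ∀ x : Fin 3 → ℤ, 2 ∣ quadVal A x

/-- The lattice is primitive: its scale ideal is `ℤ`. -/
def IsPrimitiveLat (A : TernMat) : Prop :=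
  Finset.univ.gcd (fun ij : Fin 3 × Fin 3 => (A ij.1 ij.2).natAbs) = 1

/-- Stability at a prime `p`. -/
def StableAt (A : TernMat) (p : ℕ) : Prop :=
  padicValInt p A.det ≤ 1 ∧ (p = 2 → (padicValInt 2 A.det = 1 ↔ IsEvenLat A))

/-- A stable (primitive) ternary lattice. -/
def IsStable (A : TernMat) : Prop := IsPrimitiveLat A ∧ ∀ p : ℕ, p.Prime → StableAt A p

def RepresentedAt (p : ℕ) (hp : p.Prime) (n : ℤ) (A : TernMat) : Prop :=
  letI : Fact p.Prime := ⟨hp⟩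
  ∃ x : Fin 3 → ℤ_[p], quadVal (padicMat p A) x = (n : ℤ_[p])

/-- `n` is represented by `L_p` for every prime `p`. -/
def LocallyRepresented (n : ℤ) (A : TernMat) : Prop :=
  ∀ (p : ℕ) (hp : p.Prime), RepresentedAt p hp n A

/-! ## Siegel local densities -/

/-- The Siegel local density `α_p(n, L)` (here `s = 1`, `t = 3`). -/
def localDensity (p : ℕ) (hp : p.Prime) (n : ℤ) (A : TernMat) : ℝ :=
  limUnder atTop fun r : ℕ =>
    (Nat.card {X : Fin 3 → ZMod (p ^ r) //
        (∑ i, ∑ j, X i * (A i j : ZMod (p ^ r)) * X j) = (n : ZMod (p ^ r))} : ℝ) /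
      (p : ℝ) ^ (2 * r)

def localDensityN (p : ℕ) (n : ℤ) (A : TernMat) : ℝ :=
  if h : p.Prime then localDensity p h n A else 0

/-- The value `L(1, χ_a)` of the Dirichlet series attached to the Kronecker symbol `(a/·)`. -/
def LOne (a : ℤ) : ℝ :=
  limUnder atTop fun N : ℕ =>
    ∑ k ∈ Finset.range N, (kroneckerSym a (k + 1) : ℝ) / (k + 1)

/-! ## Watson transformations (Gram matrix form) -/

/-- The underlying set of `Λ_m(L)` in the coordinates of `L`. -/
def watsonSetG (m : ℕ) (A : TernMat) : Set (Fin 3 → ℤ) :=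
  {x | ∀ y : Fin 3 → ℤ, (m : ℤ) ∣ (quadVal A (x + y) - quadVal A y)}

/-- `B` is a Gram matrix for the sublattice `Λ_m(L)` of the lattice `L` with Gram matrix `A`. -/
def IsWatsonGram (m : ℕ) (A B : TernMat) : Prop :=
  ∃ T : TernMat, Set.range T.mulVec = watsonSetG m A ∧ B = Tᵀ * A * T

/-- `B` is a Gram matrix of the Watson transform `λ_m(L)`: the primitive rescaling of `Λ_m(L)`. -/
def IsLambdaGram (m : ℕ) (A B : TernMat) : Prop :=
  IsPrimitiveLat B ∧
    ∃ (B₀ : TernMat) (c : ℚ), 0 < c ∧ IsWatsonGram m A B₀ ∧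
      B.map ((↑) : ℤ → ℚ) = c • B₀.map ((↑) : ℤ → ℚ)

/-- The `3×3` Gram matrix of the orthogonal sum `M ⊥ U`. -/
def blockMat3 {p : ℕ} [Fact p.Prime] (k : ℕ) (hk : k ≤ 3)
    (M : Matrix (Fin k) (Fin k) ℤ_[p]) (U : Matrix (Fin (3 - k)) (Fin (3 - k)) ℤ_[p]) :
    Matrix (Fin 3) (Fin 3) ℤ_[p] :=
  Matrix.reindex (finSumFinEquiv.trans (finCongr (by omega)))
    (finSumFinEquiv.trans (finCongr (by omega))) (Matrix.fromBlocks M 0 0 U)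

end

/-! ### P1: weighted sums over classes -/

/-- weighted sum over classes -/
noncomputable def csum {X : Type*} (r : X → X → Prop) (a : X → ℕ) (F : X → ℝ) : ℝ :=
  ∑ᶠ c : Quot r, F c.out / (a c.out : ℝ)

theorem quot_rel {X : Type*} {r : X → X → Prop} (hr : Equivalence r) {x y : X}
    (h : Quot.mk r x = Quot.mk r y) : r x y :=
  @Quotient.exact X ⟨r, hr⟩ x y h

theorem quot_out_rel {X : Type*} {r : X → X → Prop} (hr : Equivalence r) (x : X) :
    r (Quot.mk r x).out x :=
  quot_rel hr (Quot.out_eq _)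

theorem csum_congr {X : Type*} {r : X → X → Prop} {a : X → ℕ} {F G : X → ℝ}
    (h : ∀ x, F x = G x) : csum r a F = csum r a G := by
  have : F = G := funext h
  rw [this]

theorem csum_add {X : Type*} {r : X → X → Prop} [Finite (Quot r)] {a : X → ℕ} (F G : X → ℝ) :
    csum r a (fun x => F x + G x) = csum r a F + csum r a G := by
  unfold csum
  haveI := Fintype.ofFinite (Quot r)
  simp only [finsum_eq_sum_of_fintype, add_div, Finset.sum_add_distrib]

theorem csum_mul {X : Type*} {r : X → X → Prop} [Finite (Quot r)] {a : X → ℕ} (k : ℝ)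
    (F : X → ℝ) :
    csum r a (fun x => k * F x) = k * csum r a F := by
  unfold csum
  haveI := Fintype.ofFinite (Quot r)
  simp only [finsum_eq_sum_of_fintype, mul_div_assoc, Finset.mul_sum]

theorem csum_sum {X : Type*} {r : X → X → Prop} [Finite (Quot r)] {a : X → ℕ} {ι : Type*}
    (s : Finset ι) (F : ι → X → ℝ) :
    csum r a (fun x => ∑ i ∈ s, F i x) = ∑ i ∈ s, csum r a (F i) := by
  unfold csum
  haveI := Fintype.ofFinite (Quot r)
  simp only [finsum_eq_sum_of_fintype, Finset.sum_div]
  rw [Finset.sum_comm]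

theorem csum_reindex {X Y : Type*} {r : X → X → Prop} {s : Y → Y → Prop}
    (hr : Equivalence r) (hs : Equivalence s) [Finite (Quot r)] [Finite (Quot s)]
    {a : X → ℕ} {b : Y → ℕ} {F : X → ℝ} {G : Y → ℝ} (e : X → Y)
    (ha : ∀ x y, r x y → a x = a y) (hF : ∀ x y, r x y → F x = F y)
    (hb : ∀ x y, s x y → b x = b y) (hG : ∀ x y, s x y → G x = G y)
    (he : ∀ x y, r x y ↔ s (e x) (e y)) (hab : ∀ x, b (e x) = a x) (hFG : ∀ x, G (e x) = F x)
    (h0 : ∀ y, (∀ x, ¬ s y (e x)) → G y = 0) : csum r a F = csum s b G := by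
  unfold csum
  haveI := Fintype.ofFinite (Quot r)
  haveI := Fintype.ofFinite (Quot s)
  simp only [finsum_eq_sum_of_fintype]
  let ψ : Quot r → Quot s := fun c => Quot.mk s (e c.out)
  have hinj : Function.Injective ψ := by
    intro c c' h
    have h1 := (he _ _).2 (quot_rel hs h)
    rw [← Quot.out_eq c, ← Quot.out_eq c']
    exact Quot.sound h1
  have hval : ∀ c, F c.out / (a c.out : ℝ) = G (ψ c).out / (b (ψ c).out : ℝ) := by
    intro c
    have h1 : s (ψ c).out (e c.out) := quot_out_rel hs _
    rw [hG _ _ h1, hb _ _ h1, hab, hFG]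
  rw [Finset.sum_congr rfl (fun c _ => hval c)]
  rw [← Finset.sum_image (s := Finset.univ) (g := ψ)
    (f := fun d => G d.out / (b d.out : ℝ)) (fun x _ y _ h => hinj h)]
  apply Finset.sum_subset (Finset.subset_univ _)
  intro d _ hd
  rw [h0, zero_div]
  intro x hx
  apply hd
  rw [Finset.mem_image]
  refine ⟨Quot.mk r x, Finset.mem_univ _, ?_⟩
  have h1 : r (Quot.mk r x).out x := quot_out_rel hr _
  have h2 := (he _ _).1 h1
  calc ψ (Quot.mk r x) = Quot.mk s (e x) := Quot.sound h2
    _ = Quot.mk s d.out := (Quot.sound hx).symm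
    _ = d := Quot.out_eq d

theorem class_sum {X : Type*} {r : X → X → Prop} (hr : Equivalence r) [Finite (Quot r)]
    (h : X → X → ℕ) (a : X → ℕ) (ha : ∀ x, 0 < a x) (h1 : ∀ x y, r x y → h x y = a y)
    (h0 : ∀ x y, ¬ r x y → h x y = 0) (F : X → ℝ) (hF : ∀ x y, r x y → F x = F y)
    {J : Type*} [Fintype J] (xs : J → X) (N : X → ℕ) (hN : ∀ y, N y = ∑ j, h (xs j) y) :
    ∑ j, F (xs j) = csum r a (fun y => F y * N y) := by
  unfold csum
  haveI := Fintype.ofFinite (Quot r)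
  simp only [finsum_eq_sum_of_fintype, hN]
  push_cast
  simp only [Finset.mul_sum, Finset.sum_div]
  rw [Finset.sum_comm]
  apply Finset.sum_congr rfl
  intro j _
  rw [Finset.sum_eq_single (Quot.mk r (xs j))]
  · have h2 : r (xs j) (Quot.mk r (xs j)).out := hr.symm (quot_out_rel hr _)
    rw [h1 _ _ h2, ← hF _ _ h2]
    have := ha (Quot.mk r (xs j)).out
    field_simp
  · intro c _ hc
    rw [h0, Nat.cast_zero, mul_zero, zero_div]
    intro h2
    apply hc
    rw [← Quot.out_eq c]
    exact (Quot.sound h2).symm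
  · intro h; exact absurd (Finset.mem_univ _) h

/-- the basic double counting identity -/
theorem double_count {X Y : Type*} {r : X → X → Prop} {s : Y → Y → Prop}
    [Finite (Quot r)] [Finite (Quot s)]
    {a : X → ℕ} {b : Y → ℕ} (F : X → ℝ) (G : Y → ℝ) (N : X → Y → ℕ) :
    csum r a (fun x => F x * csum s b (fun y => G y * N x y)) =
      csum s b (fun y => G y * csum r a (fun x => F x * N x y)) := by
  unfold csum
  haveI := Fintype.ofFinite (Quot r)
  haveI := Fintype.ofFinite (Quot s)
  simp only [finsum_eq_sum_of_fintype, Finset.mul_sum, Finset.sum_div]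
  rw [Finset.sum_comm]
  refine Finset.sum_congr rfl fun i _ => Finset.sum_congr rfl fun j _ => ?_
  ring

/-! ### P2: counting projective roots of a quadratic -/

/-- roots on the projective line -/
def projRoot {F : Type*} [Field F] (a b c : F) : Option F → Prop
  | none => a = 0
  | some s => a * s ^ 2 + b * s + c = 0

theorem card_projRoot {F : Type*} [Field F] [Fintype F] (h2 : (2 : F) ≠ 0) (a b c : F)
    (h : ¬ (a = 0 ∧ b = 0 ∧ c = 0)) :
    Nat.card {j : Option F // projRoot a b c j} = Nat.card {t : F // t ^ 2 = b ^ 2 - 4 * a * c} := by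
  by_cases ha : a = 0
  · subst ha
    by_cases hb : b = 0
    · subst hb
      have hc : c ≠ 0 := by simpa using h
      have e1 : {j : Option F | projRoot 0 0 c j} = {none} := by
        ext j
        cases j <;> simp [projRoot, hc]
      have e2 : {t : F | t ^ 2 = 0 ^ 2 - 4 * 0 * c} = {0} := by
        ext t; simp
      have := congrArg Set.ncard e1
      have h' := congrArg Set.ncard e2
      rw [Set.ncard_singleton] at this h'
      exact this.trans h'.symm
    · have e1 : {j : Option F | projRoot 0 b c j} = {none, some (-c / b)} := by
        ext j
        cases j with
        | none => simp [projRoot]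
        | some s =>
          simp only [projRoot, Set.mem_ofPred_eq, Set.mem_insert_iff, Set.mem_singleton_iff,
            Option.some.injEq, reduceCtorEq, false_or]
          rw [eq_div_iff hb]
          constructor
          · intro h; linear_combination h
          · intro h; linear_combination h
      have e2 : {t : F | t ^ 2 = b ^ 2 - 4 * 0 * c} = {b, -b} := by
        ext t
        simp [sq_eq_sq_iff_eq_or_eq_neg]
      have := congrArg Set.ncard e1
      have h' := congrArg Set.ncard e2
      rw [Set.ncard_pair (by simp)] at this
      rw [Set.ncard_pair] at h'
      · exact this.trans h'.symm
      · intro hbb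
        have : 2 * b = 0 := by linear_combination hbb
        simp [h2, hb] at this
  · refine Nat.card_congr
      { toFun := fun j => ⟨match j.1 with | none => 0 | some s => 2 * a * s + b, ?_⟩
        invFun := fun t => ⟨some ((t.1 - b) / (2 * a)), ?_⟩
        left_inv := ?_
        right_inv := ?_ }
    · rcases j with ⟨j, hj⟩
      cases j with
      | none => exact absurd hj ha
      | some s =>
        simp only [projRoot] at hj
        show (2 * a * s + b) ^ 2 = _
        linear_combination 4 * a * hj
    · rcases t with ⟨t, ht⟩
      simp only [projRoot]
      field_simp
      linear_combination ht
    · rintro ⟨j, hj⟩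
      cases j with
      | none => exact absurd hj ha
      | some s =>
        simp only [Subtype.mk.injEq, Option.some.injEq]
        field_simp
        ring
    · rintro ⟨t, ht⟩
      simp only [Subtype.mk.injEq]
      field_simp
      ring

/-! ### P3: binary forms and the Hurwitz recursion -/

abbrev BF := ℤ × ℤ × ℤ
abbrev M2 := Matrix (Fin 2) (Fin 2) ℤ

/-- substitution in a binary form -/
def bact (f : BF) (M : M2) : BF :=
  (f.1 * M 0 0 ^ 2 + f.2.1 * M 0 0 * M 1 0 + f.2.2 * M 1 0 ^ 2,
   2 * f.1 * M 0 0 * M 0 1 + f.2.1 * (M 0 0 * M 1 1 + M 0 1 * M 1 0) +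
        2 * f.2.2 * M 1 0 * M 1 1,
   f.1 * M 0 1 ^ 2 + f.2.1 * M 0 1 * M 1 1 + f.2.2 * M 1 1 ^ 2)

theorem BQFEquiv_iff (f g : BF) :
    BQFEquiv f g ↔ ∃ M : Matrix.SpecialLinearGroup (Fin 2) ℤ, bact f M.1 = g := by
  unfold BQFEquiv bact
  constructor
  · rintro ⟨M, h1, h2, h3⟩
    exact ⟨M, Prod.ext h1.symm (Prod.ext h2.symm h3.symm)⟩
  · rintro ⟨M, h⟩
    refine ⟨M, ?_, ?_, ?_⟩ <;> rw [← h] <;> rfl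

theorem bact_mul (f : BF) (M N : M2) : bact f (M * N) = bact (bact f M) N := by
  unfold bact
  simp only [Matrix.mul_apply, Fin.sum_univ_two]
  refine Prod.ext ?_ (Prod.ext ?_ ?_) <;> simp only <;> ring

theorem bact_one (f : BF) : bact f 1 = f := by
  unfold bact
  simp

/-- discriminant -/
def bdisc (f : BF) : ℤ := f.2.1 ^ 2 - 4 * f.1 * f.2.2

theorem bdisc_bact (f : BF) (M : M2) : bdisc (bact f M) = bdisc f * M.det ^ 2 := by
  unfold bdisc bact
  rw [Matrix.det_fin_two]
  ring

/-- forms of discriminant `-N` -/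
def YF (N : ℕ) := {f : BF // bdisc f = -(N : ℤ) ∧ 0 < f.1}

theorem bpos {f : BF} {N : ℕ} (hN : 0 < N) (hd : bdisc f = -(N : ℤ)) (ha : 0 < f.1) (x y : ℤ)
    (h : x ≠ 0 ∨ y ≠ 0) : 0 < f.1 * x ^ 2 + f.2.1 * x * y + f.2.2 * y ^ 2 := by
  unfold bdisc at hd
  have h1 : 4 * f.1 * (f.1 * x ^ 2 + f.2.1 * x * y + f.2.2 * y ^ 2) =
      (2 * f.1 * x + f.2.1 * y) ^ 2 + N * y ^ 2 := by linear_combination (-y^2) * hd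
  have hN' : (0 : ℤ) < N := by exact_mod_cast hN
  have h2 : 0 < (2 * f.1 * x + f.2.1 * y) ^ 2 + N * y ^ 2 := by
    by_cases hy : y = 0
    · subst hy
      have hx : x ≠ 0 := by simpa using h
      simp only [mul_zero, add_zero, ne_eq, OfNat.ofNat_ne_zero, not_false_eq_true, zero_pow]
      positivity
    · positivity
  rw [← h1] at h2
  exact pos_of_mul_pos_right h2 (by linarith)

theorem bact_pos {f : BF} {N : ℕ} (hN : 0 < N) (hd : bdisc f = -(N : ℤ)) (ha : 0 < f.1)
    (M : M2) (hM : M.det ≠ 0) : 0 < (bact f M).1 := by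
  apply bpos hN hd ha
  by_contra h
  push Not at h
  apply hM
  rw [Matrix.det_fin_two, h.1, h.2]; ring

/-- equivalence on `YF N` -/
def yrel (N : ℕ) (f g : YF N) : Prop := BQFEquiv f.1 g.1

theorem BQFEquiv_refl (f : BF) : BQFEquiv f f := (BQFEquiv_iff _ _).2 ⟨1, bact_one f⟩

theorem BQFEquiv_symm {f g : BF} (h : BQFEquiv f g) : BQFEquiv g f := by
  rw [BQFEquiv_iff] at *
  obtain ⟨M, rfl⟩ := h
  refine ⟨M⁻¹, ?_⟩
  rw [← bact_mul, ← Matrix.SpecialLinearGroup.coe_mul, mul_inv_cancel]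
  exact bact_one f

theorem BQFEquiv_trans {f g k : BF} (h : BQFEquiv f g) (h' : BQFEquiv g k) : BQFEquiv f k := by
  rw [BQFEquiv_iff] at *
  obtain ⟨M, rfl⟩ := h
  obtain ⟨M', rfl⟩ := h'
  exact ⟨M * M', by rw [Matrix.SpecialLinearGroup.coe_mul, bact_mul]⟩

theorem yrel_equiv (N : ℕ) : Equivalence (yrel N) :=
  ⟨fun f => BQFEquiv_refl f.1, fun h => BQFEquiv_symm h, fun h h' => BQFEquiv_trans h h'⟩

/-- number of isomorphisms -/
noncomputable def bhom (f g : BF) : ℕ :=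
  Nat.card {U : Matrix.SpecialLinearGroup (Fin 2) ℤ // bact f U.1 = g}

theorem bhom_of_equiv {f g : BF} (h : BQFEquiv f g) : bhom f g = bhom g g := by
  rw [BQFEquiv_iff] at h
  obtain ⟨M, hM⟩ := h
  refine Nat.card_congr
    { toFun := fun U => ⟨M⁻¹ * U.1, ?_⟩
      invFun := fun U => ⟨M * U.1, ?_⟩
      left_inv := fun U => by simp
      right_inv := fun U => by simp }
  · have hi : bact g (M⁻¹).1 = f := by
      rw [← hM, ← bact_mul, ← Matrix.SpecialLinearGroup.coe_mul, mul_inv_cancel]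
      exact bact_one f
    rw [Matrix.SpecialLinearGroup.coe_mul, bact_mul, hi, U.2]
  · rw [Matrix.SpecialLinearGroup.coe_mul, bact_mul, hM, U.2]

theorem bhom_of_equiv' {f g : BF} (h : BQFEquiv f g) : bhom f g = bhom f f := by
  rw [BQFEquiv_iff] at h
  obtain ⟨M, hM⟩ := h
  refine Nat.card_congr
    { toFun := fun U => ⟨U.1 * M⁻¹, ?_⟩
      invFun := fun U => ⟨U.1 * M, ?_⟩
      left_inv := fun U => by simp
      right_inv := fun U => by simp }
  · rw [Matrix.SpecialLinearGroup.coe_mul, bact_mul, U.2, ← hM, ← bact_mul,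
      ← Matrix.SpecialLinearGroup.coe_mul, mul_inv_cancel]
    simp [bact_one]
  · rw [Matrix.SpecialLinearGroup.coe_mul, bact_mul, U.2, hM]

theorem bhom_self_eq {f g : BF} (h : BQFEquiv f g) : bhom f f = bhom g g := by
  rw [← bhom_of_equiv h, bhom_of_equiv' h]

theorem bhom_of_not {f g : BF} (h : ¬ BQFEquiv f g) : bhom f g = 0 := by
  rw [BQFEquiv_iff] at h
  have : IsEmpty {U : Matrix.SpecialLinearGroup (Fin 2) ℤ // bact f U.1 = g} :=
    ⟨fun U => h ⟨U.1, U.2⟩⟩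
  exact Nat.card_of_isEmpty

theorem bfin_rep {f : BF} {N : ℕ} (hN : 0 < N) (hd : bdisc f = -(N : ℤ)) (ha : 0 < f.1) (m : ℤ) :
    {p : ℤ × ℤ | f.1 * p.1 ^ 2 + f.2.1 * p.1 * p.2 + f.2.2 * p.2 ^ 2 = m}.Finite := by
  unfold bdisc at hd
  set K : ℤ := 4 * f.1 * m with hK
  have hN' : (0 : ℤ) < N := by exact_mod_cast hN
  apply Set.Finite.subset ((Set.finite_Icc (-(K + |f.2.1| * K)) (K + |f.2.1| * K)).prod
    (Set.finite_Icc (-K) K))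
  rintro ⟨x, y⟩ h
  have h : f.1 * x ^ 2 + f.2.1 * x * y + f.2.2 * y ^ 2 = m := h
  have h1 : (2 * f.1 * x + f.2.1 * y) ^ 2 + N * y ^ 2 = K := by
    rw [hK, ← h]; linear_combination (y^2) * hd
  have hy : y ^ 2 ≤ K := by nlinarith [sq_nonneg (2 * f.1 * x + f.2.1 * y), sq_nonneg y]
  have hz : (2 * f.1 * x + f.2.1 * y) ^ 2 ≤ K := by nlinarith [sq_nonneg y]
  have aux : ∀ z : ℤ, z ^ 2 ≤ K → |z| ≤ K := by
    intro z hz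
    have := Int.le_self_sq |z|
    rw [sq_abs] at this
    linarith
  have hy' := aux _ hy
  have hz' := aux _ hz
  have hx : |x| ≤ K + |f.2.1| * K := by
    have e1 : |2 * f.1 * x| ≤ K + |f.2.1| * K := by
      calc |2 * f.1 * x| = |(2 * f.1 * x + f.2.1 * y) - f.2.1 * y| := by ring_nf
        _ ≤ |2 * f.1 * x + f.2.1 * y| + |f.2.1 * y| := abs_sub _ _
        _ ≤ K + |f.2.1| * K := by
          rw [abs_mul]
          exact add_le_add hz' (mul_le_mul_of_nonneg_left hy' (abs_nonneg _))
    have e2 : |x| ≤ |2 * f.1 * x| := by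
      rw [abs_mul]
      have : 1 ≤ |2 * f.1| := by rw [abs_of_pos] <;> linarith
      nlinarith [abs_nonneg x]
    linarith
  exact ⟨abs_le.1 hx, abs_le.1 hy'⟩

theorem bhom_finite {f : BF} {N : ℕ} (hN : 0 < N) (hd : bdisc f = -(N : ℤ)) (ha : 0 < f.1)
    (g : BF) : Finite {T : M2 // bact f T = g} := by
  have h1 := (bfin_rep hN hd ha g.1).to_subtype
  have h2 := (bfin_rep hN hd ha g.2.2).to_subtype
  refine Finite.of_injective (β := _ × _)
    (fun T : {T : M2 // bact f T = g} =>
      ((⟨(T.1 0 0, T.1 1 0), ?_⟩ :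
          {p : ℤ × ℤ | f.1 * p.1 ^ 2 + f.2.1 * p.1 * p.2 + f.2.2 * p.2 ^ 2 = g.1}),
        (⟨(T.1 0 1, T.1 1 1), ?_⟩ :
          {p : ℤ × ℤ | f.1 * p.1 ^ 2 + f.2.1 * p.1 * p.2 + f.2.2 * p.2 ^ 2 = g.2.2}))) ?_
  · have := congrArg Prod.fst T.2
    exact this
  · have := congrArg (fun x => x.2.2) T.2
    exact this
  · rintro ⟨T, hT⟩ ⟨S, hS⟩ h
    have e1 : T 0 0 = S 0 0 := congrArg (fun x => x.1.1.1) h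
    have e2 : T 1 0 = S 1 0 := congrArg (fun x => x.1.1.2) h
    have e3 : T 0 1 = S 0 1 := congrArg (fun x => x.2.1.1) h
    have e4 : T 1 1 = S 1 1 := congrArg (fun x => x.2.1.2) h
    apply Subtype.ext
    ext i j
    fin_cases i <;> fin_cases j <;> assumption

theorem bhom_finite' {f : BF} {N : ℕ} (hN : 0 < N) (hd : bdisc f = -(N : ℤ)) (ha : 0 < f.1)
    (g : BF) : Finite {U : Matrix.SpecialLinearGroup (Fin 2) ℤ // bact f U.1 = g} := by
  have := bhom_finite hN hd ha g
  refine Finite.of_injective (fun U => (⟨U.1.1, U.2⟩ : {T : M2 // bact f T = g})) ?_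
  intro U V h
  simp only [Subtype.mk.injEq] at h
  exact Subtype.ext (Subtype.ext h)

theorem bhom_pos {N : ℕ} (hN : 0 < N) (f : YF N) : 0 < bhom f.1 f.1 := by
  have := bhom_finite' hN f.2.1 f.2.2 f.1
  have : Nonempty {U : Matrix.SpecialLinearGroup (Fin 2) ℤ // bact f.1 U.1 = f.1} :=
    ⟨⟨1, bact_one _⟩⟩
  exact Nat.card_pos

/-- transport along an `SL₂` matrix -/
def yact {N : ℕ} (hN : 0 < N) (f : YF N) (U : Matrix.SpecialLinearGroup (Fin 2) ℤ) : YF N :=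
  ⟨bact f.1 U.1, by rw [bdisc_bact, U.2, f.2.1]; ring,
    bact_pos hN f.2.1 f.2.2 _ (by rw [U.2]; exact one_ne_zero)⟩

theorem yact_rel {N : ℕ} (hN : 0 < N) (f : YF N) (U : Matrix.SpecialLinearGroup (Fin 2) ℤ) :
    yrel N f (yact hN f U) := (BQFEquiv_iff _ _).2 ⟨U, rfl⟩

theorem y_finite {N : ℕ} (hN : 0 < N) : Finite (Quot (yrel N)) := by
  let S : Set BF := {f | f.1 ∈ Set.Icc (0 : ℤ) N ∧ f.2.1 ∈ Set.Icc (-(N : ℤ)) N ∧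
    f.2.2 ∈ Set.Icc (0 : ℤ) (N ^ 2 + N)}
  have hS : S.Finite := by
    apply Set.Finite.subset ((Set.finite_Icc (0 : ℤ) N).prod
      ((Set.finite_Icc (-(N : ℤ)) N).prod (Set.finite_Icc (0 : ℤ) (N ^ 2 + N))))
    rintro ⟨a, b, c⟩ h
    exact h
  have hfin : Finite {f : YF N // f.1 ∈ S} := by
    have := hS.to_subtype
    refine Finite.of_injective (fun f : {f : YF N // f.1 ∈ S} => (⟨f.1.1, f.2⟩ : S)) ?_
    intro f g h
    simp only [Subtype.mk.injEq] at h
    exact Subtype.ext (Subtype.ext h)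
  refine Finite.of_surjective (fun f : {f : YF N // f.1 ∈ S} => Quot.mk (yrel N) f.1) ?_
  intro c
  obtain ⟨f, rfl⟩ := Quot.exists_rep c
  -- choose minimal leading coefficient
  have hex : ∃ m : ℕ, ∃ g : YF N, yrel N f g ∧ g.1.1.toNat = m := ⟨_, f, BQFEquiv_refl _, rfl⟩
  obtain ⟨g, hfg, hg⟩ := Nat.find_spec hex
  have hmin : ∀ k : YF N, yrel N f k → g.1.1 ≤ k.1.1 := by
    intro k hk
    have := Nat.find_min' hex ⟨k, hk, rfl⟩
    rw [← hg] at this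
    have h1 := k.2.2
    have h2 := g.2.2
    omega
  -- translate
  obtain ⟨t, ht⟩ : ∃ t : ℤ, |g.1.2.1 + 2 * g.1.1 * t| ≤ g.1.1 := by
    have h2 := g.2.2
    refine ⟨-((g.1.2.1 + g.1.1) / (2 * g.1.1)), ?_⟩
    have e := Int.emod_add_mul_ediv (g.1.2.1 + g.1.1) (2 * g.1.1)
    have e1 := Int.emod_nonneg (g.1.2.1 + g.1.1) (show 2 * g.1.1 ≠ 0 by omega)
    have e2 := Int.emod_lt_of_pos (g.1.2.1 + g.1.1) (show 0 < 2 * g.1.1 by omega)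
    rw [abs_le]
    constructor <;> linarith
  let U : Matrix.SpecialLinearGroup (Fin 2) ℤ := ⟨!![1, t; 0, 1], by simp [Matrix.det_fin_two]⟩
  let k := yact hN g U
  have hfk : yrel N f k := BQFEquiv_trans hfg (yact_rel hN g U)
  let V : Matrix.SpecialLinearGroup (Fin 2) ℤ := ⟨!![0, -1; 1, 0], by simp [Matrix.det_fin_two]⟩
  have hfl : yrel N f (yact hN k V) := BQFEquiv_trans hfk (yact_rel hN k V)
  have k1 : k.1.1 = g.1.1 := by simp [k, yact, bact, U]
  have k2 : k.1.2.1 = g.1.2.1 + 2 * g.1.1 * t := by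
    simp [k, yact, bact, U]; ring
  have l1 : (yact hN k V).1.1 = k.1.2.2 := by simp [yact, bact, V]
  have hac : k.1.1 ≤ k.1.2.2 := by rw [← l1, k1]; exact hmin _ hfl
  have hba : |k.1.2.1| ≤ k.1.1 := by rw [k1, k2]; exact ht
  have hd := k.2.1
  have ha := k.2.2
  unfold bdisc at hd
  refine ⟨⟨k, ?_⟩, (Quot.sound hfk).symm⟩
  rcases k with ⟨⟨a, b, c⟩, hk⟩
  simp only at hac hba hd ha
  have hb2 : b ^ 2 ≤ a ^ 2 := sq_le_sq' (by linarith [(abs_le.1 hba).1]) (abs_le.1 hba).2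
  have haN : a ≤ N := by nlinarith
  have := abs_le.1 hba
  refine ⟨⟨ha.le, haN⟩, ⟨?_, ?_⟩, ⟨?_, ?_⟩⟩ <;> simp only <;> try linarith
  nlinarith

/-- scaling -/
def bscale (k : ℤ) (f : BF) : BF := (k * f.1, k * f.2.1, k * f.2.2)

theorem bact_bscale (k : ℤ) (f : BF) (M : M2) : bact (bscale k f) M = bscale k (bact f M) := by
  unfold bact bscale
  refine Prod.ext ?_ (Prod.ext ?_ ?_) <;> simp only <;> ring

theorem bscale_inj {k : ℤ} (hk : k ≠ 0) {f g : BF} (h : bscale k f = bscale k g) : f = g := by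
  unfold bscale at h
  simp only [Prod.mk.injEq] at h
  obtain ⟨h1, h2, h3⟩ := h
  exact Prod.ext (mul_left_cancel₀ hk h1)
    (Prod.ext (mul_left_cancel₀ hk h2) (mul_left_cancel₀ hk h3))

theorem bdisc_bscale (k : ℤ) (f : BF) : bdisc (bscale k f) = k ^ 2 * bdisc f := by
  unfold bdisc bscale; ring

theorem equiv_bscale {k : ℤ} (hk : k ≠ 0) (f g : BF) :
    BQFEquiv f g ↔ BQFEquiv (bscale k f) (bscale k g) := by
  simp only [BQFEquiv_iff]
  constructor
  · rintro ⟨M, rfl⟩; exact ⟨M, bact_bscale _ _ _⟩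
  · rintro ⟨M, h⟩; rw [bact_bscale] at h; exact ⟨M, bscale_inj hk h⟩

theorem bhom_bscale {k : ℤ} (hk : k ≠ 0) (f g : BF) :
    bhom (bscale k f) (bscale k g) = bhom f g := by
  unfold bhom
  refine Nat.card_congr (Equiv.subtypeEquivRight fun U => ?_)
  rw [bact_bscale]
  exact ⟨fun h => bscale_inj hk h, fun h => by rw [h]⟩

/-- divisibility of a form -/
def bdvd (k : ℤ) (f : BF) : Prop := k ∣ f.1 ∧ k ∣ f.2.1 ∧ k ∣ f.2.2

theorem bdvd_iff (k : ℤ) (f : BF) : bdvd k f ↔ ∃ g, f = bscale k g := by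
  unfold bdvd bscale
  constructor
  · rintro ⟨⟨a, ha⟩, ⟨b, hb⟩, ⟨c, hc⟩⟩
    exact ⟨(a, b, c), Prod.ext ha (Prod.ext hb hc)⟩
  · rintro ⟨g, rfl⟩
    exact ⟨⟨_, rfl⟩, ⟨_, rfl⟩, ⟨_, rfl⟩⟩

theorem bdvd_bact {k : ℤ} {f : BF} (h : bdvd k f) (M : M2) : bdvd k (bact f M) := by
  rw [bdvd_iff] at *
  obtain ⟨g, rfl⟩ := h
  exact ⟨_, bact_bscale _ _ _⟩

theorem bdvd_equiv {k : ℤ} {f g : BF} (h : BQFEquiv f g) : bdvd k f ↔ bdvd k g := by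
  have key : ∀ f g : BF, BQFEquiv f g → bdvd k f → bdvd k g := by
    intro f g h h1
    rw [BQFEquiv_iff] at h
    obtain ⟨M, rfl⟩ := h
    exact bdvd_bact h1 _
  exact ⟨key _ _ h, key _ _ (BQFEquiv_symm h)⟩

/-- content -/
def bcont (f : BF) : ℕ := Int.gcd f.1 (Int.gcd f.2.1 f.2.2)

theorem bcont_dvd_iff (k : ℕ) (f : BF) : k ∣ bcont f ↔ bdvd k f := by
  unfold bcont bdvd
  rw [Int.dvd_gcd_iff, Int.natCast_dvd_natCast, Int.dvd_gcd_iff]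

theorem bcont_equiv {f g : BF} (h : BQFEquiv f g) : bcont f = bcont g := by
  apply Nat.dvd_antisymm
  · rw [bcont_dvd_iff, ← bdvd_equiv h, ← bcont_dvd_iff]
  · rw [bcont_dvd_iff, bdvd_equiv h, ← bcont_dvd_iff]

theorem bcont_bscale (k : ℕ) (f : BF) : bcont (bscale k f) = k * bcont f := by
  unfold bcont bscale
  simp only [Int.gcd_mul_left, Int.natAbs_natCast, Nat.cast_mul]

/-- solutions of the Pell-type equation -/
theorem card_pell (N : ℕ) (hN : 3 ≤ N) :
    Nat.card {p : ℤ × ℤ // p.1 ^ 2 + N * p.2 ^ 2 = 4} = wAut (-(N : ℤ)) := by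
  have bound : ∀ t u : ℤ, t ^ 2 + N * u ^ 2 = 4 → (-2 ≤ t ∧ t ≤ 2) ∧ (-1 ≤ u ∧ u ≤ 1) := by
    intro t u h
    have hN' : (3 : ℤ) ≤ N := by exact_mod_cast hN
    have h1 : t ^ 2 ≤ 4 := by nlinarith [sq_nonneg u]
    have h2 : u ^ 2 ≤ 1 := by nlinarith [sq_nonneg t]
    refine ⟨⟨by nlinarith, by nlinarith⟩, ⟨by nlinarith, by nlinarith⟩⟩
  unfold wAut
  by_cases h3 : N = 3
  · subst h3
    have : {p : ℤ × ℤ | p.1 ^ 2 + (3 : ℕ) * p.2 ^ 2 = 4} =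
        (({(2, 0), (-2, 0), (1, 1), (1, -1), (-1, 1), (-1, -1)} : Finset (ℤ × ℤ)) : Set _) := by
      ext ⟨t, u⟩
      simp only [Set.mem_ofPred_eq, Finset.coe_insert, Finset.coe_singleton, Set.mem_insert_iff,
        Set.mem_singleton_iff, Prod.mk.injEq]
      constructor
      · intro h
        obtain ⟨⟨a, b⟩, c, d⟩ := bound t u h
        interval_cases t <;> interval_cases u <;> simp_all
      · rintro (⟨rfl, rfl⟩ | ⟨rfl, rfl⟩ | ⟨rfl, rfl⟩ | ⟨rfl, rfl⟩ | ⟨rfl, rfl⟩ | ⟨rfl, rfl⟩) <;> norm_num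
    have h' := congrArg Set.ncard this
    rw [Set.ncard_coe_finset] at h'
    exact h'.trans (by decide)
  by_cases h4 : N = 4
  · subst h4
    have : {p : ℤ × ℤ | p.1 ^ 2 + (4 : ℕ) * p.2 ^ 2 = 4} =
        (({(2, 0), (-2, 0), (0, 1), (0, -1)} : Finset (ℤ × ℤ)) : Set _) := by
      ext ⟨t, u⟩
      simp only [Set.mem_ofPred_eq, Finset.coe_insert, Finset.coe_singleton, Set.mem_insert_iff,
        Set.mem_singleton_iff, Prod.mk.injEq]
      constructor
      · intro h
        obtain ⟨⟨a, b⟩, c, d⟩ := bound t u h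
        interval_cases t <;> interval_cases u <;> simp_all
      · rintro (⟨rfl, rfl⟩ | ⟨rfl, rfl⟩ | ⟨rfl, rfl⟩ | ⟨rfl, rfl⟩) <;> norm_num
    have h' := congrArg Set.ncard this
    rw [Set.ncard_coe_finset] at h'
    exact h'.trans (by decide)
  · rw [if_neg (by omega), if_neg (by omega)]
    have : {p : ℤ × ℤ | p.1 ^ 2 + N * p.2 ^ 2 = 4} =
        (({(2, 0), (-2, 0)} : Finset (ℤ × ℤ)) : Set _) := by
      ext ⟨t, u⟩
      simp only [Set.mem_ofPred_eq, Finset.coe_insert, Finset.coe_singleton, Set.mem_insert_iff,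
        Set.mem_singleton_iff, Prod.mk.injEq]
      constructor
      · intro h
        obtain ⟨⟨a, b⟩, c, d⟩ := bound t u h
        have hN5 : (5 : ℤ) ≤ N := by omega
        have hu : u = 0 := by
          by_contra hu
          have : 1 ≤ u ^ 2 := by have := sq_pos_of_ne_zero hu; omega
          nlinarith [sq_nonneg t]
        subst hu
        interval_cases t <;> simp_all
      · rintro (⟨rfl, rfl⟩ | ⟨rfl, rfl⟩) <;> norm_num
    have h' := congrArg Set.ncard this
    rw [Set.ncard_coe_finset] at h'
    exact h'.trans (by decide)

theorem bhom_prim {N : ℕ} (hN : 0 < N) {f : BF} (hf : IsPrimPosDefBQF (-(N : ℤ)) f) :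
    bhom f f = wAut (-(N : ℤ)) := by
  obtain ⟨hd, hg, ha⟩ := hf
  rcases f with ⟨a, b, c⟩
  simp only at hd hg ha
  have hN3 : 3 ≤ N := by
    have h4 : b ^ 2 % 4 = 0 ∨ b ^ 2 % 4 = 1 := by
      rcases Int.emod_two_eq_zero_or_one b with h | h
      · left
        obtain ⟨k, rfl⟩ := Int.dvd_of_emod_eq_zero h
        rw [show (2 * k) ^ 2 = 4 * (k ^ 2) by ring]; simp
      · right
        have : b = 2 * (b / 2) + 1 := by omega
        rw [this, show (2 * (b / 2) + 1) ^ 2 = 4 * ((b / 2) ^ 2 + b / 2) + 1 by ring]; omega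
    have : b ^ 2 - 4 * (a * c) = -(N : ℤ) := by rw [← hd]; ring
    generalize b ^ 2 = B at *
    generalize a * c = C at *
    omega
  rw [← card_pell N hN3]
  have par : ∀ t u : ℤ, t ^ 2 + N * u ^ 2 = 4 → 2 ∣ t - b * u := by
    intro t u h
    have h1 : 2 ∣ (t - b * u) ^ 2 := by
      have : (t - b * u) ^ 2 = 2 * (2 - 2 * a * c * u ^ 2 - t * b * u + b ^ 2 * u ^ 2) := by
        linear_combination h - u ^ 2 * hd
      rw [this]; exact Dvd.intro _ rfl
    exact Int.prime_two.dvd_of_dvd_pow h1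
  -- key : shape of automorphs
  have key : ∀ U : Matrix.SpecialLinearGroup (Fin 2) ℤ, bact (a, b, c) U.1 = (a, b, c) →
      ∃ u, U.1 1 0 = a * u ∧ U.1 0 1 = -c * u ∧ U.1 0 0 - U.1 1 1 = - b * u := by
    intro U hU
    have hdet := U.2
    rw [Matrix.det_fin_two] at hdet
    unfold bact at hU
    simp only [Prod.mk.injEq] at hU
    obtain ⟨h1, h2, h3⟩ := hU
    generalize U.1 0 0 = p at *
    generalize U.1 0 1 = r at *
    generalize U.1 1 0 = s at *
    generalize U.1 1 1 = t at *
    have e1 : 2 * (a * (p - t) + b * s) = 0 := by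
      linear_combination 2 * t * h1 - s * h2 - (2 * a * p + b * s) * hdet
    have e2 : 2 * (a * r + s * c) = 0 := by
      linear_combination t * h2 - 2 * s * h3 - (2 * a * r + b * t) * hdet
    have e1' : a * (p - t) + b * s = 0 := by linarith
    have e2' : a * r + s * c = 0 := by linarith
    have e3 : a ∣ s := by
      have hco : IsCoprime a (Int.gcd b c : ℤ) := Int.isCoprime_iff_gcd_eq_one.2 hg
      apply hco.dvd_of_dvd_mul_left
      rw [Int.gcd_eq_gcd_ab b c, add_mul]
      apply dvd_add
      · exact ⟨-(p - t) * Int.gcdA b c, by linear_combination (Int.gcdA b c) * e1'⟩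
      · exact ⟨-r * Int.gcdB b c, by linear_combination (Int.gcdB b c) * e2'⟩
    obtain ⟨u, rfl⟩ := e3
    refine ⟨u, rfl, ?_, ?_⟩
    · apply mul_left_cancel₀ ha.ne'
      linarith
    · apply mul_left_cancel₀ ha.ne'
      linarith
  choose! g hg1 hg2 hg3 using key
  have hpell : ∀ U : Matrix.SpecialLinearGroup (Fin 2) ℤ, bact (a, b, c) U.1 = (a, b, c) →
      (U.1 0 0 + U.1 1 1) ^ 2 + N * (g U) ^ 2 = 4 := by
    intro U hU
    have hdet := U.2
    rw [Matrix.det_fin_two] at hdet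
    have e1 := hg1 U hU
    have e2 := hg2 U hU
    have e3 := hg3 U hU
    rw [e1, e2] at hdet
    linear_combination 4 * hdet + (g U) ^ 2 * hd + (U.1 0 0 - U.1 1 1 - b * g U) * e3
  refine Nat.card_congr (Equiv.ofBijective
    (fun U : {U : Matrix.SpecialLinearGroup (Fin 2) ℤ // bact (a, b, c) U.1 = (a, b, c)} =>
      (⟨(U.1.1 0 0 + U.1.1 1 1, g U.1), hpell U.1 U.2⟩ :
        {p : ℤ × ℤ // p.1 ^ 2 + N * p.2 ^ 2 = 4})) ⟨?_, ?_⟩)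
  · rintro ⟨U, hU⟩ ⟨V, hV⟩ h
    have h1 : U.1 0 0 + U.1 1 1 = V.1 0 0 + V.1 1 1 := congrArg (fun x => x.1.1) h
    have h2 : g U = g V := congrArg (fun x => x.1.2) h
    have u1 := hg1 U hU
    have u2 := hg2 U hU
    have u3 := hg3 U hU
    have v1 := hg1 V hV
    have v2 := hg2 V hV
    have v3 := hg3 V hV
    rw [h2] at u1 u2 u3
    have w1 : U.1 1 0 = V.1 1 0 := by rw [u1, v1]
    have w2 : U.1 0 1 = V.1 0 1 := by rw [u2, v2]
    have w3 : U.1 0 0 = V.1 0 0 := by linarith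
    have w4 : U.1 1 1 = V.1 1 1 := by linarith
    apply Subtype.ext
    apply Subtype.ext
    ext i j
    fin_cases i <;> fin_cases j <;> assumption
  · rintro ⟨⟨t, u⟩, h⟩
    simp only at h
    obtain ⟨k, hk⟩ := par t u h
    have hkk : 2 * (k + b * u) = t + b * u := by linear_combination -hk
    have ht : t = 2 * k + b * u := by linear_combination hk
    subst ht
    have hq : k * (k + b * u) + a * c * u ^ 2 = 1 := by
      have : 4 * (k * (k + b * u) + a * c * u ^ 2) = 4 * 1 := by
        linear_combination h - u ^ 2 * hd
      exact mul_left_cancel₀ (by norm_num) this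
    let U : Matrix.SpecialLinearGroup (Fin 2) ℤ := ⟨!![k, -c * u; a * u, k + b * u], by
      rw [Matrix.det_fin_two]
      simp
      linear_combination hq⟩
    have hU : bact (a, b, c) U.1 = (a, b, c) := by
      simp only [bact, U, Matrix.of_apply, Matrix.cons_val_zero, Matrix.cons_val_one,
        Matrix.cons_val', Matrix.cons_val_fin_one, Prod.mk.injEq]
      refine ⟨?_, ?_, ?_⟩
      · linear_combination a * hq
      · linear_combination b * hq
      · linear_combination c * hq
    refine ⟨⟨U, hU⟩, ?_⟩
    apply Subtype.ext
    refine Prod.ext ?_ ?_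
    · simp [U]; ring
    · have := hg1 U hU
      have e : U.1 1 0 = a * u := by simp [U]
      rw [e] at this
      exact (mul_left_cancel₀ ha.ne' this).symm

/-- weighted count of classes of forms of discriminant `-N` -/
noncomputable def WB (N : ℕ) : ℝ := csum (yrel N) (fun f => bhom f.1 f.1) (fun _ => 1)

theorem bcont_sq {N : ℕ} (f : YF N) : bcont f.1 ^ 2 ∣ N := by
  have h : bdvd (bcont f.1 : ℤ) f.1 := (bcont_dvd_iff _ _).1 dvd_rfl
  rw [bdvd_iff] at h
  obtain ⟨g, hg⟩ := h
  have h2 := f.2.1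
  generalize hk : bcont f.1 = k at *
  rw [hg, bdisc_bscale] at h2
  have : ((k ^ 2 : ℕ) : ℤ) ∣ (N : ℤ) := ⟨- bdisc g, by push_cast; linarith⟩
  exact_mod_cast this

theorem primrel_equiv (d : ℤ) :
    Equivalence (fun f g : {f : ℤ × ℤ × ℤ // IsPrimPosDefBQF d f} => BQFEquiv f.1 g.1) :=
  ⟨fun f => BQFEquiv_refl f.1, fun h => BQFEquiv_symm h, fun h h' => BQFEquiv_trans h h'⟩

theorem prim_finite {N : ℕ} (hN : 0 < N) :
    Finite (Quot (fun f g : {f : ℤ × ℤ × ℤ // IsPrimPosDefBQF (-(N : ℤ)) f} =>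
      BQFEquiv f.1 g.1)) := by
  have := y_finite hN
  refine Finite.of_injective (β := Quot (yrel N))
    (fun c => Quot.mk (yrel N) ⟨c.out.1, c.out.2.1, c.out.2.2.2⟩) ?_
  intro c c' h
  have h1 := quot_rel (yrel_equiv N) h
  rw [← Quot.out_eq c, ← Quot.out_eq c']
  exact Quot.sound h1

theorem csum_prim {N : ℕ} (hN : 0 < N) :
    csum (fun f g : {f : ℤ × ℤ × ℤ // IsPrimPosDefBQF (-(N : ℤ)) f} => BQFEquiv f.1 g.1)
      (fun f => bhom f.1 f.1) (fun _ => 1) = (classNum (-(N : ℤ)) : ℝ) / wAut (-(N : ℤ)) := by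
  have := prim_finite hN
  unfold csum classNum
  haveI := Fintype.ofFinite (Quot (fun f g : {f : ℤ × ℤ × ℤ // IsPrimPosDefBQF (-(N : ℤ)) f} =>
      BQFEquiv f.1 g.1))
  rw [finsum_eq_sum_of_fintype]
  simp only [fun c : Quot (fun f g : {f : ℤ × ℤ × ℤ // IsPrimPosDefBQF (-(N : ℤ)) f} =>
      BQFEquiv f.1 g.1) => bhom_prim hN c.out.2]
  rw [Finset.sum_const, Nat.card_eq_fintype_card, Finset.card_univ,
    nsmul_eq_mul]
  ring

theorem csum_cont {N : ℕ} (hN : 0 < N) (k : ℕ) (hk : k ^ 2 ∣ N) :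
    csum (yrel N) (fun f => bhom f.1 f.1) (fun f => if bcont f.1 = k then 1 else 0) =
      (classNum (-((N / k ^ 2 : ℕ) : ℤ)) : ℝ) / wAut (-((N / k ^ 2 : ℕ) : ℤ)) := by
  obtain ⟨m, rfl⟩ := hk
  have hk0 : 0 < k := by
    rcases Nat.eq_zero_or_pos k with h | h
    · subst h; simp at hN
    · exact h
  have hk2 : 0 < k ^ 2 := by positivity
  have hm : 0 < m := by
    rcases Nat.eq_zero_or_pos m with h | h
    · subst h; simp at hN
    · exact h
  rw [Nat.mul_div_cancel_left _ hk2, ← csum_prim hm]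
  have := prim_finite hm
  have := y_finite hN
  have hkz : (k : ℤ) ≠ 0 := by exact_mod_cast hk0.ne'
  symm
  refine csum_reindex (primrel_equiv _) (yrel_equiv _)
    (fun f => ⟨bscale k f.1, ?_, ?_⟩) ?_ ?_ ?_ ?_ ?_ ?_ ?_ ?_
  · rw [bdisc_bscale]
    have := f.2.1
    unfold bdisc
    rw [this]; push_cast; ring
  · have := f.2.2.2
    show 0 < (k : ℤ) * f.1.1
    have hkp : (0 : ℤ) < k := by exact_mod_cast hk0
    positivity
  · intro x y h; exact bhom_self_eq h
  · intro x y h; rfl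
  · intro x y h; exact bhom_self_eq h
  · intro x y h
    show (if bcont x.1 = k then (1 : ℝ) else 0) = (if bcont y.1 = k then (1 : ℝ) else 0)
    rw [bcont_equiv h]
  · intro x y; exact equiv_bscale hkz _ _
  · intro x; exact bhom_bscale hkz _ _
  · intro x
    simp only
    rw [bcont_bscale, if_pos]
    have := x.2.2.1
    unfold bcont
    rw [this, mul_one]
  · intro y hy
    rw [if_neg]
    intro hc
    have h : bdvd (k : ℤ) y.1 := (bcont_dvd_iff _ _).1 (by rw [hc])
    rw [bdvd_iff] at h
    obtain ⟨g, hg⟩ := h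
    have hd := y.2.1
    have hp := y.2.2
    rw [hg] at hd hp hc
    rw [bdisc_bscale] at hd
    rw [bcont_bscale] at hc
    refine hy ⟨g, ?_, ?_, ?_⟩ ?_
    · have : (k : ℤ) ^ 2 * bdisc g = k ^ 2 * (-(m : ℤ)) := by rw [hd]; push_cast; ring
      exact mul_left_cancel₀ (pow_ne_zero 2 hkz) this
    · exact Nat.eq_of_mul_eq_mul_left hk0 (by rw [mul_one]; exact hc)
    · have hkp : (0 : ℤ) < k := by exact_mod_cast hk0
      exact pos_of_mul_pos_right hp hkp.le
    · show BQFEquiv y.1 (bscale k g)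
      rw [hg]; exact BQFEquiv_refl _

theorem hurwitz_eq {N : ℕ} (hN : 0 < N) (h4 : N % 4 = 0 ∨ N % 4 = 3) :
    ((hurwitzNat N : ℚ) : ℝ) = 2 * WB N := by
  unfold hurwitzNat
  rw [if_pos ⟨hN, h4⟩]
  have := y_finite hN
  have h1 : WB N = ∑ k ∈ N.divisors.filter fun f => f ^ 2 ∣ N,
      csum (yrel N) (fun f => bhom f.1 f.1) (fun f => if bcont f.1 = k then 1 else 0) := by
    rw [← csum_sum]
    unfold WB
    apply csum_congr
    intro f
    rw [Finset.sum_ite_eq, if_pos]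
    have := bcont_sq f
    rw [Finset.mem_filter, Nat.mem_divisors]
    exact ⟨⟨(Dvd.intro_left (bcont f.1) (by ring)).trans this, hN.ne'⟩, this⟩
  rw [h1, Finset.mul_sum]
  push_cast
  apply Finset.sum_congr rfl
  intro k hk
  rw [csum_cont hN k (Finset.mem_filter.1 hk).2]
  push_cast
  rw [div_div_eq_mul_div]
  ring

theorem csum_bdvd {M : ℕ} (hM : 0 < M) (k : ℕ) (hk0 : 0 < k) (N : ℕ) (hN : N = k ^ 2 * M) :
    csum (yrel N) (fun f => bhom f.1 f.1) (fun f => if bdvd k f.1 then 1 else 0) = WB M := by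
  have hN0 : 0 < N := by rw [hN]; positivity
  have := y_finite hN0
  have := y_finite hM
  have hkz : (k : ℤ) ≠ 0 := by exact_mod_cast hk0.ne'
  have hkp : (0 : ℤ) < k := by exact_mod_cast hk0
  symm
  unfold WB
  refine csum_reindex (yrel_equiv _) (yrel_equiv _)
    (fun f => ⟨bscale k f.1, ?_, ?_⟩) ?_ ?_ ?_ ?_ ?_ ?_ ?_ ?_
  · rw [bdisc_bscale]
    have := f.2.1
    rw [this, hN]; push_cast; ring
  · have := f.2.2
    show 0 < (k : ℤ) * f.1.1
    positivity
  · intro x y h; exact bhom_self_eq h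
  · intro x y h; rfl
  · intro x y h; exact bhom_self_eq h
  · intro x y h
    show (if bdvd k x.1 then (1 : ℝ) else 0) = (if bdvd k y.1 then (1 : ℝ) else 0)
    simp only [bdvd_equiv h]
  · intro x y; exact equiv_bscale hkz _ _
  · intro x; exact bhom_bscale hkz _ _
  · intro x
    simp only
    rw [if_pos]
    rw [bdvd_iff]; exact ⟨_, rfl⟩
  · intro y hy
    rw [if_neg]
    intro h
    rw [bdvd_iff] at h
    obtain ⟨g, hg⟩ := h
    have hd := y.2.1
    have hp := y.2.2
    rw [hg] at hd hp
    rw [bdisc_bscale] at hd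
    refine hy ⟨g, ?_, ?_⟩ ?_
    · have : (k : ℤ) ^ 2 * bdisc g = k ^ 2 * (-(M : ℤ)) := by rw [hd, hN]; push_cast; ring
      exact mul_left_cancel₀ (pow_ne_zero 2 hkz) this
    · exact pos_of_mul_pos_right hp hkp.le
    · show BQFEquiv y.1 (bscale k g)
      rw [hg]; exact BQFEquiv_refl _

/-- representatives of determinant `q` matrices -/
def TQ (q : ℕ) : Option (ZMod q) → M2
  | none => !![1, 0; 0, (q : ℤ)]
  | some s => !![(q : ℤ), (s.val : ℤ); 0, 1]

theorem TQ_det (q : ℕ) (j : Option (ZMod q)) : (TQ q j).det = q := by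
  cases j <;> simp [TQ, Matrix.det_fin_two]

section
variable {q : ℕ} [hq : Fact q.Prime]

theorem m2_mul_eq {M N : M2} (h00 : M 0 0 = N 0 0) (h01 : M 0 1 = N 0 1) (h10 : M 1 0 = N 1 0)
    (h11 : M 1 1 = N 1 1) : M = N := by
  ext i j
  fin_cases i <;> fin_cases j <;> assumption

theorem TQ_cover (T : M2) (hT : T.det = q) :
    ∃ j, ∃ U : Matrix.SpecialLinearGroup (Fin 2) ℤ, TQ q j * U.1 = T := by
  have hqp := hq.out
  have hq0 : (q : ℤ) ≠ 0 := by exact_mod_cast hqp.ne_zero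
  rw [Matrix.det_fin_two] at hT
  by_cases hc : (q : ℤ) ∣ T 1 0 ∧ (q : ℤ) ∣ T 1 1
  · obtain ⟨⟨c, hc⟩, ⟨d, hd⟩⟩ := hc
    refine ⟨none, ⟨!![T 0 0, T 0 1; c, d], ?_⟩, ?_⟩
    · rw [Matrix.det_fin_two]
      simp
      apply mul_left_cancel₀ hq0
      rw [hc, hd] at hT
      linear_combination hT
    · apply m2_mul_eq <;> simp [TQ, Matrix.mul_apply, Fin.sum_univ_two, hc, hd]
  · -- find s
    have key : ∃ s : ZMod q, (T 0 0 : ZMod q) = s * (T 1 0 : ZMod q) ∧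
        (T 0 1 : ZMod q) = s * (T 1 1 : ZMod q) := by
      have h0 : (T 0 0 : ZMod q) * T 1 1 - T 0 1 * T 1 0 = 0 := by
        have := congrArg (Int.cast : ℤ → ZMod q) hT
        push_cast at this
        rw [this]; simp
      by_cases h1 : (T 1 0 : ZMod q) = 0
      · have h2 : (T 1 1 : ZMod q) ≠ 0 := by
          intro h2
          exact hc ⟨(ZMod.intCast_zmod_eq_zero_iff_dvd _ _).1 h1,
            (ZMod.intCast_zmod_eq_zero_iff_dvd _ _).1 h2⟩
        refine ⟨T 0 1 / T 1 1, ?_, ?_⟩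
        · rw [h1] at h0 ⊢
          rw [mul_zero, sub_zero] at h0
          rw [mul_zero]
          exact (mul_eq_zero.1 h0).resolve_right h2
        · field_simp
      · refine ⟨T 0 0 / T 1 0, ?_, ?_⟩
        · field_simp
        · field_simp
          linear_combination -h0
    obtain ⟨s, h1, h2⟩ := key
    have h1' : (q : ℤ) ∣ T 0 0 - s.val * T 1 0 := by
      rw [← ZMod.intCast_zmod_eq_zero_iff_dvd]
      push_cast
      rw [ZMod.natCast_val, ZMod.cast_id', id, h1]; ring
    have h2' : (q : ℤ) ∣ T 0 1 - s.val * T 1 1 := by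
      rw [← ZMod.intCast_zmod_eq_zero_iff_dvd]
      push_cast
      rw [ZMod.natCast_val, ZMod.cast_id', id, h2]; ring
    obtain ⟨a, ha⟩ := h1'
    obtain ⟨b, hb⟩ := h2'
    refine ⟨some s, ⟨!![a, b; T 1 0, T 1 1], ?_⟩, ?_⟩
    · rw [Matrix.det_fin_two]
      simp
      apply mul_left_cancel₀ hq0
      linear_combination hT - T 1 1 * ha + T 1 0 * hb
    · apply m2_mul_eq <;> simp [TQ, Matrix.mul_apply, Fin.sum_univ_two, -ZMod.natCast_val]
      · linarith
      · linarith

theorem TQ_inj {j k : Option (ZMod q)} {U V : Matrix.SpecialLinearGroup (Fin 2) ℤ}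
    (h : TQ q j * U.1 = TQ q k * V.1) : j = k ∧ U = V := by
  have hqp := hq.out
  have hq0 : (q : ℤ) ≠ 0 := by exact_mod_cast hqp.ne_zero
  have hj : j = k := by
    have hV : TQ q k = TQ q j * (U * V⁻¹).1 := by
      rw [Matrix.SpecialLinearGroup.coe_mul, ← Matrix.mul_assoc, h, Matrix.mul_assoc,
        ← Matrix.SpecialLinearGroup.coe_mul, mul_inv_cancel, Matrix.SpecialLinearGroup.coe_one,
        Matrix.mul_one]
    generalize (U * V⁻¹).1 = P at hV
    have hn1 : ¬ (q : ℤ) ∣ 1 := by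
      intro h; exact (Nat.prime_iff_prime_int.1 hqp).not_unit (isUnit_of_dvd_one h)
    have e00 := congrFun (congrFun hV 0) 0
    have e01 := congrFun (congrFun hV 0) 1
    have e10 := congrFun (congrFun hV 1) 0
    have e11 := congrFun (congrFun hV 1) 1
    rcases j with _ | s <;> rcases k with _ | t
    · rfl
    · exfalso
      simp [TQ, Matrix.mul_apply, Fin.sum_univ_two] at e11
      exact hn1 ⟨_, e11⟩
    · exfalso
      simp [TQ, Matrix.mul_apply, Fin.sum_univ_two] at e00 e10
      rw [← e10] at e00
      exact hn1 ⟨P 0 0, by linarith⟩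
    · simp [TQ, Matrix.mul_apply, Fin.sum_univ_two] at e01 e11
      rw [← e11] at e01
      congr 1
      have := congrArg (Int.cast : ℤ → ZMod q) e01
      push_cast at this
      simp at this
      exact this.symm
  subst hj
  refine ⟨rfl, Subtype.ext ?_⟩
  have h2 := congrArg (fun M => (TQ q j).adjugate * M) h
  simp only [← Matrix.mul_assoc, Matrix.adjugate_mul, TQ_det, Matrix.smul_mul,
    Matrix.one_mul] at h2
  exact smul_right_injective _ hq0 h2

/-- number of determinant `q` maps -/
noncomputable def NQ (q : ℕ) (f g : BF) : ℕ := Nat.card {T : M2 // T.det = q ∧ bact f T = g}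

theorem NQ_eq {N : ℕ} (hN : 0 < N) {f : BF} (hd : bdisc f = -(N : ℤ)) (ha : 0 < f.1) (g : BF) :
    NQ q f g = ∑ j, bhom (bact f (TQ q j)) g := by
  have hqp := hq.out
  have hfin := bhom_finite hN hd ha g
  have e : (Σ j, {U : Matrix.SpecialLinearGroup (Fin 2) ℤ // bact (bact f (TQ q j)) U.1 = g}) ≃
      {T : M2 // T.det = q ∧ bact f T = g} := by
    refine Equiv.ofBijective (fun x => ⟨TQ q x.1 * x.2.1.1, ?_, ?_⟩) ⟨?_, ?_⟩
    · rw [Matrix.det_mul, TQ_det, x.2.1.2, mul_one]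
    · rw [bact_mul]; exact x.2.2
    · rintro ⟨j, U, hU⟩ ⟨k, V, hV⟩ h
      simp only [Subtype.mk.injEq] at h
      obtain ⟨rfl, rfl⟩ := TQ_inj h
      rfl
    · rintro ⟨T, h1, h2⟩
      obtain ⟨j, U, rfl⟩ := TQ_cover T h1
      exact ⟨⟨j, U, by rw [← bact_mul]; exact h2⟩, rfl⟩
  unfold NQ
  rw [← Nat.card_congr e]
  have : ∀ j, Finite {U : Matrix.SpecialLinearGroup (Fin 2) ℤ // bact (bact f (TQ q j)) U.1 = g} := by
    intro j
    refine Finite.of_injective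
      (fun U => (⟨TQ q j * U.1.1, by rw [bact_mul]; exact U.2⟩ : {T : M2 // bact f T = g})) ?_
    rintro ⟨U, hU⟩ ⟨V, hV⟩ h
    simp only [Subtype.mk.injEq] at h
    exact Subtype.ext (TQ_inj h).2
  rw [Nat.card_sigma]
  rfl

theorem bact_smul (f : BF) (k : ℤ) : bact f (k • (1 : M2)) = bscale (k ^ 2) f := by
  unfold bact bscale
  simp
  refine ⟨by ring, by ring, by ring⟩

theorem NQ_adj (f g : BF) : NQ q f g = NQ q g (bscale (q ^ 2) f) := by
  have hqp := hq.out
  have hq0 : (q : ℤ) ≠ 0 := by exact_mod_cast hqp.ne_zero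
  have hadj : ∀ T : M2, T.adjugate.adjugate = T := by
    intro T
    rw [Matrix.adjugate_adjugate _ (by simp)]; simp
  refine Nat.card_congr
    { toFun := fun T => ⟨T.1.adjugate, ?_, ?_⟩
      invFun := fun T => ⟨T.1.adjugate, ?_, ?_⟩
      left_inv := fun T => Subtype.ext (hadj _)
      right_inv := fun T => Subtype.ext (hadj _) }
  · rw [Matrix.det_adjugate]; simpa using T.2.1
  · obtain ⟨T, hT1, hT2⟩ := T
    simp only
    rw [← hT2, ← bact_mul, Matrix.mul_adjugate, hT1, bact_smul]
  · rw [Matrix.det_adjugate]; simpa using T.2.1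
  · have h := congrArg (fun x => bact x T.1.adjugate) T.2.2
    rw [← bact_mul, Matrix.mul_adjugate, T.2.1, bact_smul, bact_bscale] at h
    exact (bscale_inj (pow_ne_zero 2 hq0) h).symm

end

/-- number of square roots mod `q` -/
noncomputable def kap (q : ℕ) (x : ℤ) : ℕ := Nat.card {t : ZMod q // t ^ 2 = (x : ZMod q)}

section
variable {q : ℕ} [hq : Fact q.Prime]

theorem TQ_act_none (g : BF) : bact g (TQ q none) = (g.1, g.2.1 * q, g.2.2 * q ^ 2) := by
  simp [bact, TQ]

theorem TQ_act_some (g : BF) (s : ZMod q) : bact g (TQ q (some s)) =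
    (g.1 * q ^ 2, (2 * g.1 * s.val + g.2.1) * q, g.1 * (s.val : ℤ) ^ 2 + g.2.1 * s.val + g.2.2) := by
  simp [bact, TQ, -ZMod.natCast_val]; ring

theorem zval_cast (s : ZMod q) : ((s.val : ℤ) : ZMod q) = s := by simp

/-- case `q ∣ g` -/
theorem JG_div (h2 : q ≠ 2) (g : BF) :
    Nat.card {j // bdvd ((q : ℤ) ^ 2) (bact (bscale q g) (TQ q j))} =
      if bdvd q g then q + 1 else kap q (bdisc g) := by
  have hqp := hq.out
  have hq0 : (q : ℤ) ≠ 0 := by exact_mod_cast hqp.ne_zero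
  have key : ∀ j, bdvd ((q : ℤ) ^ 2) (bact (bscale q g) (TQ q j)) ↔
      projRoot (g.1 : ZMod q) g.2.1 g.2.2 j := by
    intro j
    have e : bdvd ((q : ℤ) ^ 2) (bact (bscale q g) (TQ q j)) ↔ bdvd q (bact g (TQ q j)) := by
      rw [bact_bscale]
      unfold bdvd bscale
      simp only [pow_two, mul_dvd_mul_iff_left hq0]
    rw [e]
    rcases j with _ | s
    · rw [TQ_act_none]
      simp only [bdvd, projRoot]
      rw [ZMod.intCast_zmod_eq_zero_iff_dvd]
      exact ⟨fun h => h.1, fun h => ⟨h, ⟨g.2.1, by ring⟩, ⟨g.2.2 * q, by ring⟩⟩⟩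
    · rw [TQ_act_some]
      simp only [bdvd, projRoot]
      have e2 : (g.1 : ZMod q) * s ^ 2 + g.2.1 * s + g.2.2 =
          ((g.1 * (s.val : ℤ) ^ 2 + g.2.1 * s.val + g.2.2 : ℤ) : ZMod q) := by
        push_cast
        simp
      rw [e2, ZMod.intCast_zmod_eq_zero_iff_dvd]
      exact ⟨fun h => h.2.2, fun h => ⟨⟨g.1 * q, by ring⟩, ⟨_, mul_comm _ _⟩, h⟩⟩
  rw [Nat.card_congr (Equiv.subtypeEquivRight key)]
  by_cases hd : bdvd q g
  · rw [if_pos hd]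
    obtain ⟨h1, h3, h4⟩ := hd
    rw [← ZMod.intCast_zmod_eq_zero_iff_dvd] at h1 h3 h4
    rw [h1, h3, h4]
    have : ∀ j, projRoot (0 : ZMod q) 0 0 j := by
      intro j; cases j <;> simp [projRoot]
    rw [Nat.card_congr (Equiv.subtypeUnivEquiv this)]
    simp
  · rw [if_neg hd, card_projRoot]
    · unfold kap bdisc
      push_cast
      rfl
    · intro h
      have : ((2 : ℕ) : ZMod q) = 0 := by exact_mod_cast h
      rw [ZMod.natCast_eq_zero_iff] at this
      exact h2 ((Nat.prime_dvd_prime_iff_eq hqp Nat.prime_two).1 this)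
    · by_contra h
      apply hd
      unfold bdvd
      simp only [← ZMod.intCast_zmod_eq_zero_iff_dvd]
      tauto

theorem JG_not (h2 : q ≠ 2) (g : BF) (hg : ¬ bdvd q g) (hd : (q : ℤ) ^ 2 ∣ bdisc g) :
    Nat.card {j // bdvd ((q : ℤ) ^ 2) (bact g (TQ q j))} = 1 := by
  have hqp := hq.out
  have hpz : Prime (q : ℤ) := Nat.prime_iff_prime_int.1 hqp
  have hq0 : (q : ℤ) ≠ 0 := hpz.ne_zero
  have hq2 : ¬ (q : ℤ) ∣ 2 := by
    intro h
    have : q ∣ 2 := by exact_mod_cast h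
    exact h2 ((Nat.prime_dvd_prime_iff_eq hqp Nat.prime_two).1 this)
  have hq4 : ¬ (q : ℤ) ∣ 4 := by
    intro h
    exact hq2 (hpz.dvd_of_dvd_pow (n := 2) (by norm_num; exact h))
  obtain ⟨a, b, c⟩ := g
  unfold bdisc at hd
  simp only at hd
  rw [Nat.card_eq_one_iff_unique]
  by_cases ha : (q : ℤ) ∣ a
  · have hb : (q : ℤ) ∣ b := by
      apply hpz.dvd_of_dvd_pow (n := 2)
      have h1 : (q : ℤ) ∣ b ^ 2 - 4 * a * c := (Dvd.intro_left (q : ℤ) (by ring)).trans hd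
      have h3 : (q : ℤ) ∣ 4 * a * c := by
        obtain ⟨a', rfl⟩ := ha; exact ⟨4 * a' * c, by ring⟩
      have := dvd_add h1 h3
      simpa using this
    have hc : ¬ (q : ℤ) ∣ c := fun hc => hg ⟨ha, hb, hc⟩
    have haa : (q : ℤ) ^ 2 ∣ a := by
      have h1 : (q : ℤ) ^ 2 ∣ b ^ 2 := pow_dvd_pow_of_dvd hb 2
      have h3 : (q : ℤ) ^ 2 ∣ (4 * c) * a := by
        have := dvd_sub h1 hd
        rw [show b ^ 2 - (b ^ 2 - 4 * a * c) = (4 * c) * a by ring] at this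
        exact this
      have hcop : IsCoprime ((q : ℤ) ^ 2) (4 * c) := by
        apply IsCoprime.pow_left
        rw [Prime.coprime_iff_not_dvd hpz]
        intro h
        rcases hpz.dvd_or_dvd h with h | h
        · exact hq4 h
        · exact hc h
      exact hcop.dvd_of_dvd_mul_left h3
    refine ⟨⟨?_⟩, ⟨none, ?_⟩⟩
    · have key : ∀ s : ZMod q, ¬ bdvd ((q : ℤ) ^ 2) (bact (a, b, c) (TQ q (some s))) := by
        rintro s ⟨-, -, h⟩
        rw [TQ_act_some] at h
        simp only at h
        apply hc
        have h1 : (q : ℤ) ∣ a * (s.val : ℤ) ^ 2 + b * s.val + c :=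
          (Dvd.intro_left (q : ℤ) (by ring)).trans h
        have h3 : (q : ℤ) ∣ a * (s.val : ℤ) ^ 2 + b * s.val :=
          dvd_add (ha.mul_right _) (hb.mul_right _)
        exact (dvd_add_right h3).1 h1
      rintro ⟨_ | s, hs⟩ ⟨_ | t, ht⟩
      · rfl
      · exact absurd ht (key t)
      · exact absurd hs (key s)
      · exact absurd hs (key s)
    · rw [TQ_act_none]
      refine ⟨haa, ?_, ⟨c, by ring⟩⟩
      obtain ⟨b', rfl⟩ := hb
      exact ⟨b', by ring⟩
  · have ha' : (a : ZMod q) ≠ 0 := by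
      rw [Ne, ZMod.intCast_zmod_eq_zero_iff_dvd]; exact ha
    have h2' : (2 : ZMod q) ≠ 0 := by
      intro h
      have : ((2 : ℤ) : ZMod q) = 0 := by exact_mod_cast h
      rw [ZMod.intCast_zmod_eq_zero_iff_dvd] at this
      exact hq2 this
    have cond : ∀ s : ZMod q, bdvd ((q : ℤ) ^ 2) (bact (a, b, c) (TQ q (some s))) ↔
        s = - b / (2 * a) := by
      intro s
      rw [TQ_act_some]
      have e1 : s = - b / (2 * a) ↔ (q : ℤ) ∣ 2 * a * s.val + b := by
        rw [← ZMod.intCast_zmod_eq_zero_iff_dvd, eq_div_iff (mul_ne_zero h2' ha')]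
        push_cast
        simp
        constructor
        · intro h; linear_combination h
        · intro h; linear_combination h
      rw [e1]
      unfold bdvd
      simp only
      constructor
      · rintro ⟨-, h, -⟩
        rw [pow_two] at h
        exact (mul_dvd_mul_iff_right hq0).1 h
      · intro h
        refine ⟨⟨a, by ring⟩, ?_, ?_⟩
        · rw [pow_two]; exact mul_dvd_mul_right h _
        · have h3 : (q : ℤ) ^ 2 ∣ (4 * a) * (a * (s.val : ℤ) ^ 2 + b * s.val + c) := by
            have := dvd_sub (pow_dvd_pow_of_dvd h 2) hd
            rw [show (2 * a * (s.val : ℤ) + b) ^ 2 - (b ^ 2 - 4 * a * c) =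
              (4 * a) * (a * (s.val : ℤ) ^ 2 + b * s.val + c) by ring] at this
            exact this
          have hcop : IsCoprime ((q : ℤ) ^ 2) (4 * a) := by
            apply IsCoprime.pow_left
            rw [Prime.coprime_iff_not_dvd hpz]
            intro h
            rcases hpz.dvd_or_dvd h with h | h
            · exact hq4 h
            · exact ha h
          exact hcop.dvd_of_dvd_mul_left h3
    have hnone : ¬ bdvd ((q : ℤ) ^ 2) (bact (a, b, c) (TQ q none)) := by
      rintro ⟨h, -, -⟩
      rw [TQ_act_none] at h
      exact ha ((Dvd.intro_left (q : ℤ) (by ring)).trans h)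
    refine ⟨⟨?_⟩, ⟨some (- b / (2 * a)), (cond _).2 rfl⟩⟩
    rintro ⟨_ | s, hs⟩ ⟨_ | t, ht⟩
    · rfl
    · exact absurd hs hnone
    · exact absurd ht hnone
    · rw [cond] at hs ht
      apply Subtype.ext
      simp only
      rw [hs, ht]

theorem WB_rec (h2 : q ≠ 2) {N : ℕ} (hN : 0 < N) :
    ((q : ℝ) + 1) * WB N = WB (N * q ^ 2) + ((kap q (-(N : ℤ)) : ℝ) - 1) * WB N +
      ((q : ℝ) + 1 - kap q (-(N : ℤ))) * (if q ^ 2 ∣ N then WB (N / q ^ 2) else 0) := by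
  have hqp := hq.out
  have hq0 : (q : ℤ) ≠ 0 := by exact_mod_cast hqp.ne_zero
  have hN2 : 0 < N * q ^ 2 := Nat.mul_pos hN (pow_pos hqp.pos 2)
  have := y_finite hN
  have := y_finite hN2
  have s1 : ∀ f : YF N, csum (yrel (N * q ^ 2)) (fun g => bhom g.1 g.1)
      (fun g => 1 * (NQ q f.1 g.1 : ℝ)) = q + 1 := by
    intro f
    rw [← class_sum (yrel_equiv _) (fun x y => bhom x.1 y.1) (fun g => bhom g.1 g.1)
      (bhom_pos hN2) (fun x y h => bhom_of_equiv h) (fun x y h => bhom_of_not h)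
      (fun _ => 1) (fun _ _ _ => rfl)
      (fun j : Option (ZMod q) => (⟨bact f.1 (TQ q j), by
        rw [bdisc_bact, f.2.1, TQ_det]; push_cast; ring,
        bact_pos hN f.2.1 f.2.2 _ (by rw [TQ_det]; exact hq0)⟩ : YF (N * q ^ 2)))
      (fun g => NQ q f.1 g.1) (fun g => NQ_eq hN f.2.1 f.2.2 g.1)]
    simp
  have s2 : ∀ g : YF (N * q ^ 2), csum (yrel N) (fun f => bhom f.1 f.1)
      (fun f => 1 * (NQ q f.1 g.1 : ℝ)) =
        (Nat.card {j // bdvd ((q : ℤ) ^ 2) (bact g.1 (TQ q j))} : ℝ) := by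
    intro g
    have hj : ∀ j : {j // bdvd ((q : ℤ) ^ 2) (bact g.1 (TQ q j))},
        ∃ f : YF N, bact g.1 (TQ q j.1) = bscale (q ^ 2) f.1 := by
      rintro ⟨j, hj⟩
      obtain ⟨f, hf⟩ := (bdvd_iff _ _).1 hj
      refine ⟨⟨f, ?_, ?_⟩, hf⟩
      · have h1 := congrArg bdisc hf
        rw [bdisc_bact, bdisc_bscale, TQ_det, g.2.1] at h1
        apply mul_left_cancel₀ (pow_ne_zero 4 hq0)
        push_cast at h1
        linear_combination -h1
      · have h1 := bact_pos hN2 g.2.1 g.2.2 (TQ q j) (by rw [TQ_det]; exact hq0)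
        rw [hf] at h1
        exact pos_of_mul_pos_right h1 (by positivity)
    choose xs hxs using hj
    rw [← class_sum (yrel_equiv _) (fun x y => bhom x.1 y.1) (fun g => bhom g.1 g.1)
      (bhom_pos hN) (fun x y h => bhom_of_equiv h) (fun x y h => bhom_of_not h)
      (fun _ => 1) (fun _ _ _ => rfl) xs (fun f => NQ q f.1 g.1)]
    · simp
    · intro f
      rw [NQ_adj, NQ_eq hN2 g.2.1 g.2.2]
      rw [← Finset.sum_subset (Finset.subset_univ
        (Finset.univ.filter fun j => bdvd ((q : ℤ) ^ 2) (bact g.1 (TQ q j))))]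
      · rw [Finset.sum_subtype (p := fun j => bdvd ((q : ℤ) ^ 2) (bact g.1 (TQ q j))) _
          (by intro j; simp)]
        apply Finset.sum_congr rfl
        intro j _
        rw [hxs j, bhom_bscale (pow_ne_zero 2 hq0)]
      · intro j _ hj
        apply bhom_of_not
        intro h
        apply hj
        rw [Finset.mem_filter]
        refine ⟨Finset.mem_univ _, ?_⟩
        rw [bdvd_equiv h, bdvd_iff]
        exact ⟨_, rfl⟩
  have dc := double_count (r := yrel N) (s := yrel (N * q ^ 2)) (a := fun f => bhom f.1 f.1)
    (b := fun g => bhom g.1 g.1) (fun _ => 1) (fun _ => 1) (fun f g => NQ q f.1 g.1)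
  simp only [s1, s2] at dc
  have l1 : csum (yrel N) (fun f => bhom f.1 f.1) (fun _ => 1 * ((q : ℝ) + 1)) =
      ((q : ℝ) + 1) * WB N := by
    unfold WB
    rw [← csum_mul]
    apply csum_congr
    intro x; ring
  rw [l1] at dc
  rw [dc]
  have l2 : ∀ g : YF (N * q ^ 2),
      1 * (Nat.card {j // bdvd ((q : ℤ) ^ 2) (bact g.1 (TQ q j))} : ℝ) =
        1 + ((kap q (-(N : ℤ)) : ℝ) - 1) * (if bdvd q g.1 then 1 else 0) +
      ((q : ℝ) + 1 - kap q (-(N : ℤ))) * (if bdvd ((q ^ 2 : ℕ) : ℤ) g.1 then 1 else 0) := by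
    rintro ⟨g, hg1, hg2⟩
    simp only
    by_cases h1 : bdvd q g
    · obtain ⟨g', rfl⟩ := (bdvd_iff _ _).1 h1
      have hdisc : bdisc g' = -(N : ℤ) := by
        rw [bdisc_bscale] at hg1
        apply mul_left_cancel₀ (pow_ne_zero 2 hq0)
        push_cast at hg1
        linear_combination hg1
      have e : bdvd ((q ^ 2 : ℕ) : ℤ) (bscale q g') ↔ bdvd q g' := by
        unfold bdvd bscale
        push_cast
        simp only [pow_two, mul_dvd_mul_iff_left hq0]
      simp only [if_pos h1, JG_div h2, hdisc, e]
      by_cases h3 : bdvd q g'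
      · simp only [if_pos h3]; push_cast; ring
      · simp only [if_neg h3]; push_cast; ring
    · have h3 : ¬ bdvd ((q ^ 2 : ℕ) : ℤ) g := by
        rintro ⟨a, b, c⟩
        apply h1
        have hh : (q : ℤ) ∣ ((q ^ 2 : ℕ) : ℤ) := by push_cast; exact Dvd.intro_left (q : ℤ) (by ring)
        exact ⟨hh.trans a, hh.trans b, hh.trans c⟩
      rw [JG_not h2 g h1 ⟨-(N : ℤ), by rw [hg1]; push_cast; ring⟩]
      simp only [if_neg h1, if_neg h3]
      push_cast; ring
  rw [csum_congr l2, csum_add, csum_add, csum_mul, csum_mul,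
    csum_bdvd hN q hqp.pos _ (by ring)]
  congr 1
  congr 1
  by_cases h5 : q ^ 2 ∣ N
  · rw [if_pos h5]
    obtain ⟨M, rfl⟩ := h5
    have hM : 0 < M := Nat.pos_of_mul_pos_left hN
    rw [csum_bdvd hM (q ^ 2) (pow_pos hqp.pos 2) _ (by ring),
      Nat.mul_div_cancel_left _ (pow_pos hqp.pos 2)]
  · rw [if_neg h5]
    have : ∀ g : YF (N * q ^ 2), (if bdvd ((q ^ 2 : ℕ) : ℤ) g.1 then (1 : ℝ) else 0) = 0 * 1 := by
      rintro ⟨g, hg1, hg2⟩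
      simp only
      rw [if_neg, zero_mul]
      intro h
      obtain ⟨g', rfl⟩ := (bdvd_iff _ _).1 h
      apply h5
      rw [bdisc_bscale] at hg1
      have : ((q ^ 2 : ℕ) : ℤ) ∣ (N : ℤ) := by
        refine ⟨- bdisc g', ?_⟩
        apply mul_left_cancel₀ (pow_ne_zero 2 hq0)
        push_cast at hg1 ⊢
        linear_combination hg1
      exact_mod_cast this
    rw [csum_congr this, csum_mul, zero_mul]
end

/-! ### P4: ternary lattices -/

theorem quadVal_eq {R : Type*} [CommRing R] {k : ℕ} (M : Matrix (Fin k) (Fin k) R)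
    (x : Fin k → R) : quadVal M x = x ⬝ᵥ (M *ᵥ x) := by
  simp [quadVal, dotProduct, mulVec, Finset.mul_sum, mul_assoc]

theorem quadVal_tr {R : Type*} [CommRing R] {k : ℕ} (M U : Matrix (Fin k) (Fin k) R)
    (x : Fin k → R) : quadVal (Uᵀ * M * U) x = quadVal M (U *ᵥ x) := by
  rw [quadVal_eq, quadVal_eq, ← Matrix.mulVec_mulVec, ← Matrix.mulVec_mulVec, dotProduct_mulVec,
    ← Matrix.mulVec_transpose, Matrix.transpose_transpose]

theorem quadVal_smul {R : Type*} [CommRing R] {k : ℕ} (M : Matrix (Fin k) (Fin k) R) (c : R)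
    (x : Fin k → R) : quadVal M (c • x) = c ^ 2 * quadVal M x := by
  simp only [quadVal, Finset.mul_sum, Pi.smul_apply, smul_eq_mul]
  refine Finset.sum_congr rfl fun i _ => Finset.sum_congr rfl fun j _ => by ring

theorem quadVal_three {R : Type*} [CommRing R] (M : Matrix (Fin 3) (Fin 3) R) (hM : M.IsSymm)
    (x : Fin 3 → R) : quadVal M x = M 0 0 * x 0 ^ 2 + M 1 1 * x 1 ^ 2 + M 2 2 * x 2 ^ 2 +
      2 * M 0 1 * x 0 * x 1 + 2 * M 0 2 * x 0 * x 2 + 2 * M 1 2 * x 1 * x 2 := by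
  simp only [quadVal, Fin.sum_univ_three]
  rw [hM.apply 0 1, hM.apply 0 2, hM.apply 1 2]
  ring

theorem det_symm {R : Type*} [CommRing R] (M : Matrix (Fin 3) (Fin 3) R) (hM : M.IsSymm) :
    M.det = M 0 0 * M 1 1 * M 2 2 + 2 * M 0 1 * M 0 2 * M 1 2 - M 0 0 * M 1 2 ^ 2
      - M 1 1 * M 0 2 ^ 2 - M 2 2 * M 0 1 ^ 2 := by
  rw [Matrix.det_fin_three, hM.apply 0 1, hM.apply 0 2, hM.apply 1 2]
  ring

/-- the key positivity identity -/
theorem quad_identity (A : TernMat) (hA : A.IsSymm) (x : Fin 3 → ℤ) :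
    A 0 0 * (A 0 0 * A 1 1 - A 0 1 ^ 2) * quadVal A x =
      (A 0 0 * A 1 1 - A 0 1 ^ 2) * (A 0 0 * x 0 + A 0 1 * x 1 + A 0 2 * x 2) ^ 2 +
      ((A 0 0 * A 1 1 - A 0 1 ^ 2) * x 1 + (A 0 0 * A 1 2 - A 0 1 * A 0 2) * x 2) ^ 2 +
      A 0 0 * A.det * x 2 ^ 2 := by
  rw [quadVal_three A hA, det_symm A hA]
  ring

/-- leading minors -/
theorem isLat_iff (A : TernMat) : IsLat A ↔
    A.IsSymm ∧ 0 < A 0 0 ∧ 0 < A 0 0 * A 1 1 - A 0 1 ^ 2 ∧ 0 < A.det := by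
  constructor
  · rintro ⟨hs, hp⟩
    have h0 : 0 < A 0 0 := by
      have := hp ![1, 0, 0] (by intro h; simpa using congrFun h 0)
      rw [quadVal_three A hs] at this
      simpa using this
    have h1 : 0 < A 0 0 * A 1 1 - A 0 1 ^ 2 := by
      have := hp ![- A 0 1, A 0 0, 0] (by
        intro h
        have := congrFun h 1
        simp at this
        omega)
      rw [quadVal_three A hs] at this
      simp at this
      have e : A 0 0 * A 0 1 ^ 2 + A 1 1 * A 0 0 ^ 2 + -(2 * A 0 1 * A 0 1 * A 0 0) =
        A 0 0 * (A 0 0 * A 1 1 - A 0 1 ^ 2) := by ring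
      have h3 : 0 < A 0 0 * (A 0 0 * A 1 1 - A 0 1 ^ 2) := by rw [← e]; linarith
      exact pos_of_mul_pos_right h3 h0.le
    refine ⟨hs, h0, h1, ?_⟩
    have := hp ![A 0 1 * A 1 2 - A 0 2 * A 1 1, A 0 1 * A 0 2 - A 0 0 * A 1 2,
      A 0 0 * A 1 1 - A 0 1 ^ 2] (by
        intro h
        have := congrFun h 2
        simp at this
        omega)
    rw [quadVal_three A hs] at this
    simp at this
    have e : (A 0 0 * A 1 1 - A 0 1 ^ 2) * A.det =
       A 0 0 * (A 0 1 * A 1 2 - A 0 2 * A 1 1) ^ 2 + A 1 1 * (A 0 1 * A 0 2 - A 0 0 * A 1 2) ^ 2 +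
       A 2 2 * (A 0 0 * A 1 1 - A 0 1 ^ 2) ^ 2 +
       2 * A 0 1 * (A 0 1 * A 1 2 - A 0 2 * A 1 1) * (A 0 1 * A 0 2 - A 0 0 * A 1 2) +
       2 * A 0 2 * (A 0 1 * A 1 2 - A 0 2 * A 1 1) * (A 0 0 * A 1 1 - A 0 1 ^ 2) +
       2 * A 1 2 * (A 0 1 * A 0 2 - A 0 0 * A 1 2) * (A 0 0 * A 1 1 - A 0 1 ^ 2) := by
      rw [det_symm A hs]; ring
    rw [← e] at this
    exact pos_of_mul_pos_right this h1.le
  · rintro ⟨hs, h0, h1, hd⟩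
    refine ⟨hs, fun x hx => ?_⟩
    have hk := quad_identity A hs x
    have : 0 < A 0 0 * (A 0 0 * A 1 1 - A 0 1 ^ 2) * quadVal A x := by
      rw [hk]
      by_cases h2 : x 2 = 0
      · rw [h2]
        by_cases h3 : x 1 = 0
        · rw [h3]
          have h4 : x 0 ≠ 0 := by
            intro h4; apply hx; ext i; fin_cases i <;> assumption
          have : 0 < (A 0 0 * A 1 1 - A 0 1 ^ 2) * (A 0 0 * x 0) ^ 2 := by positivity
          simpa using this
        · have : 0 < ((A 0 0 * A 1 1 - A 0 1 ^ 2) * x 1) ^ 2 := by positivity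
          have h5 : 0 ≤ (A 0 0 * A 1 1 - A 0 1 ^ 2) * (A 0 0 * x 0 + A 0 1 * x 1) ^ 2 := by
            positivity
          simp only [mul_zero, add_zero, ne_eq, OfNat.ofNat_ne_zero, not_false_eq_true, zero_pow]
          linarith
      · have : 0 < A 0 0 * A.det * x 2 ^ 2 := by positivity
        positivity
    exact pos_of_mul_pos_right this (by positivity)

theorem sq_le_abs {w K : ℤ} (h : w ^ 2 ≤ K) : w ∈ Set.Icc (-K) K := by
  have h1 : w ≤ w ^ 2 := by
    rcases le_or_gt w 0 with h | h
    · nlinarith [sq_nonneg w]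
    · nlinarith
  have h2 : -w ≤ w ^ 2 := by
    rcases le_or_gt 0 w with h | h
    · nlinarith [sq_nonneg w]
    · nlinarith
  constructor <;> linarith

theorem rep_finite {A : TernMat} (hA : IsLat A) (n : ℤ) : Finite {x : Fin 3 → ℤ // quadVal A x = n} := by
  obtain ⟨hs, h0, h1, hd⟩ := (isLat_iff A).1 hA
  set m := A 0 0 * A 1 1 - A 0 1 ^ 2 with hm
  set K := A 0 0 * m * n with hK
  have hfin : Finite (Set.Icc (-K) K) := (Set.finite_Icc _ _).to_subtype
  have hb : ∀ x : {x : Fin 3 → ℤ // quadVal A x = n},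
      (A 0 0 * x.1 0 + A 0 1 * x.1 1 + A 0 2 * x.1 2) ∈ Set.Icc (-K) K ∧
      (m * x.1 1 + (A 0 0 * A 1 2 - A 0 1 * A 0 2) * x.1 2) ∈ Set.Icc (-K) K ∧
      x.1 2 ∈ Set.Icc (-K) K := by
    rintro ⟨x, hx⟩
    have hk := quad_identity A hs x
    rw [hx, ← hm, ← hK] at hk
    simp only
    generalize (A 0 0 * x 0 + A 0 1 * x 1 + A 0 2 * x 2) = u at *
    generalize (m * x 1 + (A 0 0 * A 1 2 - A 0 1 * A 0 2) * x 2) = v at *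
    generalize x 2 = w at *
    have p1 : u ^ 2 ≤ m * u ^ 2 := by nlinarith [sq_nonneg u]
    have p2 : w ^ 2 ≤ A 0 0 * A.det * w ^ 2 := by
      have : 1 ≤ A 0 0 * A.det := by nlinarith
      nlinarith [sq_nonneg w]
    refine ⟨sq_le_abs ?_, sq_le_abs ?_, sq_le_abs ?_⟩ <;>
      nlinarith [sq_nonneg u, sq_nonneg v, sq_nonneg w]
  refine Finite.of_injective (β := Set.Icc (-K) K × Set.Icc (-K) K × Set.Icc (-K) K)
    (fun x => (⟨_, (hb x).1⟩, ⟨_, (hb x).2.1⟩, ⟨_, (hb x).2.2⟩)) ?_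
  rintro ⟨x, hx⟩ ⟨y, hy⟩ h
  simp only [Prod.mk.injEq, Subtype.mk.injEq] at h
  obtain ⟨e1, e2, e3⟩ := h
  rw [e3] at e1 e2
  have e4 : x 1 = y 1 := by
    apply mul_left_cancel₀ h1.ne'
    linarith
  rw [e4] at e1
  have e5 : x 0 = y 0 := by
    apply mul_left_cancel₀ h0.ne'
    linarith
  apply Subtype.ext
  ext i
  fin_cases i <;> assumption

theorem hom_finite {A : TernMat} (hA : IsLat A) (B : TernMat) :
    Finite {U : TernMat // Uᵀ * A * U = B} := by
  have := fun n => rep_finite hA n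
  refine Finite.of_injective (β := ∀ i : Fin 3, {x : Fin 3 → ℤ // quadVal A x = B i i})
    (fun U i => ⟨fun j => U.1 j i, ?_⟩) ?_
  · have h := congrArg (fun M : TernMat => M i i) U.2
    have h' : (U.1ᵀ * A * U.1) i i = B i i := h
    rw [← h']
    simp only [quadVal, Matrix.mul_apply, Matrix.transpose_apply, Finset.sum_mul]
    rw [Finset.sum_comm]
  · intro U V h
    apply Subtype.ext
    ext i j
    have := congrFun (congrArg Subtype.val (congrFun h j)) i
    exact this

theorem LatIsom_refl (A : TernMat) : LatIsom A A := ⟨1, by simp, by simp⟩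

theorem LatIsom_symm {A B : TernMat} (h : LatIsom A B) : LatIsom B A := by
  obtain ⟨U, hU, rfl⟩ := h
  refine ⟨U⁻¹, ?_, ?_⟩
  · exact (Matrix.isUnit_nonsing_inv_det_iff).2 hU
  · rw [Matrix.transpose_nonsing_inv]
    simp only [Matrix.mul_assoc]
    rw [Matrix.mul_nonsing_inv _ hU, Matrix.mul_one, Matrix.nonsing_inv_mul_cancel_left]
    rwa [Matrix.det_transpose]

theorem LatIsom_trans {A B C : TernMat} (h : LatIsom A B) (h' : LatIsom B C) : LatIsom A C := by
  obtain ⟨U, hU, rfl⟩ := h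
  obtain ⟨V, hV, rfl⟩ := h'
  refine ⟨U * V, ?_, ?_⟩
  · rw [Matrix.det_mul]; exact hU.mul hV
  · rw [Matrix.transpose_mul]; simp only [Matrix.mul_assoc]

/-- number of isometries -/
noncomputable def thom (A B : TernMat) : ℕ :=
  Nat.card {U : TernMat // IsUnit U.det ∧ Uᵀ * A * U = B}

theorem thom_of_isom {A B : TernMat} (h : LatIsom A B) : thom A B = numAut B := by
  obtain ⟨V, hV, rfl⟩ := h
  symm
  refine Nat.card_congr
    { toFun := fun U => ⟨V * U.1, ?_, ?_⟩
      invFun := fun U => ⟨V⁻¹ * U.1, ?_, ?_⟩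
      left_inv := fun U => Subtype.ext (Matrix.nonsing_inv_mul_cancel_left _ _ hV)
      right_inv := fun U => Subtype.ext (Matrix.mul_nonsing_inv_cancel_left _ _ hV) }
  · rw [Matrix.det_mul]; exact hV.mul U.2.1
  · rw [Matrix.transpose_mul]
    have := U.2.2
    simp only [Matrix.mul_assoc] at this ⊢
    exact this
  · rw [Matrix.det_mul]; exact ((Matrix.isUnit_nonsing_inv_det_iff).2 hV).mul U.2.1
  · have h2 := U.2.2
    rw [Matrix.transpose_mul, Matrix.transpose_nonsing_inv]
    simp only [Matrix.mul_assoc] at h2 ⊢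
    rw [Matrix.mul_nonsing_inv_cancel_left _ _ hV, Matrix.nonsing_inv_mul_cancel_left _ _
      (by rwa [Matrix.det_transpose])]
    exact h2

theorem thom_not {A B : TernMat} (h : ¬ LatIsom A B) : thom A B = 0 := by
  have : IsEmpty {U : TernMat // IsUnit U.det ∧ Uᵀ * A * U = B} := ⟨fun U => h ⟨U.1, U.2⟩⟩
  exact Nat.card_of_isEmpty

theorem numAut_pos {A : TernMat} (hA : IsLat A) : 0 < numAut A := by
  have := hom_finite hA A
  have : Finite {U : TernMat // IsUnit U.det ∧ Uᵀ * A * U = A} :=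
    Finite.of_injective (fun U => (⟨U.1, U.2.2⟩ : {U : TernMat // Uᵀ * A * U = A}))
      (fun U V h => Subtype.ext (by simpa using h))
  have : Nonempty {U : TernMat // IsUnit U.det ∧ Uᵀ * A * U = A} := ⟨⟨1, by simp, by simp⟩⟩
  exact Nat.card_pos

theorem rRep_isom {A B : TernMat} (h : LatIsom A B) (n : ℤ) : rRep n A = rRep n B := by
  obtain ⟨V, hV, rfl⟩ := h
  symm
  refine Nat.card_congr
    { toFun := fun x => ⟨V *ᵥ x.1, by rw [← quadVal_tr]; exact x.2⟩
      invFun := fun x => ⟨V⁻¹ *ᵥ x.1, by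
        rw [quadVal_tr, Matrix.mulVec_mulVec, Matrix.mul_nonsing_inv _ hV, Matrix.one_mulVec]
        exact x.2⟩
      left_inv := fun x => Subtype.ext (by
        simp only [Matrix.mulVec_mulVec, Matrix.nonsing_inv_mul _ hV, Matrix.one_mulVec])
      right_inv := fun x => Subtype.ext (by
        simp only [Matrix.mulVec_mulVec, Matrix.mul_nonsing_inv _ hV, Matrix.one_mulVec]) }

theorem LatIsom_isLat {A B : TernMat} (hA : IsLat A) (h : LatIsom A B) : IsLat B := by
  obtain ⟨V, hV, rfl⟩ := h
  refine ⟨?_, ?_⟩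
  · unfold Matrix.IsSymm
    simp only [Matrix.transpose_mul, Matrix.transpose_transpose, Matrix.mul_assoc]
    rw [hA.1.eq]
  · intro x hx
    rw [quadVal_tr]
    apply hA.2
    intro h
    apply hx
    have := congrArg (fun y => V⁻¹ *ᵥ y) h
    simpa [Matrix.mulVec_mulVec, Matrix.nonsing_inv_mul _ hV] using this

theorem LatIsom_det {A B : TernMat} (h : LatIsom A B) : B.det = A.det := by
  obtain ⟨V, hV, rfl⟩ := h
  rw [Matrix.det_mul, Matrix.det_mul, Matrix.det_transpose]
  rcases Int.isUnit_iff.1 hV with h | h <;> rw [h] <;> ring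

theorem exists_near (b a : ℤ) (ha : 0 < a) : ∃ x : ℤ, 2 * |b + x * a| ≤ a := by
  refine ⟨-((2 * b + a) / (2 * a)), ?_⟩
  have h1 := Int.emod_add_mul_ediv (2 * b + a) (2 * a)
  have h2 := Int.emod_nonneg (2 * b + a) (by omega : 2 * a ≠ 0)
  have h3 := Int.emod_lt_of_pos (2 * b + a) (by omega : 0 < 2 * a)
  generalize (2 * b + a) / (2 * a) = x at *
  have : 2 * |b + -x * a| = |2 * (b - x * a)| := by
    rw [abs_mul]; congr 2; ring
  rw [this, abs_le]
  constructor <;> nlinarith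

/-- bound used in reduction theory -/
def redK (d : ℤ) : ℤ := 100 * (d + 1) ^ 6

set_option maxHeartbeats 1000000 in
theorem red_bounds {a b c e f g d : ℤ} (ha : 0 < a) (hmu : 0 < a * e - b ^ 2) (hd : 0 < d)
    (hdet : a * e * g + 2 * b * c * f - a * f ^ 2 - e * c ^ 2 - g * b ^ 2 = d)
    (hb : 2 * |b| ≤ a) (hc : 2 * |c| ≤ a)
    (hnu : 2 * |a * f - b * c| ≤ a * e - b ^ 2)
    (hae : a ≤ e) (hmr : a * e - b ^ 2 ≤ a * g - c ^ 2) :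
    (|a| ≤ redK d ∧ |b| ≤ redK d ∧ |c| ≤ redK d) ∧
    (|e| ≤ redK d ∧ |f| ≤ redK d ∧ |g| ≤ redK d) := by
  have hb2 : 4 * b ^ 2 ≤ a ^ 2 := by
    have := abs_nonneg b
    rw [← sq_abs b]; nlinarith
  have hc2 : 4 * c ^ 2 ≤ a ^ 2 := by
    have := abs_nonneg c
    rw [← sq_abs c]; nlinarith
  obtain ⟨mu, hm⟩ : ∃ mu, mu = a * e - b ^ 2 := ⟨_, rfl⟩
  obtain ⟨nu, hn⟩ : ∃ nu, nu = a * f - b * c := ⟨_, rfl⟩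
  obtain ⟨rho, hr⟩ : ∃ rho, rho = a * g - c ^ 2 := ⟨_, rfl⟩
  rw [← hm] at hmu hnu hmr
  rw [← hn] at hnu
  rw [← hr] at hmr
  have hn2 : 4 * nu ^ 2 ≤ mu ^ 2 := by
    have := abs_nonneg nu
    rw [← sq_abs nu]; nlinarith
  have hdet2 : mu * rho - nu ^ 2 = a * d := by
    rw [hm, hn, hr, ← hdet]; ring
  have h1 : 3 * a ^ 2 ≤ 4 * mu := by nlinarith
  have h2 : 3 * mu ^ 2 ≤ 4 * (a * d) := by nlinarith
  have h3 : 27 * a ^ 3 ≤ 64 * d := by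
    have : 9 * (a ^ 2) ^ 2 ≤ 16 * mu ^ 2 := by nlinarith [sq_nonneg a]
    have h4 : a * (27 * a ^ 3) ≤ a * (64 * d) := by nlinarith
    exact le_of_mul_le_mul_left h4 ha
  have ha3 : a ≤ 3 * d := by
    have : a ≤ a ^ 3 := by nlinarith [sq_nonneg (a - 1), mul_pos ha ha]
    nlinarith
  have hmu2 : mu ≤ 2 * d := by
    by_contra hh
    push Not at hh
    nlinarith
  have hrho : rho ≤ 3 * d ^ 2 + 2 * d := by
    have e2 : mu * (rho - mu) ≤ a * d := by nlinarith [sq_nonneg mu]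
    have e3 : rho - mu ≤ mu * (rho - mu) := by nlinarith
    have e4 : a * d ≤ 3 * d * d := mul_le_mul_of_nonneg_right ha3 hd.le
    have e5 : 3 * d * d = 3 * d ^ 2 := by ring
    linarith
  have ha9 : a ^ 2 ≤ 9 * d ^ 2 := by nlinarith
  have he : e ≤ 2 * d + 9 * d ^ 2 := by
    have h7 : e ≤ a * e := by nlinarith
    linarith [sq_nonneg b]
  have hg0 : 0 < g := by
    have : 0 < a * g := by linarith [sq_nonneg c]
    exact pos_of_mul_pos_right this ha.le
  have hg : g ≤ 12 * d ^ 2 + 2 * d := by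
    have h7 : g ≤ a * g := by nlinarith
    linarith [sq_nonneg c, sq_nonneg d]
  have he0 : 0 < e := by linarith
  have hfe : |f| ≤ e := by
    have hx : a * |f| ≤ a * e := by
      have h7 : a * |f| = |nu + b * c| := by
        rw [hn, show a * f - b * c + b * c = a * f by ring, abs_mul, abs_of_pos ha]
      rw [h7]
      have t1 := abs_add_le nu (b * c)
      rw [abs_mul] at t1
      have t2 := abs_nonneg b
      have t3 := abs_nonneg c
      have t4 : (2 * |b|) * (2 * |c|) ≤ a * a :=
        mul_le_mul hb hc (by positivity) ha.le
      have t5 : mu ≤ a * e := by rw [hm]; linarith [sq_nonneg b]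
      have t6 : a * a ≤ a * e := mul_le_mul_of_nonneg_left hae ha.le
      linarith
    exact le_of_mul_le_mul_left hx ha
  have hK : 20 * (d + 1) ^ 2 ≤ redK d := by
    unfold redK
    have : 1 ≤ (d + 1) ^ 4 := one_le_pow₀ (by omega)
    nlinarith [sq_nonneg (d + 1)]
  have hK2 : 20 * (d + 1) ^ 2 = 20 * d ^ 2 + 40 * d + 20 := by ring
  have hKd : d ^ 2 * 80 ≤ redK d := by
    unfold redK
    have : 1 ≤ (d + 1) ^ 4 := one_le_pow₀ (by omega)
    nlinarith [sq_nonneg (d + 1)]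
  have := abs_nonneg b
  have := abs_nonneg c
  have hdd : d ≤ d ^ 2 := by nlinarith
  refine ⟨⟨?_, ?_, ?_⟩, ⟨?_, ?_, ?_⟩⟩
  · rw [abs_of_pos ha]; linarith
  · linarith
  · linarith
  · rw [abs_of_pos he0]; linarith
  · linarith
  · rw [abs_of_pos hg0]; linarith

theorem exists_reduced {B : TernMat} (hB : IsLat B) :
    ∃ C, LatIsom B C ∧ ∀ i j, |C i j| ≤ redK B.det := by
  -- minimal first coefficient
  have hex1 : ∃ a : ℕ, ∃ C, LatIsom B C ∧ C 0 0 = a := by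
    obtain ⟨_, h0, _, _⟩ := (isLat_iff B).1 hB
    exact ⟨(B 0 0).toNat, B, LatIsom_refl B, (Int.toNat_of_nonneg h0.le).symm⟩
  set a := Nat.find hex1 with ha
  have hex2 : ∃ m : ℕ, ∃ C, LatIsom B C ∧ C 0 0 = a ∧ C 0 0 * C 1 1 - C 0 1 ^ 2 = m := by
    obtain ⟨C, hC, h⟩ := Nat.find_spec hex1
    obtain ⟨_, h0, h1, _⟩ := (isLat_iff C).1 (LatIsom_isLat hB hC)
    exact ⟨(C 0 0 * C 1 1 - C 0 1 ^ 2).toNat, C, hC, h, (Int.toNat_of_nonneg h1.le).symm⟩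
  set m := Nat.find hex2 with hm
  have min1 : ∀ C, LatIsom B C → (a : ℤ) ≤ C 0 0 := by
    intro C hC
    obtain ⟨_, h0, h1, _⟩ := (isLat_iff C).1 (LatIsom_isLat hB hC)
    have := Nat.find_min' hex1 (m := (C 0 0).toNat) ⟨C, hC, (Int.toNat_of_nonneg h0.le).symm⟩
    omega
  have min2 : ∀ C, LatIsom B C → C 0 0 = a → (m : ℤ) ≤ C 0 0 * C 1 1 - C 0 1 ^ 2 := by
    intro C hC hCa
    obtain ⟨_, h0, h1, _⟩ := (isLat_iff C).1 (LatIsom_isLat hB hC)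
    have := Nat.find_min' hex2 (m := (C 0 0 * C 1 1 - C 0 1 ^ 2).toNat)
      ⟨C, hC, hCa, (Int.toNat_of_nonneg h1.le).symm⟩
    omega
  obtain ⟨C, hC, hCa, hCm⟩ := Nat.find_spec hex2
  rw [← hm] at hCm
  obtain ⟨hs, h0, h1, hd⟩ := (isLat_iff C).1 (LatIsom_isLat hB hC)
  obtain ⟨x, hx⟩ := exists_near (C 0 1) (C 0 0) h0
  obtain ⟨z, hz⟩ := exists_near (C 0 0 * C 1 2 - C 0 1 * C 0 2) _ h1
  obtain ⟨y, hy⟩ := exists_near (C 0 2 + z * C 0 1) (C 0 0) h0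
  let U : TernMat := !![1, x, y; 0, 1, z; 0, 0, 1]
  have hU : U.det = 1 := by simp [U, Matrix.det_fin_three]
  set D := Uᵀ * C * U with hD
  have hCD : LatIsom C D := ⟨U, by rw [hU]; exact isUnit_one, rfl⟩
  have hBD := LatIsom_trans hC hCD
  obtain ⟨hs', h0', h1', hd'⟩ := (isLat_iff D).1 (LatIsom_isLat hB hBD)
  have e00 : D 0 0 = C 0 0 := by
    simp [hD, U, Matrix.mul_apply, Fin.sum_univ_three]
  have e01 : D 0 1 = C 0 1 + x * C 0 0 := by
    simp [hD, U, Matrix.mul_apply, Fin.sum_univ_three]; ring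
  have e02 : D 0 2 = C 0 2 + z * C 0 1 + y * C 0 0 := by
    simp [hD, U, Matrix.mul_apply, Fin.sum_univ_three]; ring
  have e11 : D 1 1 = C 1 1 + 2 * x * C 0 1 + x ^ 2 * C 0 0 := by
    simp [hD, U, Matrix.mul_apply, Fin.sum_univ_three]; rw [hs.apply 0 1]; ring
  have e12 : D 1 2 = C 1 2 + z * C 1 1 + y * C 0 1 + x * (C 0 2 + z * C 0 1 + y * C 0 0) := by
    simp [hD, U, Matrix.mul_apply, Fin.sum_univ_three]; rw [hs.apply 0 1]; ring
  have hmu : D 0 0 * D 1 1 - D 0 1 ^ 2 = C 0 0 * C 1 1 - C 0 1 ^ 2 := by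
    rw [e00, e01, e11]; ring
  have hnu : D 0 0 * D 1 2 - D 0 1 * D 0 2 = C 0 0 * C 1 2 - C 0 1 * C 0 2 +
      z * (C 0 0 * C 1 1 - C 0 1 ^ 2) := by
    rw [e00, e01, e12, e02]; ring
  have hdet := LatIsom_det hBD
  -- swaps
  have hae : D 0 0 ≤ D 1 1 := by
    let P : TernMat := !![0, 1, 0; 1, 0, 0; 0, 0, 1]
    have hP : LatIsom D (Pᵀ * D * P) := ⟨P, by simp [P, Matrix.det_fin_three], rfl⟩
    have := min1 _ (LatIsom_trans hBD hP)
    have e : (Pᵀ * D * P) 0 0 = D 1 1 := by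
      simp [P, Matrix.mul_apply, Fin.sum_univ_three]
    rw [e] at this
    rw [e00, hCa]; exact this
  have hmr : D 0 0 * D 1 1 - D 0 1 ^ 2 ≤ D 0 0 * D 2 2 - D 0 2 ^ 2 := by
    let P : TernMat := !![1, 0, 0; 0, 0, 1; 0, 1, 0]
    have hP : LatIsom D (Pᵀ * D * P) := ⟨P, by simp [P, Matrix.det_fin_three], rfl⟩
    have e : (Pᵀ * D * P) 0 0 = D 0 0 := by
      simp [P, Matrix.mul_apply, Fin.sum_univ_three]
    have e' : (Pᵀ * D * P) 1 1 = D 2 2 := by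
      simp [P, Matrix.mul_apply, Fin.sum_univ_three]
    have e'' : (Pᵀ * D * P) 0 1 = D 0 2 := by
      simp [P, Matrix.mul_apply, Fin.sum_univ_three]
    have := min2 _ (LatIsom_trans hBD hP) (by rw [e, e00, hCa])
    rw [e, e', e''] at this
    rw [hmu, hCm]; exact this
  have key := red_bounds (d := B.det) h0' h1' (by rw [← hdet]; exact hd')
    (f := D 1 2) (g := D 2 2) (c := D 0 2)
    (by rw [← hdet, det_symm D hs'])
    (by rw [e01, e00]; exact hx) (by rw [e02, e00]; exact hy) (by rw [hnu, hmu]; exact hz)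
    hae hmr
  refine ⟨D, hBD, ?_⟩
  obtain ⟨⟨k1, k2, k3⟩, k4, k5, k6⟩ := key
  intro i j
  fin_cases i <;> fin_cases j
  · exact k1
  · exact k2
  · exact k3
  · show |D 1 0| ≤ _; rw [hs'.apply 0 1]; exact k2
  · exact k4
  · exact k5
  · show |D 2 0| ≤ _; rw [hs'.apply 0 2]; exact k3
  · show |D 2 1| ≤ _; rw [hs'.apply 1 2]; exact k5
  · exact k6

section
variable {p : ℕ} [hp : Fact p.Prime]

theorem PadicIsomP_refl {k : ℕ} (M : Matrix (Fin k) (Fin k) ℤ_[p]) : PadicIsomP p M M :=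
  ⟨1, by simp, by simp⟩

theorem PadicIsomP_symm {k : ℕ} {M N : Matrix (Fin k) (Fin k) ℤ_[p]} (h : PadicIsomP p M N) :
    PadicIsomP p N M := by
  obtain ⟨U, hU, rfl⟩ := h
  refine ⟨U⁻¹, ?_, ?_⟩
  · exact (Matrix.isUnit_nonsing_inv_det_iff).2 hU
  · rw [Matrix.transpose_nonsing_inv]
    simp only [Matrix.mul_assoc]
    rw [Matrix.mul_nonsing_inv _ hU, Matrix.mul_one, Matrix.nonsing_inv_mul_cancel_left]
    rwa [Matrix.det_transpose]

theorem PadicIsomP_trans {k : ℕ} {M N P : Matrix (Fin k) (Fin k) ℤ_[p]} (h : PadicIsomP p M N)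
    (h' : PadicIsomP p N P) : PadicIsomP p M P := by
  obtain ⟨U, hU, rfl⟩ := h
  obtain ⟨V, hV, rfl⟩ := h'
  refine ⟨U * V, ?_, ?_⟩
  · rw [Matrix.det_mul]; exact hU.mul hV
  · rw [Matrix.transpose_mul]; simp only [Matrix.mul_assoc]

theorem padicMat_mul {k : ℕ} (M N : Matrix (Fin k) (Fin k) ℤ) :
    padicMat p (M * N) = padicMat p M * padicMat p N := by
  unfold padicMat
  exact Matrix.map_mul (f := Int.castRingHom ℤ_[p])

theorem padicMat_tr {k : ℕ} (M : Matrix (Fin k) (Fin k) ℤ) :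
    padicMat p (Mᵀ) = (padicMat p M)ᵀ := rfl

theorem padicMat_det {k : ℕ} (M : Matrix (Fin k) (Fin k) ℤ) :
    (padicMat p M).det = (M.det : ℤ_[p]) := by
  unfold padicMat
  exact ((Int.castRingHom ℤ_[p]).map_det M).symm

theorem padic_of_lat {A B : TernMat} (h : LatIsom A B) :
    PadicIsomP p (padicMat p A) (padicMat p B) := by
  obtain ⟨U, hU, rfl⟩ := h
  refine ⟨padicMat p U, ?_, ?_⟩
  · rw [padicMat_det]; exact hU.map (Int.castRingHom ℤ_[p])
  · simp only [padicMat_mul, padicMat_tr]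

theorem padic_dvd_det {A B : TernMat} (h : PadicIsomP p (padicMat p A) (padicMat p B)) (n : ℕ) :
    (p : ℤ) ^ n ∣ A.det ↔ (p : ℤ) ^ n ∣ B.det := by
  obtain ⟨U, hU, h⟩ := h
  have h1 := congrArg Matrix.det h
  rw [Matrix.det_mul, Matrix.det_mul, Matrix.det_transpose, padicMat_det, padicMat_det] at h1
  rw [← PadicInt.pow_p_dvd_int_iff, ← PadicInt.pow_p_dvd_int_iff, ← h1]
  rw [mul_comm (U.det), mul_assoc]
  exact ((hU.mul hU).dvd_mul_right).symm

end

theorem InGenus_trans {A B C : TernMat} (h : InGenus A B) (h' : InGenus B C) : InGenus A C :=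
  ⟨h'.1, fun p hp => by
    haveI : Fact p.Prime := ⟨hp⟩
    exact PadicIsomP_trans (h.2 p hp) (h'.2 p hp)⟩

theorem InGenus_symm {A B : TernMat} (hA : IsLat A) (h : InGenus A B) : InGenus B A :=
  ⟨hA, fun p hp => by
    haveI : Fact p.Prime := ⟨hp⟩
    exact PadicIsomP_symm (h.2 p hp)⟩

theorem InGenus_refl {A : TernMat} (hA : IsLat A) : InGenus A A :=
  ⟨hA, fun p hp => by
    haveI : Fact p.Prime := ⟨hp⟩
    exact PadicIsomP_refl _⟩

theorem InGenus_det {A B : TernMat} (hA : IsLat A) (h : InGenus A B) : B.det = A.det := by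
  obtain ⟨_, _, _, hdA⟩ := (isLat_iff A).1 hA
  obtain ⟨_, _, _, hdB⟩ := (isLat_iff B).1 h.1
  have key : ∀ X Y : ℤ, 0 < X → 0 < Y → (∀ p k : ℕ, p.Prime → (p : ℤ) ^ k ∣ X → (p : ℤ) ^ k ∣ Y) →
      X ∣ Y := by
    intro X Y hX hY hh
    lift X to ℕ using hX.le
    lift Y to ℕ using hY.le
    norm_cast
    rw [Nat.dvd_iff_prime_pow_dvd_dvd]
    intro p k hp hk
    have := hh p k hp (by exact_mod_cast hk)
    exact_mod_cast this
  apply Int.dvd_antisymm hdB.le hdA.le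
  · apply key _ _ hdB hdA
    intro p k hp hk
    haveI : Fact p.Prime := ⟨hp⟩
    exact (padic_dvd_det (h.2 p hp) k).2 hk
  · apply key _ _ hdA hdB
    intro p k hp hk
    haveI : Fact p.Prime := ⟨hp⟩
    exact (padic_dvd_det (h.2 p hp) k).1 hk

/-- equivalence on the genus -/
def grel (A : TernMat) (B C : {B : TernMat // InGenus A B}) : Prop := LatIsom B.1 C.1

theorem grel_equiv (A : TernMat) : Equivalence (grel A) :=
  ⟨fun B => LatIsom_refl B.1, fun h => LatIsom_symm h, fun h h' => LatIsom_trans h h'⟩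

theorem g_finite {A : TernMat} (hA : IsLat A) : Finite (Quot (grel A)) := by
  have hfin : Finite {C : TernMat // ∀ i j, |C i j| ≤ redK A.det} := by
    have : Finite (Set.Icc (-redK A.det) (redK A.det)) := (Set.finite_Icc _ _).to_subtype
    refine Finite.of_injective (β := Fin 3 → Fin 3 → Set.Icc (-redK A.det) (redK A.det))
      (fun C i j => ⟨C.1 i j, abs_le.1 (C.2 i j)⟩) ?_
    intro C D h
    apply Subtype.ext
    ext i j
    exact congrArg Subtype.val (congrFun (congrFun h i) j)
  have hred : ∀ B : {B : TernMat // InGenus A B}, ∃ C, LatIsom B.1 C ∧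
      ∀ i j, |C i j| ≤ redK A.det := by
    intro B
    have := exists_reduced B.2.1
    rw [InGenus_det hA B.2] at this
    exact this
  choose C hC1 hC2 using hred
  refine Finite.of_injective (fun c : Quot (grel A) => (⟨C c.out, hC2 c.out⟩ :
    {C : TernMat // ∀ i j, |C i j| ≤ redK A.det})) ?_
  intro c c' h
  have h1 : C c.out = C c'.out := congrArg Subtype.val h
  have h2 := hC1 c.out
  rw [h1] at h2
  rw [← Quot.out_eq c, ← Quot.out_eq c']
  exact Quot.sound (LatIsom_trans h2 (LatIsom_symm (hC1 c'.out)))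

/-- the weighted sum over the genus -/
noncomputable def RG (A : TernMat) (n : ℤ) : ℝ :=
  csum (grel A) (fun B => numAut B.1) (fun B => (rRep n B.1 : ℝ))

theorem rGenus_eq (A : TernMat) (n : ℤ) : rGenus n A = (massOf A)⁻¹ * RG A n := rfl

theorem numAut_isom {A B : TernMat} (h : LatIsom A B) : numAut A = numAut B := by
  obtain ⟨V, hV, rfl⟩ := h
  symm
  refine Nat.card_congr
    { toFun := fun U => ⟨V * U.1 * V⁻¹, ?_, ?_⟩
      invFun := fun U => ⟨V⁻¹ * U.1 * V, ?_, ?_⟩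
      left_inv := fun U => Subtype.ext ?_
      right_inv := fun U => Subtype.ext ?_ }
  · rw [Matrix.det_mul, Matrix.det_mul]
    exact (hV.mul U.2.1).mul ((Matrix.isUnit_nonsing_inv_det_iff).2 hV)
  · have h2 := U.2.2
    have hVt : IsUnit (Vᵀ).det := by rwa [Matrix.det_transpose]
    have h3 : (V * U.1 * V⁻¹)ᵀ * A * (V * U.1 * V⁻¹) =
        (Vᵀ)⁻¹ * (U.1ᵀ * (Vᵀ * A * V) * U.1) * V⁻¹ := by
      simp only [Matrix.transpose_mul, Matrix.transpose_nonsing_inv, Matrix.mul_assoc]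
    rw [h3, h2]
    simp only [Matrix.mul_assoc]
    rw [Matrix.mul_nonsing_inv _ hV, Matrix.mul_one, Matrix.nonsing_inv_mul_cancel_left _ _ hVt]
  · rw [Matrix.det_mul, Matrix.det_mul]
    exact (((Matrix.isUnit_nonsing_inv_det_iff).2 hV).mul U.2.1).mul hV
  · have h2 := U.2.2
    have h3 : (V⁻¹ * U.1 * V)ᵀ * (Vᵀ * A * V) * (V⁻¹ * U.1 * V) =
        Vᵀ * (U.1ᵀ * ((V * V⁻¹)ᵀ * A * (V * V⁻¹)) * U.1) * V := by
      simp only [Matrix.transpose_mul, Matrix.mul_assoc]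
    rw [h3, Matrix.mul_nonsing_inv _ hV, Matrix.transpose_one, Matrix.one_mul, Matrix.mul_one, h2]
  · simp only [Matrix.mul_assoc]
    rw [Matrix.nonsing_inv_mul_cancel_left _ _ hV, Matrix.nonsing_inv_mul _ hV, Matrix.mul_one]
  · simp only [Matrix.mul_assoc]
    rw [Matrix.mul_nonsing_inv_cancel_left _ _ hV, Matrix.mul_nonsing_inv _ hV, Matrix.mul_one]

theorem massOf_pos {A : TernMat} (hA : IsLat A) : 0 < massOf A := by
  have := g_finite hA
  show 0 < ∑ᶠ c : Quot (grel A), ((numAut (Quot.out c).1 : ℝ))⁻¹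
  haveI := Fintype.ofFinite (Quot (grel A))
  rw [finsum_eq_sum_of_fintype]
  apply Finset.sum_pos
  · intro c _
    have := numAut_pos c.out.2.1
    positivity
  · exact ⟨Quot.mk _ ⟨A, InGenus_refl hA⟩, Finset.mem_univ _⟩

theorem RG_pos {A B : TernMat} (hA : IsLat A) (hB : InGenus A B) {n : ℤ} {x : Fin 3 → ℤ}
    (hx : quadVal B x = n) : 0 < RG A n := by
  have := g_finite hA
  unfold RG csum
  haveI := Fintype.ofFinite (Quot (grel A))
  rw [finsum_eq_sum_of_fintype]
  apply Finset.sum_pos'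
  · intro c _
    positivity
  · refine ⟨Quot.mk _ ⟨B, hB⟩, Finset.mem_univ _, ?_⟩
    have h1 : grel A (Quot.mk (grel A) ⟨B, hB⟩).out ⟨B, hB⟩ := quot_out_rel (grel_equiv A) _
    have h2 : 0 < numAut (Quot.mk (grel A) ⟨B, hB⟩).out.1 := numAut_pos (Quot.mk (grel A) ⟨B, hB⟩).out.2.1
    have h3 : 0 < rRep n (Quot.mk (grel A) ⟨B, hB⟩).out.1 := by
      rw [rRep_isom h1]
      have := rep_finite hB.1 n
      have : Nonempty {x : Fin 3 → ℤ // quadVal B x = n} := ⟨⟨x, hx⟩⟩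
      exact Nat.card_pos
    positivity

/-! ### P5: unimodular forms over the p-adic integers -/

section
variable {p : ℕ} [hp : Fact p.Prime]

theorem toZMod_zero_iff (c : ℤ_[p]) : PadicInt.toZMod c = 0 ↔ (p : ℤ_[p]) ∣ c := by
  rw [← RingHom.mem_ker, PadicInt.ker_toZMod, PadicInt.maximalIdeal_eq_span_p,
    Ideal.mem_span_singleton]

theorem unit_iff_toZMod (c : ℤ_[p]) : IsUnit c ↔ PadicInt.toZMod c ≠ 0 := by
  rw [Ne, ← RingHom.mem_ker, PadicInt.ker_toZMod, IsLocalRing.mem_maximalIdeal]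
  simp

theorem unit_iff_not_dvd (c : ℤ_[p]) : IsUnit c ↔ ¬ (p : ℤ_[p]) ∣ c := by
  rw [unit_iff_toZMod, Ne, toZMod_zero_iff]

theorem hensel_quad (a b c : ℤ_[p]) (hc : (p : ℤ_[p]) ∣ c) (hb : IsUnit b) :
    ∃ t : ℤ_[p], a * t ^ 2 + b * t + c = 0 ∧ (p : ℤ_[p]) ∣ t := by
  let F : Polynomial ℤ_[p] := Polynomial.C a * Polynomial.X ^ 2 + Polynomial.C b * Polynomial.X +
    Polynomial.C c
  have h : ‖F.aeval (0 : ℤ_[p])‖ < ‖F.derivative.aeval (0 : ℤ_[p])‖ ^ 2 := by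
    have h1 : ‖b‖ = 1 := PadicInt.isUnit_iff.1 hb
    have h2 : ‖c‖ < 1 := by
      rw [← PadicInt.mem_nonunits]
      exact fun h => (unit_iff_not_dvd c).1 h hc
    simp [F, h1, h2]
  obtain ⟨z, hz, hz2, -⟩ := hensels_lemma h
  refine ⟨z, by simpa [F] using hz, ?_⟩
  have h1 : ‖b‖ = 1 := PadicInt.isUnit_iff.1 hb
  have h3 : ‖z‖ < 1 := by simpa [F, h1] using hz2
  by_contra hcon
  rw [← unit_iff_not_dvd, PadicInt.isUnit_iff] at hcon
  linarith

theorem sq_near_one (u : ℤ_[p]) (h : (4 * p : ℤ_[p]) ∣ u - 1) : ∃ r : ℤ_[p], IsUnit r ∧ r ^ 2 = u := by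
  obtain ⟨k, hk⟩ := h
  obtain ⟨t, ht, -⟩ := hensel_quad (p := p) 1 1 (-(p * k)) ⟨-k, by ring⟩ isUnit_one
  have hu : (1 + 2 * t) ^ 2 = u := by linear_combination 4 * ht - hk
  refine ⟨1 + 2 * t, ?_, hu⟩
  have : IsUnit u := by
    rw [unit_iff_not_dvd]
    intro h
    have : (p : ℤ_[p]) ∣ 1 := by
      have h2 : (p : ℤ_[p]) ∣ u - 1 := ⟨4 * k, by rw [hk]; ring⟩
      simpa using dvd_sub h h2
    have := (unit_iff_not_dvd (p := p) 1).1 isUnit_one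
    contradiction
  rw [← hu] at this
  exact (isUnit_pow_iff (by norm_num)).1 this

theorem isotropic_mod (X : Matrix (Fin 3) (Fin 3) (ZMod p)) :
    ∃ x : Fin 3 → ZMod p, x ≠ 0 ∧ quadVal X x = 0 := by
  let f : MvPolynomial (Fin 3) (ZMod p) :=
    ∑ i, ∑ j, MvPolynomial.X i * MvPolynomial.C (X i j) * MvPolynomial.X j
  have hdeg : f.totalDegree < Fintype.card (Fin 3) := by
    have : f.totalDegree ≤ 2 := by
      refine MvPolynomial.totalDegree_finsetSum_le fun i _ =>
        MvPolynomial.totalDegree_finsetSum_le fun j _ => ?_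
      refine (MvPolynomial.totalDegree_mul _ _).trans ?_
      have := MvPolynomial.totalDegree_mul (MvPolynomial.X i) (MvPolynomial.C (σ := Fin 3) (X i j))
      simp at this ⊢
      omega
    simp; omega
  have h1 := char_dvd_card_solutions p hdeg
  have hev : ∀ x, MvPolynomial.eval x f = quadVal X x := by
    intro x; simp [f, quadVal]
  by_contra hcon
  push Not at hcon
  have : Fintype.card {x : Fin 3 → ZMod p // MvPolynomial.eval x f = 0} = 1 := by
    rw [Fintype.card_eq_one_iff]
    refine ⟨⟨0, by rw [hev]; simp [quadVal]⟩, ?_⟩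
    rintro ⟨y, hy⟩
    rw [hev] at hy
    by_contra h
    exact hcon y (fun h' => h (Subtype.ext h')) hy
  rw [this] at h1
  exact hp.1.one_lt.ne' (Nat.dvd_one.1 h1)

/-- the standard unimodular form -/
def stdH {R : Type*} [CommRing R] (d : R) : Matrix (Fin 3) (Fin 3) R :=
  !![0, 0, 1; 0, -d, 0; 1, 0, 0]

theorem eq_stdH {R : Type*} [CommRing R] (M : Matrix (Fin 3) (Fin 3) R) (hM : M.IsSymm)
    (e00 : M 0 0 = 0) (e01 : M 0 1 = 0) (e02 : M 0 2 = 1) (e12 : M 1 2 = 0) (e22 : M 2 2 = 0) :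
    M = stdH M.det := by
  have e11 : M 1 1 = - M.det := by
    have := det_symm _ hM
    rw [e00, e01, e02, e12, e22] at this
    linear_combination this
  have e10 := hM.apply 0 1
  have e20 := hM.apply 0 2
  have e21 := hM.apply 1 2
  rw [e01] at e10
  rw [e02] at e20
  rw [e12] at e21
  ext i j
  fin_cases i <;> fin_cases j <;> simp [stdH, e00, e01, e02, e10, e11, e12, e20, e21, e22]

theorem isotropic_vec (h2 : p ≠ 2) (X : Matrix (Fin 3) (Fin 3) ℤ_[p]) (hX : X.IsSymm)
    (hd : IsUnit X.det) : ∃ v : Fin 3 → ℤ_[p], quadVal X v = 0 ∧ ∃ i, IsUnit ((X *ᵥ v) i) := by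
  let π : ℤ_[p] →+* ZMod p := PadicInt.toZMod
  obtain ⟨x, hx0, hx⟩ := isotropic_mod (X.map π)
  have hsurj : Function.Surjective π := ZMod.ringHom_surjective π
  choose g hg using hsurj
  let v : Fin 3 → ℤ_[p] := fun i => g (x i)
  have hv : π ∘ v = x := by funext i; simp [v, hg]
  have hmv : π ∘ (X *ᵥ v) = X.map π *ᵥ x := by
    rw [← hv]; funext i; exact RingHom.map_mulVec π X v i
  have hex : ∃ i, IsUnit ((X *ᵥ v) i) := by
    by_contra hcon
    push Not at hcon
    have h0 : X.map π *ᵥ x = 0 := by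
      rw [← hmv]
      funext i
      have := hcon i
      rw [unit_iff_toZMod] at this
      simpa using this
    have hdet : IsUnit (X.map π).det := by
      have := hd.map π
      rwa [RingHom.map_det] at this
    apply hx0
    exact Matrix.eq_zero_of_mulVec_eq_zero hdet.ne_zero h0
  obtain ⟨i, hi⟩ := hex
  have hq : (p : ℤ_[p]) ∣ quadVal X v := by
    rw [← toZMod_zero_iff]
    change π _ = 0
    rw [← hx, ← hv]
    simp [quadVal]
  have h2u : IsUnit (2 : ℤ_[p]) := by
    rw [unit_iff_toZMod]
    have : (PadicInt.toZMod (2 : ℤ_[p])) = ((2 : ℕ) : ZMod p) := by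
      rw [map_ofNat]; simp
    rw [this, Ne, ZMod.natCast_eq_zero_iff]
    exact fun h => h2 ((Nat.prime_dvd_prime_iff_eq hp.1 Nat.prime_two).1 h)
  obtain ⟨t, ht, hpt⟩ := hensel_quad (X i i) (2 * (X *ᵥ v) i) _ hq (h2u.mul hi)
  refine ⟨v + t • Pi.single i 1, ?_, i, ?_⟩
  · rw [← ht, quadVal_three X hX, quadVal_three X hX]
    fin_cases i <;> simp [mulVec, dotProduct, Fin.sum_univ_three, hX.apply 0 1, hX.apply 0 2,
      hX.apply 1 2] <;> ring
  · rw [Matrix.mulVec_add, Matrix.mulVec_smul]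
    have : IsUnit ((X *ᵥ v) i + t * X i i) := by
      rw [unit_iff_not_dvd] at hi ⊢
      intro h
      exact hi ((dvd_add_left (hpt.mul_right _)).1 h)
    simpa using this

set_option maxHeartbeats 1000000 in
theorem unimod_std (h2 : p ≠ 2) (X : Matrix (Fin 3) (Fin 3) ℤ_[p]) (hX : X.IsSymm)
    (hd : IsUnit X.det) : ∃ P : Matrix (Fin 3) (Fin 3) ℤ_[p], P.det = 1 ∧
      Pᵀ * X * P = stdH X.det := by
  obtain ⟨v, hv, i, hi⟩ := isotropic_vec h2 X hX hd
  obtain ⟨k, hk⟩ := hi.exists_left_inv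
  have h2u : IsUnit (2 : ℤ_[p]) := by
    rw [unit_iff_toZMod]
    have : (PadicInt.toZMod (2 : ℤ_[p])) = ((2 : ℕ) : ZMod p) := by
      rw [map_ofNat]; simp
    rw [this, Ne, ZMod.natCast_eq_zero_iff]
    exact fun h => h2 ((Nat.prime_dvd_prime_iff_eq hp.1 Nat.prime_two).1 h)
  obtain ⟨h, hh⟩ := h2u.exists_left_inv
  -- a vector w with Q(w) = 0 and B(v,w) = 1
  have hw : ∃ w : Fin 3 → ℤ_[p], quadVal X w = 0 ∧ (X *ᵥ v) ⬝ᵥ w = 1 := by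
    let w0 : Fin 3 → ℤ_[p] := k • Pi.single i 1
    have e1 : (X *ᵥ v) ⬝ᵥ w0 = 1 := by
      simp only [w0, dotProduct_smul, dotProduct_single, smul_eq_mul, mul_one]
      exact hk
    refine ⟨w0 + (-(h * quadVal X w0)) • v, ?_, ?_⟩
    · have : ∀ c : ℤ_[p], quadVal X (w0 + c • v) =
          quadVal X w0 + 2 * c * ((X *ᵥ v) ⬝ᵥ w0) + c ^ 2 * quadVal X v := by
        intro c
        rw [quadVal_three X hX, quadVal_three X hX, quadVal_three X hX]
        simp [mulVec, dotProduct, Fin.sum_univ_three, hX.apply 0 1, hX.apply 0 2, hX.apply 1 2]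
        ring
      rw [this, e1, hv]
      linear_combination (-quadVal X w0) * hh
    · rw [dotProduct_add, e1, dotProduct_smul, dotProduct_comm, ← quadVal_eq, hv]
      simp
  obtain ⟨w, hw, hvw⟩ := hw
  rw [quadVal_three X hX] at hv hw
  have hdet := det_symm X hX
  simp only [mulVec, dotProduct, Fin.sum_univ_three] at hvw
  rw [hX.apply 0 1, hX.apply 0 2, hX.apply 1 2] at hvw
  set a := X 0 0 with ha
  set b := X 0 1 with hb
  set c := X 0 2 with hc
  set e := X 1 1 with he
  set f := X 1 2 with hf
  set g := X 2 2 with hg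
  have hXe : X = !![a, b, c; b, e, f; c, f, g] := by
    ext i j; fin_cases i <;> fin_cases j <;> simp [a, b, c, e, f, g, hX.apply 0 1, hX.apply 0 2, hX.apply 1 2]
  obtain ⟨v0, hv0⟩ : ∃ y, y = v 0 := ⟨_, rfl⟩
  obtain ⟨v1, hv1⟩ : ∃ y, y = v 1 := ⟨_, rfl⟩
  obtain ⟨v2, hv2⟩ : ∃ y, y = v 2 := ⟨_, rfl⟩
  obtain ⟨w0, hw0⟩ : ∃ y, y = w 0 := ⟨_, rfl⟩
  obtain ⟨w1, hw1⟩ : ∃ y, y = w 1 := ⟨_, rfl⟩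
  obtain ⟨w2, hw2⟩ : ∃ y, y = w 2 := ⟨_, rfl⟩
  rw [← hv0, ← hv1, ← hv2] at hv hvw
  rw [← hw0, ← hw1, ← hw2] at hw hvw
  obtain ⟨r0, hr0⟩ : ∃ y, y = a * v0 + b * v1 + c * v2 := ⟨_, rfl⟩
  obtain ⟨r1, hr1⟩ : ∃ y, y = b * v0 + e * v1 + f * v2 := ⟨_, rfl⟩
  obtain ⟨r2, hr2⟩ : ∃ y, y = c * v0 + f * v1 + g * v2 := ⟨_, rfl⟩
  obtain ⟨s0, hs0⟩ : ∃ y, y = a * w0 + b * w1 + c * w2 := ⟨_, rfl⟩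
  obtain ⟨s1, hs1⟩ : ∃ y, y = b * w0 + e * w1 + f * w2 := ⟨_, rfl⟩
  obtain ⟨s2, hs2⟩ : ∃ y, y = c * w0 + f * w1 + g * w2 := ⟨_, rfl⟩
  have i1 : r0 * v0 + r1 * v1 + r2 * v2 = 0 := by rw [hr0, hr1, hr2, ← hv]; ring
  have i2 : s0 * w0 + s1 * w1 + s2 * w2 = 0 := by rw [hs0, hs1, hs2, ← hw]; ring
  have i3 : r0 * w0 + r1 * w1 + r2 * w2 = 1 := by rw [hr0, hr1, hr2, ← hvw]
  have i4 : s0 * v0 + s1 * v1 + s2 * v2 = 1 := by rw [hs0, hs1, hs2, ← hvw]; ring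
  let z0 := r1 * s2 - r2 * s1
  let z1 := r2 * s0 - r0 * s2
  let z2 := r0 * s1 - r1 * s0
  let P : Matrix (Fin 3) (Fin 3) ℤ_[p] := !![v0, z0, w0; v1, z1, w1; v2, z2, w2]
  have hP : P.det = 1 := by
    rw [Matrix.det_fin_three]
    simp [P, z0, z1, z2]
    linear_combination (s0 * v0 + s1 * v1 + s2 * v2) * i3 + i4 - (s0 * w0 + s1 * w1 + s2 * w2) * i1
  refine ⟨P, hP, ?_⟩
  have hsy : (Pᵀ * X * P).IsSymm := by
    unfold Matrix.IsSymm
    rw [Matrix.transpose_mul, Matrix.transpose_mul, Matrix.transpose_transpose, hX.eq,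
      Matrix.mul_assoc]
  have hdP : (Pᵀ * X * P).det = X.det := by
    rw [Matrix.det_mul, Matrix.det_mul, Matrix.det_transpose, hP]; ring
  have e00 : (Pᵀ * X * P) 0 0 = 0 := by
    rw [hXe, ← i1, hr0, hr1, hr2]
    simp [P, Matrix.mul_apply, Fin.sum_univ_three]; ring
  have e01 : (Pᵀ * X * P) 0 1 = 0 := by
    have : r0 * z0 + r1 * z1 + r2 * z2 = 0 := by simp only [z0, z1, z2]; ring
    rw [hXe, ← this, hr0, hr1, hr2]
    simp [P, Matrix.mul_apply, Fin.sum_univ_three]; ring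
  have e02 : (Pᵀ * X * P) 0 2 = 1 := by
    rw [hXe, ← i3, hr0, hr1, hr2]
    simp [P, Matrix.mul_apply, Fin.sum_univ_three]; ring
  have e12 : (Pᵀ * X * P) 1 2 = 0 := by
    have : s0 * z0 + s1 * z1 + s2 * z2 = 0 := by simp only [z0, z1, z2]; ring
    rw [hXe, ← this, hs0, hs1, hs2]
    simp [P, Matrix.mul_apply, Fin.sum_univ_three]; ring
  have e22 : (Pᵀ * X * P) 2 2 = 0 := by
    rw [hXe, ← i2, hs0, hs1, hs2]
    simp [P, Matrix.mul_apply, Fin.sum_univ_three]; ring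
  have := eq_stdH _ hsy e00 e01 e02 e12 e22
  rw [this, hdP]

theorem unimod_isom (h2 : p ≠ 2) (X Y : Matrix (Fin 3) (Fin 3) ℤ_[p]) (hX : X.IsSymm)
    (hY : Y.IsSymm) (hd : IsUnit X.det) (h : X.det = Y.det) : PadicIsomP p X Y := by
  obtain ⟨P, hP, h1⟩ := unimod_std h2 X hX hd
  obtain ⟨R, hR, h3⟩ := unimod_std h2 Y hY (h ▸ hd)
  have a : PadicIsomP p X (stdH X.det) := ⟨P, by rw [hP]; exact isUnit_one, h1⟩
  have b : PadicIsomP p Y (stdH X.det) := ⟨R, by rw [hR]; exact isUnit_one, by rw [h3, h]⟩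
  exact PadicIsomP_trans a (PadicIsomP_symm b)

end

/-! ### P5b: strong approximation for SL3, approximation of p-adic numbers -/

theorem exists_coprime_add (b N t : ℤ) (ht : t ≠ 0)
    (h : ∀ p : ℕ, p.Prime → (p : ℤ) ∣ b → (p : ℤ) ∣ N → (p : ℤ) ∣ t → False) :
    ∃ k : ℤ, IsCoprime (b + k * N) t := by
  let s : Finset ℕ := t.natAbs.primeFactors.filter (fun p : ℕ => ¬ (p : ℤ) ∣ b)
  refine ⟨∏ p ∈ (s : Finset ℕ), (p : ℤ), ?_⟩
  rw [Int.isCoprime_iff_gcd_eq_one]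
  by_contra hne
  obtain ⟨p, hp, hpd⟩ := Nat.exists_prime_and_dvd hne
  have h1 : (p : ℤ) ∣ b + (∏ p ∈ (s : Finset ℕ), (p : ℤ)) * N :=
    (Int.natCast_dvd_natCast.2 hpd).trans (Int.gcd_dvd_left ..)
  have h2 : (p : ℤ) ∣ t := (Int.natCast_dvd_natCast.2 hpd).trans (Int.gcd_dvd_right ..)
  by_cases hb : (p : ℤ) ∣ b
  · have h3 := (dvd_add_right hb).1 h1
    rcases (Nat.prime_iff_prime_int.1 hp).dvd_or_dvd h3 with h4 | h4
    · obtain ⟨r, hr, hpr⟩ := ((Nat.prime_iff_prime_int.1 hp).dvd_finsetProd_iff _).1 h4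
      simp only [s, Finset.mem_filter, Nat.mem_primeFactors] at hr
      have := (Nat.prime_dvd_prime_iff_eq hp hr.1.1).1 (Int.natCast_dvd_natCast.1 hpr)
      exact hr.2 (this ▸ hb)
    · exact h p hp hb h4 h2
  · have hps : p ∈ s := by
      simp only [s, Finset.mem_filter, Nat.mem_primeFactors]
      exact ⟨⟨hp, Int.natCast_dvd.1 h2, by simpa using ht⟩, hb⟩
    have h3 : (p : ℤ) ∣ ∏ p ∈ (s : Finset ℕ), (p : ℤ) := Finset.dvd_prod_of_mem (fun p : ℕ => (p : ℤ)) hps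
    exact hb ((dvd_add_left (h3.mul_right N)).1 h1)

theorem prim3 (a b c N : ℤ) (hN : N ≠ 0)
    (h : ∀ p : ℕ, p.Prime → (p : ℤ) ∣ a → (p : ℤ) ∣ b → (p : ℤ) ∣ c → (p : ℤ) ∣ N → False) :
    ∃ a' c', N ∣ a' - a ∧ N ∣ c' - c ∧ IsCoprime c' (Int.gcd a' b : ℤ) := by
  obtain ⟨a', ha', h0⟩ : ∃ a' : ℤ, N ∣ a' - a ∧ a' ≠ 0 := by
    by_cases ha : a = 0
    · exact ⟨N, by simp [ha], hN⟩
    · exact ⟨a, by simp, ha⟩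
  have hg : (Int.gcd a' b : ℤ) ≠ 0 := by
    simp [Int.gcd_eq_zero_iff, h0]
  obtain ⟨k, hk⟩ := exists_coprime_add c N _ hg (by
    intro p hp h1 h2 h3
    have h4 : (p : ℤ) ∣ a' := h3.trans (Int.gcd_dvd_left ..)
    have h5 : (p : ℤ) ∣ b := h3.trans (Int.gcd_dvd_right ..)
    exact h p hp ((dvd_sub_right h4).1 (h2.trans ha')) h5 h1 h2)
  exact ⟨a', _, ha', ⟨k, by ring⟩, hk⟩

theorem complete3 (a b c : ℤ) (h : IsCoprime c (Int.gcd a b : ℤ)) :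
    ∃ W : TernMat, W.det = 1 ∧ W 0 0 = a ∧ W 1 0 = b ∧ W 2 0 = c := by
  obtain ⟨s, r, hsr⟩ := h
  by_cases hg : Int.gcd a b = 0
  · have ha := (Int.gcd_eq_zero_iff.1 hg)
    obtain ⟨rfl, rfl⟩ := ha
    simp at hsr
    refine ⟨!![0, 1, 0; 0, 0, s; c, 0, 0], ?_, by simp, by simp, by simp⟩
    rw [Matrix.det_fin_three]; simp; linarith
  · set g : ℤ := (Int.gcd a b : ℤ) with hgdef
    have hg' : g ≠ 0 := by simpa [g] using hg
    obtain ⟨a', ha⟩ : g ∣ a := Int.gcd_dvd_left ..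
    obtain ⟨b', hb⟩ : g ∣ b := Int.gcd_dvd_right ..
    have hbez := Int.gcd_eq_gcd_ab a b
    rw [← hgdef] at hbez
    set u := Int.gcdA a b
    set v := Int.gcdB a b
    have huv : a' * u + b' * v = 1 := by
      apply mul_left_cancel₀ hg'
      linear_combination -hbez - u * ha - v * hb
    refine ⟨!![a, -v, -a' * s; b, u, -b' * s; c, 0, r], ?_, by simp, by simp, by simp⟩
    rw [Matrix.det_fin_three]
    simp
    linear_combination hsr + c * s * huv - r * hbez

theorem SA2 (e f g h N : ℤ) (hN : N ≠ 0) (hd : N ∣ e * h - f * g - 1) :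
    ∃ e' f' g' h' : ℤ, e' * h' - f' * g' = 1 ∧ N ∣ e' - e ∧ N ∣ f' - f ∧ N ∣ g' - g ∧ N ∣ h' - h := by
  obtain ⟨e', he', h0⟩ : ∃ e' : ℤ, N ∣ e' - e ∧ e' ≠ 0 := by
    by_cases ha : e = 0
    · exact ⟨N, by simp [ha], hN⟩
    · exact ⟨e, by simp, ha⟩
  have hd' : N ∣ e' * h - f * g - 1 := by
    have := dvd_add hd (he'.mul_right h)
    ring_nf at this ⊢; exact this
  obtain ⟨k, hk⟩ := exists_coprime_add g N e' h0 (by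
    intro p hp h1 h2 h3
    have : (p : ℤ) ∣ 1 := by
      have h4 := h2.trans hd'
      have h5 := dvd_sub (dvd_sub (h3.mul_right h) (h1.mul_left f)) h4
      simpa using h5
    exact hp.one_lt.ne' (Nat.dvd_one.1 (Int.natCast_dvd_natCast.1 (by rw [Nat.cast_one]; exact this))))
  set g' := g + k * N with hg'
  have hgg : N ∣ g' - g := ⟨k, by rw [hg']; ring⟩
  have hd2 : N ∣ e' * h - f * g' - 1 := by
    have := dvd_sub hd' (hgg.mul_left f)
    ring_nf at this ⊢; exact this
  obtain ⟨v, u, huv⟩ := hk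
  refine ⟨e', e' * (u * f + v * h) - v, g', g' * (u * f + v * h) + u, ?_, he', ?_, hgg, ?_⟩
  · linear_combination huv
  · have : e' * (u * f + v * h) - v - f = v * (e' * h - f * g' - 1) := by
      linear_combination f * huv
    rw [this]; exact hd2.mul_left v
  · have : g' * (u * f + v * h) + u - h = - (u * (e' * h - f * g' - 1)) := by
      linear_combination h * huv
    rw [this]; exact (hd2.mul_left u).neg_right

theorem SA3 (V : TernMat) (N : ℤ) (hN : N ≠ 0) (hd : N ∣ V.det - 1) :
    ∃ W : TernMat, W.det = 1 ∧ ∀ i j, N ∣ W i j - V i j := by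
  obtain ⟨a', c', ha, hc, hco⟩ := prim3 (V 0 0) (V 1 0) (V 2 0) N hN (by
    intro p hp h1 h2 h3 h4
    have : (p : ℤ) ∣ 1 := by
      have h5 : (p : ℤ) ∣ V.det := by
        rw [Matrix.det_fin_three]
        have e : V 0 0 * V 1 1 * V 2 2 - V 0 0 * V 1 2 * V 2 1 - V 0 1 * V 1 0 * V 2 2 +
          V 0 1 * V 1 2 * V 2 0 + V 0 2 * V 1 0 * V 2 1 - V 0 2 * V 1 1 * V 2 0 =
          V 0 0 * (V 1 1 * V 2 2 - V 1 2 * V 2 1) + V 1 0 * (V 0 2 * V 2 1 - V 0 1 * V 2 2) +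
          V 2 0 * (V 0 1 * V 1 2 - V 0 2 * V 1 1) := by ring
        rw [e]
        exact dvd_add (dvd_add (h1.mul_right _) (h2.mul_right _)) (h3.mul_right _)
      have h6 := dvd_sub h5 (h4.trans hd)
      simpa using h6
    exact hp.one_lt.ne' (Nat.dvd_one.1 (Int.natCast_dvd_natCast.1 (by rw [Nat.cast_one]; exact this))))
  obtain ⟨W1, hW1, w0, w1, w2⟩ := complete3 a' (V 1 0) c' hco
  set V1 := W1.adjugate * V with hV1
  have hWV : W1 * V1 = V := by
    rw [hV1, ← Matrix.mul_assoc, Matrix.mul_adjugate, hW1]; simp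
  -- first column of V1 is e0 mod N
  have hcol : ∀ i, N ∣ V1 i 0 - (1 : TernMat) i 0 := by
    intro i
    have e1 : W1.adjugate * W1 = 1 := by rw [Matrix.adjugate_mul, hW1]; simp
    rw [← e1, hV1, Matrix.mul_apply, Matrix.mul_apply]
    simp only [Fin.sum_univ_three, w0, w1, w2]
    have : W1.adjugate i 0 * V 0 0 + W1.adjugate i 1 * V 1 0 + W1.adjugate i 2 * V 2 0 -
        (W1.adjugate i 0 * a' + W1.adjugate i 1 * V 1 0 + W1.adjugate i 2 * c') =
        - (W1.adjugate i 0 * (a' - V 0 0) + W1.adjugate i 2 * (c' - V 2 0)) := by ring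
    rw [this]
    exact (dvd_add (ha.mul_left _) (hc.mul_left _)).neg_right
  have c0 : N ∣ V1 0 0 - 1 := by simpa using hcol 0
  have c1 : N ∣ V1 1 0 := by simpa using hcol 1
  have c2 : N ∣ V1 2 0 := by simpa using hcol 2
  have hdet1 : V1.det = V.det := by
    conv_rhs => rw [← hWV, Matrix.det_mul, hW1, one_mul]
  have hd2 : N ∣ V1 1 1 * V1 2 2 - V1 1 2 * V1 2 1 - 1 := by
    rw [← hdet1, Matrix.det_fin_three] at hd
    have e : V1 1 1 * V1 2 2 - V1 1 2 * V1 2 1 - 1 =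
      (V1 0 0 * V1 1 1 * V1 2 2 - V1 0 0 * V1 1 2 * V1 2 1 - V1 0 1 * V1 1 0 * V1 2 2 +
          V1 0 1 * V1 1 2 * V1 2 0 + V1 0 2 * V1 1 0 * V1 2 1 - V1 0 2 * V1 1 1 * V1 2 0 - 1)
      - (V1 0 0 - 1) * (V1 1 1 * V1 2 2 - V1 1 2 * V1 2 1)
      - V1 1 0 * (V1 0 2 * V1 2 1 - V1 0 1 * V1 2 2)
      - V1 2 0 * (V1 0 1 * V1 1 2 - V1 0 2 * V1 1 1) := by ring
    rw [e]
    exact dvd_sub (dvd_sub (dvd_sub hd (c0.mul_right _)) (c1.mul_right _)) (c2.mul_right _)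
  obtain ⟨e', f', g', h', hdet, k1, k2, k3, k4⟩ := SA2 _ _ _ _ N hN hd2
  let V2 : TernMat := !![1, V1 0 1, V1 0 2; 0, e', f'; 0, g', h']
  have hV2 : V2.det = 1 := by
    rw [Matrix.det_fin_three]; simp [V2]; linear_combination hdet
  have hdiff : ∀ i j, N ∣ V2 i j - V1 i j := by
    intro i j
    fin_cases i <;> fin_cases j <;> simp [V2]
    · rw [← neg_sub]; exact c0.neg_right
    · exact c1
    · exact k1
    · exact k2
    · exact c2
    · exact k3
    · exact k4
  refine ⟨W1 * V2, by rw [Matrix.det_mul, hW1, hV2, one_mul], ?_⟩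
  intro i j
  have : (W1 * V2) i j - V i j = ∑ k, W1 i k * (V2 k j - V1 k j) := by
    rw [← hWV, Matrix.mul_apply, Matrix.mul_apply, ← Finset.sum_sub_distrib]
    exact Finset.sum_congr rfl fun k _ => by ring
  rw [this]
  exact Finset.dvd_sum fun k _ => (hdiff k j).mul_left _

section
variable {p : ℕ} [hp : Fact p.Prime]

theorem padic_unit_nat {m : ℕ} (h : ¬ p ∣ m) : IsUnit (m : ℤ_[p]) := by
  rw [unit_iff_toZMod, map_natCast, Ne, ZMod.natCast_eq_zero_iff]
  exact h

theorem padic_assoc (M : ℕ) (hM : M ≠ 0) :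
    Associated ((p : ℤ_[p]) ^ (M.factorization p)) (M : ℤ_[p]) := by
  have h := Nat.ordProj_mul_ordCompl_eq_self M p
  have hu : IsUnit ((M / p ^ M.factorization p : ℕ) : ℤ_[p]) :=
    padic_unit_nat (Nat.not_dvd_ordCompl hp.1 hM)
  refine ⟨hu.unit, ?_⟩
  rw [IsUnit.unit_spec]
  conv_rhs => rw [← h]
  push_cast
  rfl

theorem padic_approx (M : ℕ) (hM : M ≠ 0) (x : ℤ_[p]) : ∃ m : ℕ, (M : ℤ_[p]) ∣ x - m := by
  refine ⟨x.appr (M.factorization p), ?_⟩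
  rw [← (padic_assoc M hM).dvd_iff_dvd_left, ← Ideal.mem_span_singleton]
  exact PadicInt.appr_spec _ _

end

/-- an integer divisibility from the local ones -/
theorem dvd_of_padic {M : ℕ} (hM : M ≠ 0) {x : ℤ}
    (h : ∀ (p : ℕ) (hp : Fact p.Prime), p ∣ M → (M : ℤ_[p]) ∣ (x : ℤ_[p])) : (M : ℤ) ∣ x := by
  rw [Int.natCast_dvd]
  by_cases hx : x = 0
  · simp [hx]
  rw [Nat.dvd_iff_prime_pow_dvd_dvd]
  intro p k hp hk
  haveI : Fact p.Prime := ⟨hp⟩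
  rcases Nat.eq_zero_or_pos k with rfl | hk0
  · simp
  have h1 := h p ⟨hp⟩ ((dvd_pow_self p hk0.ne').trans hk)
  rw [← Int.natCast_dvd]
  push_cast
  rw [← PadicInt.pow_p_dvd_int_iff]
  refine dvd_trans ?_ h1
  obtain ⟨c, rfl⟩ := hk
  exact ⟨c, by push_cast; ring⟩

/-- simultaneous approximation -/
theorem crt_padic (M : ℕ) (hM : M ≠ 0) (x : ∀ (p : ℕ) (_ : Fact p.Prime), ℤ_[p]) :
    ∃ m : ℤ, ∀ (p : ℕ) (hp : Fact p.Prime), p ∣ M → (M : ℤ_[p]) ∣ (m : ℤ_[p]) - x p hp := by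
  have h1 : ∀ p : ℕ, ∃ a : ℕ, ∀ hp : Fact p.Prime, (M : ℤ_[p]) ∣ x p hp - a := by
    intro p
    by_cases hp : p.Prime
    · haveI : Fact p.Prime := ⟨hp⟩
      obtain ⟨a, ha⟩ := padic_approx M hM (x p ⟨hp⟩)
      exact ⟨a, fun _ => ha⟩
    · exact ⟨0, fun h => absurd h.1 hp⟩
  choose a ha using h1
  obtain ⟨k, hk⟩ := Nat.chineseRemainderOfFinset a (fun p => p ^ M.factorization p) M.primeFactors
    (by intro p hp; exact pow_ne_zero _ (Nat.prime_of_mem_primeFactors hp).ne_zero)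
    (by
      intro p hp r hr hne
      exact Nat.Coprime.pow _ _ ((Nat.coprime_primes (Nat.prime_of_mem_primeFactors hp)
        (Nat.prime_of_mem_primeFactors hr)).2 hne))
  refine ⟨k, fun p hp hpM => ?_⟩
  have h2 := hk p (Nat.mem_primeFactors.2 ⟨hp.1, hpM, hM⟩)
  have h3 : (M : ℤ_[p]) ∣ (k : ℤ_[p]) - a p := by
    rw [← (padic_assoc M hM).dvd_iff_dvd_left]
    have := (Nat.modEq_iff_dvd.1 h2.symm)
    have h4 := map_dvd (Int.castRingHom ℤ_[p]) this
    push_cast at h4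
    simpa using h4
  have := dvd_sub h3 (ha p hp)
  have e : (((k : ℕ) : ℤ) : ℤ_[p]) - x p hp = (k : ℤ_[p]) - a p - (x p hp - a p) := by
    push_cast; ring
  rw [e]; exact this

/-- strong approximation for SL3 -/
theorem SA_padic (M : ℕ) (hM : M ≠ 0)
    (V : ∀ (p : ℕ) (_ : Fact p.Prime), Matrix (Fin 3) (Fin 3) ℤ_[p])
    (hV : ∀ (p : ℕ) (hp : Fact p.Prime), (V p hp).det = 1) :
    ∃ W : TernMat, W.det = 1 ∧ ∀ (p : ℕ) (hp : Fact p.Prime), p ∣ M →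
      ∀ i j, (M : ℤ_[p]) ∣ (W i j : ℤ_[p]) - V p hp i j := by
  have h1 : ∀ i j : Fin 3, ∃ m : ℤ, ∀ (p : ℕ) (hp : Fact p.Prime), p ∣ M →
      (M : ℤ_[p]) ∣ (m : ℤ_[p]) - V p hp i j := fun i j => crt_padic M hM _
  choose V0 hV0 using h1
  have hdet : (M : ℤ) ∣ Matrix.det (Matrix.of V0) - 1 := by
    apply dvd_of_padic hM
    intro p hp hpM
    rw [Int.cast_sub, Int.cast_one, ← padicMat_det]
    have : (M : ℤ_[p]) ∣ (padicMat p (Matrix.of V0)).det - (V p hp).det := by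
      rw [← Ideal.mem_span_singleton, ← Ideal.Quotient.eq, RingHom.map_det, RingHom.map_det]
      congr 1
      ext i j
      simp only [RingHom.mapMatrix_apply, Matrix.map_apply, padicMat]
      rw [Ideal.Quotient.eq, Ideal.mem_span_singleton]
      exact hV0 i j p hp hpM
    rwa [hV] at this
  obtain ⟨W, hW, h⟩ := SA3 _ (M : ℤ) (by exact_mod_cast hM) hdet
  refine ⟨W, hW, fun p hp hpM i j => ?_⟩
  have h2 := map_dvd (Int.castRingHom ℤ_[p]) (h i j)
  have h3 : (M : ℤ_[p]) ∣ (W i j : ℤ_[p]) - V0 i j := by simpa using h2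
  have := dvd_add h3 (hV0 i j p hp hpM)
  simpa using this

/-! ### P6: neighbours of a ternary lattice in standard position mod q^2 -/

def StdQ (q : ℕ) (d : ℤ) (B : TernMat) : Prop := ∀ i j, (q : ℤ) ^ 2 ∣ B i j - stdH d i j

section
variable {q : ℕ} {d : ℤ}

def nbS (q : ℕ) (d : ℤ) : Option (ZMod q) → TernMat
  | none => !![0, 0, 1; 0, 1, 0; 1, 0, 0]
  | some s => !![1, 0, 0; (s.val : ℤ), 1, 0;
      (((q : ℤ) ^ 2 + 1) / 2) * d * (s.val : ℤ) ^ 2, d * (s.val : ℤ), 1]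

def nbSi (q : ℕ) (d : ℤ) : Option (ZMod q) → TernMat
  | none => !![0, 0, 1; 0, 1, 0; 1, 0, 0]
  | some s => !![1, 0, 0; -(s.val : ℤ), 1, 0;
      (1 - ((q : ℤ) ^ 2 + 1) / 2) * d * (s.val : ℤ) ^ 2, - d * (s.val : ℤ), 1]

theorem nbS_mul (s : Option (ZMod q)) : nbS q d s * nbSi q d s = 1 := by
  cases s with
  | none =>
    ext i j; fin_cases i <;> fin_cases j <;> simp [nbS, nbSi, Matrix.mul_apply, Fin.sum_univ_three]
  | some s =>
    ext i j; fin_cases i <;> fin_cases j <;>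
      simp [nbS, nbSi, Matrix.mul_apply, Fin.sum_univ_three, -ZMod.natCast_val] <;> ring

theorem nbS_mul' (s : Option (ZMod q)) : nbSi q d s * nbS q d s = 1 :=
  mul_eq_one_comm.1 (nbS_mul s)

def nbD (q : ℕ) : TernMat := !![1, 0, 0; 0, (q : ℤ), 0; 0, 0, (q : ℤ) ^ 2]
def nbD' (q : ℕ) : TernMat := !![(q : ℤ) ^ 2, 0, 0; 0, (q : ℤ), 0; 0, 0, 1]

theorem nbD_mul : nbD q * nbD' q = ((q : ℤ) ^ 2) • (1 : TernMat) := by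
  ext i j; fin_cases i <;> fin_cases j <;>
    simp [nbD, nbD', Matrix.mul_apply, Fin.sum_univ_three]
  ring

def nbT (q : ℕ) (d : ℤ) : Option (Option (ZMod q)) → TernMat
  | none => (q : ℤ) • (1 : TernMat)
  | some s => nbS q d s * nbD q

def nbT' (q : ℕ) (d : ℤ) : Option (Option (ZMod q)) → TernMat
  | none => (q : ℤ) • (1 : TernMat)
  | some s => nbD' q * nbSi q d s

theorem nbT_mul (j : Option (Option (ZMod q))) :
    nbT q d j * nbT' q d j = ((q : ℤ) ^ 2) • (1 : TernMat) := by
  cases j with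
  | none => simp [nbT, nbT', pow_two, smul_smul]
  | some s =>
    simp only [nbT, nbT']
    rw [Matrix.mul_assoc, ← Matrix.mul_assoc (nbD q), nbD_mul, Matrix.smul_mul, Matrix.one_mul,
      Matrix.mul_smul, nbS_mul]

theorem half_spec (h2 : Odd q) : 2 * (((q : ℤ) ^ 2 + 1) / 2) = (q : ℤ) ^ 2 + 1 := by
  obtain ⟨k, rfl⟩ := h2
  have : ((2 * k + 1 : ℕ) : ℤ) ^ 2 + 1 = 2 * (2 * k ^ 2 + 2 * k + 1) := by push_cast; ring
  rw [this]; simp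

/-- the transform by `nbS` is again standard -/
theorem std_nbS (h2 : Odd q) {B : TernMat} (hB : StdQ q d B) (s : Option (ZMod q)) :
    StdQ q d ((nbS q d s)ᵀ * B * nbS q d s) := by
  have hex : ∀ i j, ∃ k, B i j = stdH d i j + (q : ℤ) ^ 2 * k := by
    intro i j
    obtain ⟨k, hk⟩ := hB i j
    exact ⟨k, by linarith⟩
  choose R hR using hex
  have hBR : B = stdH d + ((q : ℤ) ^ 2) • Matrix.of R := by
    ext i j; simp [hR i j]
  have hmain : ∀ i j, (q : ℤ) ^ 2 ∣ ((nbS q d s)ᵀ * stdH d * nbS q d s) i j - stdH d i j := by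
    cases s with
    | none =>
      intro i j; fin_cases i <;> fin_cases j <;>
        simp [nbS, stdH, Matrix.mul_apply, Fin.sum_univ_three]
    | some s =>
      have e : (nbS q d (some s))ᵀ * stdH d * nbS q d (some s) - stdH d =
          !![(q : ℤ) ^ 2 * (d * (s.val : ℤ) ^ 2), 0, 0; 0, 0, 0; 0, 0, 0] := by
        have hh := half_spec h2
        simp only [nbS]
        generalize ((q : ℤ) ^ 2 + 1) / 2 = h at hh ⊢
        generalize (s.val : ℤ) = t
        ext i j
        fin_cases i <;> fin_cases j <;>
          simp [stdH, Matrix.mul_apply, Fin.sum_univ_three] <;> try ring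
        linear_combination d * t ^ 2 * hh
      intro i j
      rw [← Matrix.sub_apply, e]
      fin_cases i <;> fin_cases j <;> simp
  intro i j
  have : ((nbS q d s)ᵀ * B * nbS q d s) i j - stdH d i j =
      (((nbS q d s)ᵀ * stdH d * nbS q d s) i j - stdH d i j) +
      (q : ℤ) ^ 2 * ((nbS q d s)ᵀ * Matrix.of R * nbS q d s) i j := by
    rw [hBR]
    simp only [Matrix.mul_add, Matrix.add_mul, Matrix.mul_smul, Matrix.smul_mul, Matrix.add_apply,
      Matrix.smul_apply, smul_eq_mul]
    ring
  rw [this]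
  exact dvd_add (hmain i j) (dvd_mul_right _ _)

/-- the six congruences -/
theorem std_entries {B : TernMat} (hs : B.IsSymm) (hB : StdQ q d B) :
    (q : ℤ) ^ 2 ∣ B 0 0 ∧ (q : ℤ) ^ 2 ∣ B 0 1 ∧ (q : ℤ) ^ 2 ∣ B 0 2 - 1 ∧ (q : ℤ) ^ 2 ∣ B 1 1 + d ∧
    (q : ℤ) ^ 2 ∣ B 1 2 ∧ (q : ℤ) ^ 2 ∣ B 2 2 := by
  refine ⟨?_, ?_, ?_, ?_, ?_, ?_⟩
  · simpa [stdH] using hB 0 0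
  · simpa [stdH] using hB 0 1
  · simpa [stdH] using hB 0 2
  · simpa [stdH] using hB 1 1
  · simpa [stdH] using hB 1 2
  · simpa [stdH] using hB 2 2

theorem nb_C {B : TernMat} (hs : B.IsSymm) (hB : StdQ q d B) :
    ∃ C : TernMat, (nbD q)ᵀ * B * nbD q = ((q : ℤ) ^ 2) • C := by
  obtain ⟨⟨k0, h0⟩, ⟨k1, h1⟩, ⟨k2, h2⟩, ⟨k3, h3⟩, ⟨k4, h4⟩, ⟨k5, h5⟩⟩ := std_entries hs hB
  have h10 := hs.apply 0 1
  have h20 := hs.apply 0 2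
  have h21 := hs.apply 1 2
  refine ⟨!![k0, q * k1, B 0 2; q * k1, B 1 1, q * B 1 2; B 0 2, q * B 1 2, (q : ℤ) ^ 2 * B 2 2], ?_⟩
  ext i j
  fin_cases i <;> fin_cases j <;>
    simp [nbD, Matrix.mul_apply, Fin.sum_univ_three, h10, h20, h21, h0, h1] <;> ring

theorem nbT_C (h2 : Odd q) {B : TernMat} (hs : B.IsSymm) (hB : StdQ q d B)
    (j : Option (Option (ZMod q))) :
    ∃ C : TernMat, (nbT q d j)ᵀ * B * nbT q d j = ((q : ℤ) ^ 2) • C := by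
  cases j with
  | none =>
    refine ⟨B, ?_⟩
    simp only [nbT, Matrix.transpose_smul, Matrix.transpose_one, Matrix.smul_mul, Matrix.one_mul,
      Matrix.mul_smul, Matrix.mul_one, smul_smul, pow_two]
  | some s =>
    have hs' : ((nbS q d s)ᵀ * B * nbS q d s).IsSymm := by
      unfold Matrix.IsSymm
      rw [Matrix.transpose_mul, Matrix.transpose_mul, Matrix.transpose_transpose, hs.eq,
        Matrix.mul_assoc]
    obtain ⟨C, hC⟩ := nb_C hs' (std_nbS h2 hB s)
    refine ⟨C, ?_⟩
    rw [← hC]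
    simp only [nbT, Matrix.transpose_mul, Matrix.mul_assoc]

/-- membership in the neighbour -/
theorem nb_mem_none (y : Fin 3 → ℤ) :
    (∃ x, nbT q d none *ᵥ x = y) ↔ ∀ i, (q : ℤ) ∣ y i := by
  simp only [nbT, Matrix.smul_mulVec, Matrix.one_mulVec]
  constructor
  · rintro ⟨x, rfl⟩ i; simp
  · intro h
    choose x hx using h
    exact ⟨x, by funext i; simp [hx i]⟩

theorem nb_mem_some (s : Option (ZMod q)) (y : Fin 3 → ℤ) :
    (∃ x, nbT q d (some s) *ᵥ x = y) ↔
      (q : ℤ) ∣ (nbSi q d s *ᵥ y) 1 ∧ (q : ℤ) ^ 2 ∣ (nbSi q d s *ᵥ y) 2 := by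
  constructor
  · rintro ⟨x, rfl⟩
    simp only [nbT]
    rw [Matrix.mulVec_mulVec, ← Matrix.mul_assoc, nbS_mul', Matrix.one_mul]
    simp [nbD, Matrix.mulVec, dotProduct, Fin.sum_univ_three]
  · rintro ⟨⟨a, ha⟩, ⟨b, hb⟩⟩
    refine ⟨![(nbSi q d s *ᵥ y) 0, a, b], ?_⟩
    have : nbD q *ᵥ ![(nbSi q d s *ᵥ y) 0, a, b] = nbSi q d s *ᵥ y := by
      funext i
      fin_cases i
      · simp [nbD, Matrix.mulVec, dotProduct, Fin.sum_univ_three]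
      · change _ = (nbSi q d s *ᵥ y) 1
        rw [ha]
        simp [nbD, Matrix.mulVec, dotProduct, Fin.sum_univ_three]
      · change _ = (nbSi q d s *ᵥ y) 2
        rw [hb]
        simp [nbD, Matrix.mulVec, dotProduct, Fin.sum_univ_three]
    simp only [nbT]
    rw [← Matrix.mulVec_mulVec, this, Matrix.mulVec_mulVec, nbS_mul, Matrix.one_mulVec]

theorem nbSi_none (y : Fin 3 → ℤ) : (nbSi q d none *ᵥ y) 0 = y 2 ∧ (nbSi q d none *ᵥ y) 1 = y 1 ∧
    (nbSi q d none *ᵥ y) 2 = y 0 := by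
  simp [nbSi, Matrix.mulVec, dotProduct, Fin.sum_univ_three]

theorem nbSi_some (s : ZMod q) (y : Fin 3 → ℤ) : (nbSi q d (some s) *ᵥ y) 0 = y 0 ∧
    (nbSi q d (some s) *ᵥ y) 1 = y 1 - (s.val : ℤ) * y 0 ∧
    (nbSi q d (some s) *ᵥ y) 2 = y 2 - d * (s.val : ℤ) * y 1 +
      (1 - ((q : ℤ) ^ 2 + 1) / 2) * d * (s.val : ℤ) ^ 2 * y 0 := by
  simp only [nbSi, Matrix.mulVec, dotProduct, Fin.sum_univ_three]
  simp [-ZMod.natCast_val]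
  constructor <;> ring

/-- bilinear congruence -/
theorem std_bil {B : TernMat} (hs : B.IsSymm) (hB : StdQ q d B) (x y : Fin 3 → ℤ)
    (h : (q : ℤ) ^ 2 ∣ x ⬝ᵥ (B *ᵥ y)) : (q : ℤ) ^ 2 ∣ x 0 * y 2 + x 2 * y 0 - d * x 1 * y 1 := by
  obtain ⟨⟨k0, h0⟩, ⟨k1, h1⟩, ⟨k2, h2⟩, ⟨k3, h3⟩, ⟨k4, h4⟩, ⟨k5, h5⟩⟩ := std_entries hs hB
  obtain ⟨k, hk⟩ := h
  have h10 := hs.apply 0 1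
  have h20 := hs.apply 0 2
  have h21 := hs.apply 1 2
  simp only [Matrix.mulVec, dotProduct, Fin.sum_univ_three, h10, h20, h21] at hk
  refine ⟨k - (x 0 * k0 * y 0 + x 0 * k1 * y 1 + x 1 * k1 * y 0 + x 0 * k2 * y 2 + x 2 * k2 * y 0 +
    x 1 * k3 * y 1 + x 1 * k4 * y 2 + x 2 * k4 * y 1 + x 2 * k5 * y 2), ?_⟩
  linear_combination hk - x 0 * y 0 * h0 - (x 0 * y 1 + x 1 * y 0) * h1 -
    (x 0 * y 2 + x 2 * y 0) * h2 - x 1 * y 1 * h3 - (x 1 * y 2 + x 2 * y 1) * h4 - x 2 * y 2 * h5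

end

section
variable {q : ℕ} [hq : Fact q.Prime] {d : ℤ}

theorem q_dvd_mul {a b : ℤ} (h : (q : ℤ) ∣ a * b) (ha : ¬ (q : ℤ) ∣ a) : (q : ℤ) ∣ b :=
  ((Nat.prime_iff_prime_int.1 hq.1).dvd_or_dvd h).resolve_left ha

theorem q2_dvd_mul {a b : ℤ} (h : (q : ℤ) ^ 2 ∣ a * b) (ha : ¬ (q : ℤ) ∣ a) : (q : ℤ) ^ 2 ∣ b :=
  (Nat.prime_iff_prime_int.1 hq.1).pow_dvd_of_dvd_mul_left _ ha h

theorem q2_q {a : ℤ} (h : (q : ℤ) ^ 2 ∣ a) : (q : ℤ) ∣ a := (dvd_pow_self _ two_ne_zero).trans h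

theorem nbSi_bil {B : TernMat} (s : Option (ZMod q)) (x y : Fin 3 → ℤ) :
    x ⬝ᵥ (B *ᵥ y) = (nbSi q d s *ᵥ x) ⬝ᵥ
      (((nbS q d s)ᵀ * B * nbS q d s) *ᵥ (nbSi q d s *ᵥ y)) := by
  have e : x = nbS q d s *ᵥ (nbSi q d s *ᵥ x) := by
    rw [Matrix.mulVec_mulVec, nbS_mul, Matrix.one_mulVec]
  rw [Matrix.mulVec_mulVec, Matrix.mul_assoc, nbS_mul, Matrix.mul_one]
  conv_lhs => rw [e]
  rw [← Matrix.mulVec_mulVec, dotProduct_mulVec _ (nbS q d s)ᵀ, Matrix.vecMul_transpose]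

theorem nb_bil (h2 : Odd q) {B : TernMat} (hs : B.IsSymm) (hB : StdQ q d B) (s : Option (ZMod q))
    (x y : Fin 3 → ℤ) (h : (q : ℤ) ^ 2 ∣ x ⬝ᵥ (B *ᵥ y)) :
    (q : ℤ) ^ 2 ∣ (nbSi q d s *ᵥ x) 0 * (nbSi q d s *ᵥ y) 2 + (nbSi q d s *ᵥ x) 2 * (nbSi q d s *ᵥ y) 0
      - d * (nbSi q d s *ᵥ x) 1 * (nbSi q d s *ᵥ y) 1 := by
  have hs' : ((nbS q d s)ᵀ * B * nbS q d s).IsSymm := by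
    unfold Matrix.IsSymm
    rw [Matrix.transpose_mul, Matrix.transpose_mul, Matrix.transpose_transpose, hs.eq,
      Matrix.mul_assoc]
  rw [nbSi_bil (d := d) s] at h
  exact std_bil hs' (std_nbS h2 hB s) _ _ h

theorem q_not_two (h2 : Odd q) : ¬ (q : ℤ) ∣ 2 := by
  intro h
  have h3 : q ∣ 2 := by exact_mod_cast h
  have := (Nat.prime_dvd_prime_iff_eq hq.1 Nat.prime_two).1 h3
  subst this
  exact absurd h2 (by decide)

theorem nb_exists (h2 : Odd q) (hd : ¬ (q : ℤ) ∣ d) {B : TernMat} (hs : B.IsSymm) (hB : StdQ q d B)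
    (y : Fin 3 → ℤ) (hy : ¬ ∀ i, (q : ℤ) ∣ y i) (hQ : (q : ℤ) ^ 2 ∣ quadVal B y) :
    ∃ s : Option (ZMod q), (∃ x, nbT q d (some s) *ᵥ x = y) ∧ ¬ (q : ℤ) ∣ (nbSi q d s *ᵥ y) 0 := by
  have hqp := Nat.prime_iff_prime_int.1 hq.1
  rw [quadVal_eq] at hQ
  by_cases h0 : (q : ℤ) ∣ y 0
  · refine ⟨none, ?_⟩
    rw [nb_mem_some]
    obtain ⟨e0, e1, e2⟩ := nbSi_none (q := q) (d := d) y
    rw [e0, e1, e2]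
    have h3 := std_bil hs hB y y hQ
    have h4 : (q : ℤ) ∣ d * (y 1 * y 1) := by
      have h5 : (q : ℤ) ∣ y 0 * y 2 + y 2 * y 0 := dvd_add (h0.mul_right _) (h0.mul_left _)
      have := dvd_sub h5 (q2_q h3)
      ring_nf at this ⊢; exact this
    have h1 : (q : ℤ) ∣ y 1 := by
      have := q_dvd_mul h4 hd
      rcases hqp.dvd_or_dvd this with h | h <;> exact h
    have hy2 : ¬ (q : ℤ) ∣ y 2 := by
      intro h
      apply hy
      intro i; fin_cases i
      · exact h0
      · exact h1
      · exact h
    refine ⟨⟨h1, ?_⟩, hy2⟩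
    have h6 : (q : ℤ) ^ 2 ∣ y 1 * y 1 := by rw [pow_two]; exact mul_dvd_mul h1 h1
    have h7 : (q : ℤ) ^ 2 ∣ (2 * y 2) * y 0 := by
      have := dvd_add h3 (h6.mul_left d)
      ring_nf at this ⊢; exact this
    refine q2_dvd_mul h7 ?_
    intro h
    exact hy2 (q_dvd_mul h (q_not_two h2))
  · have h0' : ((y 0 : ℤ) : ZMod q) ≠ 0 := by
      rwa [Ne, ZMod.intCast_zmod_eq_zero_iff_dvd]
    let s : ZMod q := (y 1 : ZMod q) / (y 0 : ZMod q)
    refine ⟨some s, ?_⟩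
    rw [nb_mem_some]
    have h3 := nb_bil h2 hs hB (some s) y y hQ
    obtain ⟨e0, e1, e2⟩ := nbSi_some (d := d) s y
    have h4 : (q : ℤ) ∣ (nbSi q d (some s) *ᵥ y) 1 := by
      rw [e1, ← ZMod.intCast_zmod_eq_zero_iff_dvd]
      push_cast
      rw [ZMod.natCast_zmod_val]
      simp only [s]
      field_simp
      ring
    have h5 : ¬ (q : ℤ) ∣ (nbSi q d (some s) *ᵥ y) 0 := by rwa [e0]
    refine ⟨⟨h4, ?_⟩, h5⟩
    have h6 := mul_dvd_mul h4 h4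
    rw [← pow_two] at h6
    have h7 : (q : ℤ) ^ 2 ∣ (2 * (nbSi q d (some s) *ᵥ y) 0) * (nbSi q d (some s) *ᵥ y) 2 := by
      have := dvd_add h3 (h6.mul_left d)
      ring_nf at this ⊢; exact this
    refine q2_dvd_mul h7 ?_
    intro h
    exact h5 (q_dvd_mul h (q_not_two h2))

theorem nb_unique (y : Fin 3 → ℤ) (hy : ¬ ∀ i, (q : ℤ) ∣ y i) (s t : Option (ZMod q))
    (hs : ∃ x, nbT q d (some s) *ᵥ x = y) (ht : ∃ x, nbT q d (some t) *ᵥ x = y) : s = t := by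
  rw [nb_mem_some] at hs ht
  have key : ∀ s : ZMod q, ((q : ℤ) ∣ (nbSi q d (some s) *ᵥ y) 1 ∧
      (q : ℤ) ^ 2 ∣ (nbSi q d (some s) *ᵥ y) 2) → ¬ (q : ℤ) ∣ y 0 := by
    rintro s ⟨h1, h2⟩ h0
    obtain ⟨e0, e1, e2⟩ := nbSi_some (d := d) s y
    rw [e1] at h1
    rw [e2] at h2
    have h1' : (q : ℤ) ∣ y 1 := (dvd_sub_left (h0.mul_left _)).1 h1
    have h2' : (q : ℤ) ∣ y 2 := by
      have h3 := q2_q h2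
      rw [dvd_add_left (h0.mul_left _)] at h3
      exact (dvd_sub_left (h1'.mul_left _)).1 h3
    apply hy
    intro i; fin_cases i
    · exact h0
    · exact h1'
    · exact h2'
  have keyn : ((q : ℤ) ∣ (nbSi q d none *ᵥ y) 1 ∧
      (q : ℤ) ^ 2 ∣ (nbSi q d none *ᵥ y) 2) → (q : ℤ) ∣ y 0 := by
    rintro ⟨h1, h2⟩
    obtain ⟨e0, e1, e2⟩ := nbSi_none (q := q) (d := d) y
    rw [e2] at h2
    exact q2_q h2
  cases s with
  | none =>
    cases t with
    | none => rfl
    | some t => exact absurd (keyn hs) (key t ht)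
  | some s =>
    cases t with
    | none => exact absurd (keyn ht) (key s hs)
    | some t =>
      have h0 := key s hs
      have a1 := hs.1
      have a2 := ht.1
      rw [(nbSi_some (d := d) s y).2.1] at a1
      rw [(nbSi_some (d := d) t y).2.1] at a2
      have h0' : ((y 0 : ℤ) : ZMod q) ≠ 0 := by
        rwa [Ne, ZMod.intCast_zmod_eq_zero_iff_dvd]
      have h3 := dvd_sub a2 a1
      rw [← ZMod.intCast_zmod_eq_zero_iff_dvd] at h3
      push_cast at h3
      rw [ZMod.natCast_zmod_val, ZMod.natCast_zmod_val] at h3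
      have h4 : (s - t) * ((y 0 : ℤ) : ZMod q) = 0 := by linear_combination h3
      rcases mul_eq_zero.1 h4 with h | h
      · rw [sub_eq_zero.1 h]
      · exact absurd h h0'

theorem nb_root (h2 : Odd q) (hd : ¬ (q : ℤ) ∣ d) (x : Fin 3 → ℤ) (s : Option (ZMod q)) :
    (∃ z, nbT q d (some s) *ᵥ z = (q : ℤ) • x) ↔
      projRoot ((((q : ℤ) ^ 2 + 1) / 2 * d * x 0 : ℤ) : ZMod q) ((- d * x 1 : ℤ) : ZMod q)
        ((x 2 : ℤ) : ZMod q) s := by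
  rw [nb_mem_some, Matrix.mulVec_smul]
  have hq0 : (q : ℤ) ≠ 0 := by exact_mod_cast hq.1.ne_zero
  have e : ((q : ℤ) ∣ ((q : ℤ) • (nbSi q d s *ᵥ x)) 1 ∧
      (q : ℤ) ^ 2 ∣ ((q : ℤ) • (nbSi q d s *ᵥ x)) 2) ↔ (q : ℤ) ∣ (nbSi q d s *ᵥ x) 2 := by
    simp only [Pi.smul_apply, smul_eq_mul, dvd_mul_right, true_and, pow_two]
    exact mul_dvd_mul_iff_left hq0
  rw [e, ← ZMod.intCast_zmod_eq_zero_iff_dvd]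
  have hh := half_spec h2
  have hhz : (2 : ZMod q) * ((((q : ℤ) ^ 2 + 1) / 2 : ℤ) : ZMod q) = 1 := by
    have := congrArg (Int.cast : ℤ → ZMod q) hh
    push_cast at this
    simpa using this
  have hd0 : (d : ZMod q) ≠ 0 := by rwa [Ne, ZMod.intCast_zmod_eq_zero_iff_dvd]
  cases s with
  | none =>
    rw [(nbSi_none (q := q) (d := d) x).2.2]
    simp only [projRoot]
    generalize ((q : ℤ) ^ 2 + 1) / 2 = h at hhz
    push_cast
    have hh0 : (h : ZMod q) ≠ 0 := by
      rintro h0; rw [h0] at hhz; simp at hhz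
    simp [hh0, hd0]
  | some s =>
    rw [(nbSi_some (d := d) s x).2.2]
    simp only [projRoot]
    generalize ((q : ℤ) ^ 2 + 1) / 2 = h at hhz
    push_cast
    rw [ZMod.natCast_zmod_val]
    have e2 : (x 2 : ZMod q) - d * s * x 1 + (1 - h) * d * s ^ 2 * x 0 =
      h * d * x 0 * s ^ 2 + -d * x 1 * s + x 2 := by
      linear_combination (-(d : ZMod q) * s ^ 2 * x 0) * hhz
    rw [e2]

/-- factorisation of a similitude -/
theorem nb_factor (h2 : Odd q) (hd : ¬ (q : ℤ) ∣ d) {B : TernMat} (hs : B.IsSymm) (hB : StdQ q d B)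
    (Z C : TernMat) (h : Zᵀ * B * Z = ((q : ℤ) ^ 2) • C) :
    ∃ j U, Z = nbT q d j * U := by
  have hqp := Nat.prime_iff_prime_int.1 hq.1
  have hcol : ∀ i j, (q : ℤ) ^ 2 ∣ (Z.col i) ⬝ᵥ (B *ᵥ (Z.col j)) := by
    intro i j
    have := congrFun (congrFun h i) j
    refine ⟨C i j, ?_⟩
    rw [Matrix.smul_apply, smul_eq_mul] at this
    rw [← this, Matrix.mul_assoc, Matrix.mul_apply]
    simp [Matrix.mul_apply, Matrix.mulVec, dotProduct]
  have hfin : ∀ J : Option (Option (ZMod q)), (∀ j, ∃ x, nbT q d J *ᵥ x = Z.col j) →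
      ∃ j U, Z = nbT q d j * U := by
    intro J hJ
    choose x hx using hJ
    refine ⟨J, Matrix.of fun i j => x j i, ?_⟩
    ext i j
    have := congrFun (hx j) i
    simp only [Matrix.col_apply] at this
    rw [← this, Matrix.mul_apply]
    simp [Matrix.mulVec, dotProduct]
  by_cases hall : ∀ i j, (q : ℤ) ∣ Z i j
  · apply hfin none
    intro j
    rw [nb_mem_none]
    intro i; exact hall i j
  · push Not at hall
    obtain ⟨i0, j0, hij⟩ := hall
    obtain ⟨s, hs1, hs2⟩ := nb_exists h2 hd hs hB (Z.col j0) (fun h => hij (h i0))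
      (by rw [quadVal_eq]; exact hcol j0 j0)
    apply hfin (some s)
    intro j
    rw [nb_mem_some] at hs1 ⊢
    have b1 := nb_bil h2 hs hB s _ _ (hcol j0 j)
    have b2 := nb_bil h2 hs hB s _ _ (hcol j j)
    generalize nbSi q d s *ᵥ Z.col j0 = z at *
    generalize nbSi q d s *ᵥ Z.col j = w at *
    have c1 : (q : ℤ) ∣ w 2 := by
      have h1 : (q : ℤ) ∣ z 2 * w 0 - d * z 1 * w 1 :=
        dvd_sub ((q2_q hs1.2).mul_right _) ((hs1.1.mul_left d).mul_right _)
      have h3 : (q : ℤ) ∣ z 0 * w 2 := by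
        have := dvd_sub (q2_q b1) h1
        ring_nf at this ⊢; exact this
      exact q_dvd_mul h3 hs2
    have c2 : (q : ℤ) ∣ w 1 := by
      have h3 : (q : ℤ) ∣ d * (w 1 * w 1) := by
        have := dvd_sub (dvd_add (c1.mul_left (w 0)) (c1.mul_right (w 0))) (q2_q b2)
        ring_nf at this ⊢; exact this
      have := q_dvd_mul h3 hd
      rcases hqp.dvd_or_dvd this with h | h <;> exact h
    refine ⟨c2, ?_⟩
    have h3 : (q : ℤ) ^ 2 ∣ z 1 * w 1 := by rw [pow_two]; exact mul_dvd_mul hs1.1 c2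
    have h4 : (q : ℤ) ^ 2 ∣ z 0 * w 2 := by
      have := dvd_add (dvd_sub b1 (hs1.2.mul_right (w 0))) (h3.mul_left d)
      ring_nf at this ⊢; exact this
    exact q2_dvd_mul h4 hs2

end

section
variable {q : ℕ} [hq : Fact q.Prime] {d : ℤ}

theorem nbT_det2 (j : Option (Option (ZMod q))) : (nbT q d j).det ^ 2 = (q : ℤ) ^ 6 := by
  cases j with
  | none =>
    simp only [nbT, Matrix.det_smul, Matrix.det_one, Fintype.card_fin]; ring
  | some s =>
    have h1 := congrArg Matrix.det (nbS_mul (q := q) (d := d) s)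
    rw [Matrix.det_mul, Matrix.det_one] at h1
    have h3 : IsUnit (nbS q d s).det := IsUnit.of_mul_eq_one _ h1
    have h4 : (nbD q).det = (q : ℤ) ^ 3 := by
      rw [Matrix.det_fin_three]; simp [nbD]; ring
    simp only [nbT, Matrix.det_mul, h4]
    rcases Int.isUnit_iff.1 h3 with h | h <;> rw [h] <;> ring

theorem sim_det {B D Z : TernMat} (h0 : B.det ≠ 0) (h : Zᵀ * B * Z = ((q : ℤ) ^ 2) • D)
    (hd : D.det = B.det) : Z.det ^ 2 = (q : ℤ) ^ 6 := by
  have h1 := congrArg Matrix.det h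
  rw [Matrix.det_mul, Matrix.det_mul, Matrix.det_transpose, Matrix.det_smul, Fintype.card_fin, hd] at h1
  have : (Z.det ^ 2 - (q : ℤ) ^ 6) * B.det = 0 := by linear_combination h1
  rcases mul_eq_zero.1 this with h | h
  · linarith
  · exact absurd h h0

theorem sim_det' {B D Z : TernMat} (h : Zᵀ * B * Z = ((q : ℤ) ^ 2) • D)
    (hz : Z.det ^ 2 = (q : ℤ) ^ 6) : D.det = B.det := by
  have h1 := congrArg Matrix.det h
  have hq0 : (q : ℤ) ≠ 0 := by exact_mod_cast hq.1.ne_zero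
  rw [Matrix.det_mul, Matrix.det_mul, Matrix.det_transpose, Matrix.det_smul, Fintype.card_fin] at h1
  have : (q : ℤ) ^ 6 * (D.det - B.det) = 0 := by linear_combination -h1 + hz * B.det
  rcases mul_eq_zero.1 this with h | h
  · exact absurd (pow_eq_zero_iff (by norm_num) |>.1 h) hq0
  · linarith

theorem det_ne_of_sq {Z : TernMat} (hz : Z.det ^ 2 = (q : ℤ) ^ 6) : Z.det ≠ 0 := by
  have hq0 : (q : ℤ) ≠ 0 := by exact_mod_cast hq.1.ne_zero
  intro h; rw [h] at hz
  exact pow_ne_zero 6 hq0 (by rw [← hz]; ring)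

theorem mulVec_inj_of_det {Z : TernMat} (h : Z.det ≠ 0) : Function.Injective (fun x => Z *ᵥ x) := by
  intro x y hxy
  have : Z *ᵥ (x - y) = 0 := by rw [Matrix.mulVec_sub]; simpa [sub_eq_zero] using hxy
  exact sub_eq_zero.1 (Matrix.eq_zero_of_mulVec_eq_zero h this)

theorem sim_genus {B D Z : TernMat} (hB : IsLat B) (h2 : Odd q) (hqd : ¬ (q : ℤ) ∣ B.det)
    (h : Zᵀ * B * Z = ((q : ℤ) ^ 2) • D) (hz : Z.det ^ 2 = (q : ℤ) ^ 6) : InGenus B D := by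
  have hq0 : (q : ℤ) ≠ 0 := by exact_mod_cast hq.1.ne_zero
  have hq2 : 0 < (q : ℤ) ^ 2 := by positivity
  have hD : IsLat D := by
    constructor
    · have h1 := congrArg Matrix.transpose h
      rw [Matrix.transpose_mul, Matrix.transpose_mul, Matrix.transpose_transpose, hB.1.eq,
        ← Matrix.mul_assoc, h, Matrix.transpose_smul] at h1
      ext i j
      have h3 := congrFun (congrFun h1 i) j
      simp only [Matrix.smul_apply, smul_eq_mul] at h3
      exact (mul_left_cancel₀ hq2.ne' h3).symm
    · intro x hx
      have h1 : quadVal (Zᵀ * B * Z) x = (q : ℤ) ^ 2 * quadVal D x := by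
        rw [h]; simp only [quadVal_eq, Matrix.smul_mulVec, dotProduct_smul, smul_eq_mul]
      rw [quadVal_tr] at h1
      have h3 := hB.2 (Z *ᵥ x) (fun h0 => hx (Matrix.eq_zero_of_mulVec_eq_zero (det_ne_of_sq hz) h0))
      rw [h1] at h3
      exact pos_of_mul_pos_right h3 hq2.le
  refine ⟨hD, fun p hp => ?_⟩
  haveI : Fact p.Prime := ⟨hp⟩
  show PadicIsomP p (padicMat p B) (padicMat p D)
  have hdd : D.det = B.det := sim_det' h hz
  by_cases hpq : p = q
  · subst hpq
    refine unimod_isom ?_ _ _ ?_ ?_ ?_ ?_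
    · rintro rfl; exact absurd h2 (by decide)
    · show (padicMat p B)ᵀ = _
      rw [← padicMat_tr, hB.1.eq]
    · show (padicMat p D)ᵀ = _
      rw [← padicMat_tr, hD.1.eq]
    · rw [padicMat_det, unit_iff_not_dvd, ← pow_one (p : ℤ_[p]), PadicInt.pow_p_dvd_int_iff]
      simpa using hqd
    · rw [padicMat_det, padicMat_det, hdd]
  · have hu : IsUnit ((q : ℕ) : ℤ_[p]) :=
      padic_unit_nat (fun hh => hpq ((Nat.prime_dvd_prime_iff_eq hp hq.1).1 hh))
    obtain ⟨u, hu'⟩ := hu.exists_right_inv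
    refine ⟨u • padicMat p Z, ?_, ?_⟩
    · have e : ((u • padicMat p Z).det) ^ 2 = 1 := by
        rw [Matrix.det_smul, padicMat_det, Fintype.card_fin, mul_pow]
        have : ((Z.det : ℤ_[p])) ^ 2 = (q : ℤ_[p]) ^ 6 := by exact_mod_cast congrArg (Int.cast : ℤ → ℤ_[p]) hz
        rw [this]
        calc (u ^ 3) ^ 2 * (q : ℤ_[p]) ^ 6 = (q * u) ^ 6 := by ring
          _ = 1 := by rw [hu']; ring
      exact IsUnit.of_mul_eq_one _ (by rw [← pow_two]; exact e)
    · have e : padicMat p (((q : ℤ) ^ 2) • D) = ((q : ℤ_[p]) ^ 2) • padicMat p D := by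
        ext i j; simp only [padicMat, Matrix.map_apply, Matrix.smul_apply, smul_eq_mul]; push_cast; rfl
      have e2 := congrArg (padicMat p) h
      rw [e, padicMat_mul, padicMat_mul, padicMat_tr] at e2
      rw [Matrix.transpose_smul, Matrix.smul_mul, Matrix.smul_mul, Matrix.mul_smul, e2, smul_smul,
        smul_smul]
      have : u * u * (q : ℤ_[p]) ^ 2 = 1 := by
        calc u * u * (q : ℤ_[p]) ^ 2 = (q * u) ^ 2 := by ring
          _ = 1 := by rw [hu']; ring
      rw [this, one_smul]

/-- number of similitudes -/
noncomputable def NN (q : ℕ) (B D : TernMat) : ℕ :=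
  Nat.card {Z : TernMat // Zᵀ * B * Z = ((q : ℤ) ^ 2) • D}

theorem nb_disj {i j : Option (Option (ZMod q))} {U V : TernMat} (hU : IsUnit U.det)
    (hV : IsUnit V.det) (h : nbT q d i * U = nbT q d j * V) : i = j := by
  have key : ∀ (i j : Option (Option (ZMod q))) (U V : TernMat), IsUnit U.det →
      nbT q d i * U = nbT q d j * V → ∀ x, ∃ y, nbT q d j *ᵥ y = nbT q d i *ᵥ x := by
    intro i j U V hU h x
    refine ⟨V *ᵥ (U⁻¹ *ᵥ x), ?_⟩
    rw [Matrix.mulVec_mulVec, ← h, ← Matrix.mulVec_mulVec, Matrix.mulVec_mulVec _ U,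
      Matrix.mul_nonsing_inv _ hU, Matrix.one_mulVec]
  have hy : ∀ s : Option (ZMod q), ¬ ∀ i, (q : ℤ) ∣ (nbT q d (some s) *ᵥ ![1, 0, 0]) i := by
    intro s hall
    have h1 : (1 : ℤ) = (nbSi q d s *ᵥ (nbT q d (some s) *ᵥ ![1, 0, 0])) 0 := by
      simp only [nbT]
      rw [Matrix.mulVec_mulVec, ← Matrix.mul_assoc, nbS_mul', Matrix.one_mul]
      simp [nbD, Matrix.mulVec, dotProduct, Fin.sum_univ_three]
    have h2 : (q : ℤ) ∣ 1 := by
      rw [h1, Matrix.mulVec, dotProduct]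
      exact Finset.dvd_sum fun k _ => (hall k).mul_left _
    exact (Nat.prime_iff_prime_int.1 hq.1).not_dvd_one h2
  cases i with
  | none =>
    cases j with
    | none => rfl
    | some t =>
      exfalso
      have := key _ _ _ _ hV h.symm ![1, 0, 0]
      rw [nb_mem_none] at this
      exact hy t this
  | some s =>
    cases j with
    | none =>
      exfalso
      have := key _ _ _ _ hU h ![1, 0, 0]
      rw [nb_mem_none] at this
      exact hy s this
    | some t =>
      have h1 := key _ _ _ _ hU h ![1, 0, 0]
      rw [nb_unique _ (hy s) s t ⟨_, rfl⟩ h1]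

theorem mat_cancel {T U V : TernMat} (h : T.det ≠ 0) (e : T * U = T * V) : U = V := by
  have h1 := congrArg (fun X => T.adjugate * X) e
  simp only [← Matrix.mul_assoc, Matrix.adjugate_mul, Matrix.smul_mul, Matrix.one_mul] at h1
  ext i j
  have h3 := congrFun (congrFun h1 i) j
  simp only [Matrix.smul_apply, smul_eq_mul] at h3
  exact mul_left_cancel₀ h h3

theorem smul_cancel {c : ℤ} (h : c ≠ 0) {U V : TernMat} (e : c • U = c • V) : U = V := by
  ext i j
  have h3 := congrFun (congrFun e i) j
  simp only [Matrix.smul_apply, smul_eq_mul] at h3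
  exact mul_left_cancel₀ h h3

theorem nb_factor' (h2 : Odd q) {B : TernMat} (hB : IsLat B) (hd : ¬ (q : ℤ) ∣ B.det)
    (hS : StdQ q B.det B) {Z D : TernMat} (h : Zᵀ * B * Z = ((q : ℤ) ^ 2) • D)
    (hD : D.det = B.det) : ∃ j U, IsUnit U.det ∧ Z = nbT q B.det j * U := by
  obtain ⟨j, U, hU⟩ := nb_factor h2 hd hB.1 hS Z D h
  refine ⟨j, U, ?_, hU⟩
  have hd0 : B.det ≠ 0 := fun h => hd (by rw [h]; exact dvd_zero _)
  have h1 := sim_det hd0 h hD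
  have h3 := nbT_det2 (d := B.det) j
  rw [hU, Matrix.det_mul, mul_pow, h3] at h1
  have hq0 : (q : ℤ) ^ 6 ≠ 0 := pow_ne_zero _ (by exact_mod_cast hq.1.ne_zero)
  have h4 : U.det ^ 2 = 1 := mul_left_cancel₀ hq0 (by rw [h1, mul_one])
  exact IsUnit.of_mul_eq_one _ (by rw [← pow_two]; exact h4)

theorem std_NN (h2 : Odd q) {B : TernMat} (hB : IsLat B) (hd : ¬ (q : ℤ) ∣ B.det)
    (hS : StdQ q B.det B) (C : Option (Option (ZMod q)) → TernMat)
    (hC : ∀ j, (nbT q B.det j)ᵀ * B * nbT q B.det j = ((q : ℤ) ^ 2) • C j)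
    (hL : ∀ j, IsLat (C j)) (D : TernMat) (hD : D.det = B.det) :
    NN q B D = ∑ j, thom (C j) D := by
  have hq0 : (q : ℤ) ^ 2 ≠ 0 := pow_ne_zero _ (by exact_mod_cast hq.1.ne_zero)
  have hfin : ∀ j, Finite {U : TernMat // IsUnit U.det ∧ Uᵀ * C j * U = D} := by
    intro j
    have := hom_finite (hL j) D
    exact Finite.of_injective (fun U => (⟨U.1, U.2.2⟩ : {U : TernMat // Uᵀ * C j * U = D}))
      (fun U V h => Subtype.ext (by simpa using h))
  unfold NN thom
  rw [← Nat.card_sigma]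
  symm
  have hsim : ∀ j U, (nbT q B.det j * U)ᵀ * B * (nbT q B.det j * U) = ((q : ℤ) ^ 2) • (Uᵀ * C j * U) := by
    intro j U
    rw [← Matrix.smul_mul, ← Matrix.mul_smul, ← hC j]
    simp only [Matrix.transpose_mul, Matrix.mul_assoc]
  refine Nat.card_eq_of_bijective (fun x => ⟨nbT q B.det x.1 * x.2.1, ?_⟩) ⟨?_, ?_⟩
  · rw [hsim, x.2.2.2]
  · rintro ⟨i, U⟩ ⟨j, V⟩ h
    have h' : nbT q B.det i * U.1 = nbT q B.det j * V.1 := congrArg Subtype.val h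
    have hij := nb_disj U.2.1 V.2.1 h'
    subst hij
    have := mat_cancel (det_ne_of_sq (nbT_det2 (q := q) i)) h'
    have : U = V := Subtype.ext this
    rw [this]
  · rintro ⟨Z, hZ⟩
    obtain ⟨j, U, hU, e⟩ := nb_factor' h2 hB hd hS hZ hD
    refine ⟨⟨j, U, hU, ?_⟩, Subtype.ext e.symm⟩
    rw [e, hsim] at hZ
    exact smul_cancel hq0 hZ

theorem std_inv (h2 : Odd q) {B : TernMat} (hB : IsLat B) (hd : ¬ (q : ℤ) ∣ B.det)
    (hS : StdQ q B.det B) {Z D : TernMat} (h : Zᵀ * B * Z = ((q : ℤ) ^ 2) • D)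
    (hD : D.det = B.det) : ∃ Z', Z * Z' = ((q : ℤ) ^ 2) • (1 : TernMat) := by
  obtain ⟨j, U, hU, e⟩ := nb_factor' h2 hB hd hS h hD
  refine ⟨U⁻¹ * nbT' q B.det j, ?_⟩
  rw [e, Matrix.mul_assoc, ← Matrix.mul_assoc U, Matrix.mul_nonsing_inv _ hU, Matrix.one_mul, nbT_mul]

/-- general lattice can be moved to standard position -/
theorem exists_std (h2 : Odd q) {B : TernMat} (hB : IsLat B) (hd : ¬ (q : ℤ) ∣ B.det) :
    ∃ B', LatIsom B B' ∧ StdQ q B.det B' := by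
  have hV : ∀ p (hp : Fact p.Prime), ∃ V : Matrix (Fin 3) (Fin 3) ℤ_[p], V.det = 1 ∧
      (p = q → Vᵀ * padicMat p B * V = stdH (B.det : ℤ_[p])) := by
    intro p hp
    by_cases hpq : p = q
    · subst hpq
      obtain ⟨P, hP, hP'⟩ := unimod_std (p := p) (by rintro rfl; exact absurd h2 (by decide)) (padicMat p B)
        (by show (padicMat p B)ᵀ = _; rw [← padicMat_tr, hB.1.eq])
        (by rw [padicMat_det, unit_iff_not_dvd, ← pow_one (p : ℤ_[p]), PadicInt.pow_p_dvd_int_iff]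
            simpa using hd)
      refine ⟨P, hP, fun _ => ?_⟩
      rw [hP', padicMat_det]
    · exact ⟨1, by simp, fun h => absurd h hpq⟩
  choose V hV1 hV2 using hV
  obtain ⟨W, hW, hWV⟩ := SA_padic (q ^ 2) (pow_pos hq.1.pos 2).ne' V hV1
  refine ⟨Wᵀ * B * W, ⟨W, by rw [hW]; exact isUnit_one, rfl⟩, ?_⟩
  intro i j
  have hex : ∀ i j, ∃ k, (W i j : ℤ_[q]) = V q hq i j + ((q : ℤ_[q]) ^ 2) * k := by
    intro i j
    obtain ⟨k, hk⟩ := hWV q hq (dvd_pow_self _ two_ne_zero) i j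
    refine ⟨k, ?_⟩
    push_cast at hk
    linear_combination hk
  choose R hR using hex
  have hWR : padicMat q W = V q hq + ((q : ℤ_[q]) ^ 2) • Matrix.of R := by
    ext i j; simp [padicMat, hR i j]
  have hmain : ((q : ℤ_[q]) ^ 2) ∣ (padicMat q (Wᵀ * B * W)) i j - stdH (B.det : ℤ_[q]) i j := by
    rw [← hV2 q hq rfl, padicMat_mul, padicMat_mul, padicMat_tr, hWR]
    refine ⟨((Matrix.of R)ᵀ * padicMat q B * V q hq + (V q hq)ᵀ * padicMat q B * Matrix.of R +
      ((q : ℤ_[q]) ^ 2) • ((Matrix.of R)ᵀ * padicMat q B * Matrix.of R)) i j, ?_⟩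
    simp only [Matrix.transpose_add, Matrix.transpose_smul, Matrix.mul_add, Matrix.add_mul,
      Matrix.mul_smul, Matrix.smul_mul, Matrix.add_apply, Matrix.smul_apply, smul_eq_mul]
    ring
  have e : (padicMat q (Wᵀ * B * W)) i j - stdH (B.det : ℤ_[q]) i j =
      (((Wᵀ * B * W) i j - stdH B.det i j : ℤ) : ℤ_[q]) := by
    fin_cases i <;> fin_cases j <;> simp [padicMat, stdH]
  rw [e] at hmain
  have := (PadicInt.pow_p_dvd_int_iff (p := q) 2 _).1 hmain
  exact_mod_cast this

end

section
variable {q : ℕ} [hq : Fact q.Prime]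

theorem card_option {α : Type*} [Fintype α] (P : Option α → Prop) :
    Nat.card {j // P j} = (if P none then 1 else 0) + Nat.card {s // P (some s)} := by
  rw [Nat.card_eq_fintype_card, Nat.card_eq_fintype_card, Fintype.card_subtype, Fintype.card_subtype,
    Finset.card_filter, Finset.card_filter, Fintype.sum_option]

theorem std_quad_mod {B : TernMat} (hs : B.IsSymm) {d : ℤ} (hB : StdQ q d B) (x : Fin 3 → ℤ) :
    ((quadVal B x : ℤ) : ZMod q) = 2 * x 0 * x 2 - d * x 1 ^ 2 := by
  have h := std_entries hs hB
  have e : ∀ a : ℤ, (q : ℤ) ^ 2 ∣ a → (a : ZMod q) = 0 := fun a ha =>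
    (ZMod.intCast_zmod_eq_zero_iff_dvd _ _).2 (q2_q ha)
  have h0 := e _ h.1
  have h1 := e _ h.2.1
  have h2 := e _ h.2.2.1
  have h3 := e _ h.2.2.2.1
  have h4 := e _ h.2.2.2.2.1
  have h5 := e _ h.2.2.2.2.2
  rw [quadVal_three B hs]
  push_cast at *
  rw [h0, h1, h4, h5]
  linear_combination 2 * (x 0 : ZMod q) * x 2 * h2 + (x 1 : ZMod q) ^ 2 * h3

theorem nb_count (h2 : Odd q) {B : TernMat} (hB : IsLat B) (hd : ¬ (q : ℤ) ∣ B.det)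
    (hS : StdQ q B.det B) (n : ℤ) (y : Fin 3 → ℤ) (hy : quadVal B y = n * (q : ℤ) ^ 2) :
    (Nat.card {j // ∃ x, nbT q B.det j *ᵥ x = y} : ℝ) =
      1 + (kap q (-(B.det * n)) : ℝ) * (if ∀ i, (q : ℤ) ∣ y i then 1 else 0) +
      ((q : ℝ) + 1 - kap q (-(B.det * n))) * (if ∀ i, (q : ℤ) ^ 2 ∣ y i then 1 else 0) := by
  have hq0 : (q : ℤ) ≠ 0 := by exact_mod_cast hq.1.ne_zero
  rw [card_option]
  simp only [nb_mem_none]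
  by_cases hall : ∀ i, (q : ℤ) ∣ y i
  · have hx : ∃ x : Fin 3 → ℤ, y = (q : ℤ) • x := by
      choose x hx using hall
      exact ⟨x, by funext i; simp [hx i]⟩
    obtain ⟨x, rfl⟩ := hx
    rw [quadVal_smul, mul_comm] at hy
    have hxn := mul_right_cancel₀ (pow_ne_zero 2 hq0) hy
    rw [if_pos hall, if_pos hall]
    have e2 : (∀ i, (q : ℤ) ^ 2 ∣ ((q : ℤ) • x) i) ↔ ∀ i, (q : ℤ) ∣ x i := by
      simp only [Pi.smul_apply, smul_eq_mul, pow_two]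
      exact forall_congr' fun i => mul_dvd_mul_iff_left hq0
    simp only [e2, nb_root h2 hd]
    have hh := half_spec h2
    have hhz : (2 : ZMod q) * ((((q : ℤ) ^ 2 + 1) / 2 : ℤ) : ZMod q) = 1 := by
      have := congrArg (Int.cast : ℤ → ZMod q) hh
      push_cast at this
      simpa using this
    have hd0 : (B.det : ZMod q) ≠ 0 := by rwa [Ne, ZMod.intCast_zmod_eq_zero_iff_dvd]
    generalize ((q : ℤ) ^ 2 + 1) / 2 = h at hhz
    have hh0 : (h : ZMod q) ≠ 0 := by
      rintro h0; rw [h0] at hhz; simp at hhz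
    have h20 : (2 : ZMod q) ≠ 0 := by
      intro h0; rw [h0] at hhz; simp at hhz
    by_cases hx : ∀ i, (q : ℤ) ∣ x i
    · rw [if_pos hx]
      have hz : ∀ i, ((x i : ℤ) : ZMod q) = 0 := fun i =>
        (ZMod.intCast_zmod_eq_zero_iff_dvd _ _).2 (hx i)
      have : ∀ s, projRoot ((h * B.det * x 0 : ℤ) : ZMod q) ((-B.det * x 1 : ℤ) : ZMod q)
          ((x 2 : ℤ) : ZMod q) s := by
        intro s
        cases s <;> simp [projRoot, hz]
      simp only [this, Nat.card_eq_fintype_card, Fintype.card_subtype, Finset.filter_true,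
        Finset.card_univ, Fintype.card_option, ZMod.card]
      push_cast; ring
    · rw [if_neg hx, card_projRoot h20]
      · have e : ((-B.det * x 1 : ℤ) : ZMod q) ^ 2 - 4 * ((h * B.det * x 0 : ℤ) : ZMod q) * ((x 2 : ℤ) : ZMod q) =
          ((-(B.det * n) : ℤ) : ZMod q) := by
          have h5 := std_quad_mod hB.1 hS x
          rw [hxn] at h5
          simp only [Int.cast_neg, Int.cast_mul]
          rw [h5]
          linear_combination (-2 * (B.det : ZMod q) * x 0 * x 2) * hhz
        rw [e]
        unfold kap
        push_cast; ring
      · rintro ⟨h1, h3, h4⟩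
        apply hx
        have g0 : ((x 0 : ℤ) : ZMod q) = 0 := by
          simp only [Int.cast_neg, Int.cast_mul] at h1; simpa [-Int.cast_det, hh0, hd0] using h1
        have g1 : ((x 1 : ℤ) : ZMod q) = 0 := by
          simp only [Int.cast_neg, Int.cast_mul] at h3; simpa [-Int.cast_det, hd0] using h3
        intro i
        rw [← ZMod.intCast_zmod_eq_zero_iff_dvd]
        fin_cases i
        · exact g0
        · exact g1
        · exact h4
  · have hall2 : ¬ ∀ i, (q : ℤ) ^ 2 ∣ y i := fun h => hall fun i => q2_q (h i)
    rw [if_neg hall, if_neg hall, if_neg hall2]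
    obtain ⟨s, hs, _⟩ := nb_exists h2 hd hB.1 hS y hall (by rw [hy]; exact dvd_mul_left _ _)
    have : Nat.card {s // ∃ x, nbT q B.det (some s) *ᵥ x = y} = 1 := by
      rw [Nat.card_eq_one_iff_unique]
      exact ⟨⟨fun a b => Subtype.ext (nb_unique y hall _ _ a.2 b.2)⟩, ⟨⟨s, hs⟩⟩⟩
    rw [this]
    norm_num

theorem rRep_dvd {B : TernMat} (m : ℕ) (hm : m ≠ 0) (n : ℤ) :
    Nat.card {y : {y : Fin 3 → ℤ // quadVal B y = n * (m : ℤ) ^ 2} // ∀ i, (m : ℤ) ∣ y.1 i} =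
      rRep n B := by
  have hm0 : (m : ℤ) ≠ 0 := by exact_mod_cast hm
  unfold rRep
  symm
  refine Nat.card_eq_of_bijective (fun x => ⟨⟨(m : ℤ) • x.1, ?_⟩, ?_⟩) ⟨?_, ?_⟩
  · rw [quadVal_smul, x.2]; ring
  · intro i; simp
  · intro x y h
    have h' : (m : ℤ) • x.1 = (m : ℤ) • y.1 := congrArg (fun z => z.1.1) h
    ext i
    have := congrFun h' i
    exact mul_left_cancel₀ hm0 this
  · rintro ⟨⟨y, hy⟩, h⟩
    have h2 := h
    choose x hx using h2
    have : y = (m : ℤ) • x := by funext i; exact hx i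
    refine ⟨⟨x, ?_⟩, ?_⟩
    · rw [this, quadVal_smul, mul_comm] at hy
      exact mul_right_cancel₀ (pow_ne_zero 2 hm0) hy
    · apply Subtype.ext; apply Subtype.ext; exact this.symm

theorem std_rep (h2 : Odd q) {B : TernMat} (hB : IsLat B) (hd : ¬ (q : ℤ) ∣ B.det)
    (hS : StdQ q B.det B) (C : Option (Option (ZMod q)) → TernMat)
    (hC : ∀ j, (nbT q B.det j)ᵀ * B * nbT q B.det j = ((q : ℤ) ^ 2) • C j) (n : ℤ) :
    ∑ j, (rRep n (C j) : ℝ) = rRep (n * (q : ℤ) ^ 2) B + kap q (-(B.det * n)) * rRep n B +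
      ((q : ℝ) + 1 - kap q (-(B.det * n))) *
        (if (q : ℤ) ^ 2 ∣ n then (rRep (n / (q : ℤ) ^ 2) B : ℝ) else 0) := by
  have hq0 : (q : ℤ) ≠ 0 := by exact_mod_cast hq.1.ne_zero
  have hfin := rep_finite hB (n * (q : ℤ) ^ 2)
  haveI := Fintype.ofFinite {y : Fin 3 → ℤ // quadVal B y = n * (q : ℤ) ^ 2}
  have h1 : ∀ j, (rRep n (C j) : ℝ) = ∑ y : {y : Fin 3 → ℤ // quadVal B y = n * (q : ℤ) ^ 2},
      if (∃ x, nbT q B.det j *ᵥ x = y.1) then (1 : ℝ) else 0 := by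
    intro j
    have e : rRep n (C j) = Nat.card {y : {y : Fin 3 → ℤ // quadVal B y = n * (q : ℤ) ^ 2} //
        ∃ x, nbT q B.det j *ᵥ x = y.1} := by
      have hv : ∀ x, quadVal B (nbT q B.det j *ᵥ x) = (q : ℤ) ^ 2 * quadVal (C j) x := by
        intro x
        rw [← quadVal_tr, hC]
        simp only [quadVal_eq, Matrix.smul_mulVec, dotProduct_smul, smul_eq_mul]
      unfold rRep
      refine Nat.card_eq_of_bijective (fun x => ⟨⟨nbT q B.det j *ᵥ x.1, ?_⟩, ⟨_, rfl⟩⟩) ⟨?_, ?_⟩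
      · rw [hv, x.2, mul_comm]
      · intro x y h
        have h' : nbT q B.det j *ᵥ x.1 = nbT q B.det j *ᵥ y.1 := congrArg (fun z => z.1.1) h
        exact Subtype.ext (mulVec_inj_of_det (det_ne_of_sq (nbT_det2 (q := q) j)) h')
      · rintro ⟨⟨y, hy⟩, ⟨x, hx⟩⟩
        refine ⟨⟨x, ?_⟩, ?_⟩
        · simp only at hx
          rw [← hx, hv, mul_comm] at hy
          exact mul_right_cancel₀ (pow_ne_zero 2 hq0) hy
        · apply Subtype.ext; apply Subtype.ext; exact hx
    rw [e, Nat.card_eq_fintype_card, Fintype.card_subtype, Finset.sum_boole]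
  simp only [h1]
  rw [Finset.sum_comm]
  have h3 : ∀ y : {y : Fin 3 → ℤ // quadVal B y = n * (q : ℤ) ^ 2},
      (∑ j, if (∃ x, nbT q B.det j *ᵥ x = y.1) then (1 : ℝ) else 0) =
      1 + (kap q (-(B.det * n)) : ℝ) * (if ∀ i, (q : ℤ) ∣ y.1 i then 1 else 0) +
      ((q : ℝ) + 1 - kap q (-(B.det * n))) * (if ∀ i, (q : ℤ) ^ 2 ∣ y.1 i then 1 else 0) := by
    intro y
    rw [← nb_count h2 hB hd hS n y.1 y.2, Nat.card_eq_fintype_card, Fintype.card_subtype, Finset.sum_boole]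
  simp only [h3, Finset.sum_add_distrib, ← Finset.mul_sum, Finset.sum_boole, ← Fintype.card_subtype,
    ← Nat.card_eq_fintype_card]
  congr 1
  · congr 1
    · simp [rRep]
    · rw [← rRep_dvd (B := B) q hq.1.ne_zero n]
  · congr 1
    split_ifs with hdv
    · obtain ⟨m, rfl⟩ := hdv
      rw [Int.mul_ediv_cancel_left _ (pow_ne_zero 2 hq0)]
      rw [← rRep_dvd (B := B) (q ^ 2) (pow_ne_zero 2 hq.1.ne_zero) m]
      congr 1
      push_cast
      rw [show (q : ℤ) ^ 2 * m * (q : ℤ) ^ 2 = m * ((q : ℤ) ^ 2) ^ 2 by ring]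
    · rw [Nat.cast_eq_zero, Nat.card_eq_zero]
      left
      refine ⟨fun y => hdv ?_⟩
      obtain ⟨⟨y, hy⟩, h⟩ := y
      choose x hx using h
      have : y = ((q : ℤ) ^ 2) • x := by funext i; simp only [Pi.smul_apply, smul_eq_mul]; exact hx i
      rw [this, quadVal_smul] at hy
      refine ⟨quadVal B x, mul_right_cancel₀ (pow_ne_zero 2 hq0) ?_⟩
      rw [← hy]; ring

end

section
variable {q : ℕ} [hq : Fact q.Prime]

theorem NN_isom {B B' : TernMat} (h : LatIsom B B') (D : TernMat) : NN q B D = NN q B' D := by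
  obtain ⟨V, hV, rfl⟩ := h
  symm
  refine Nat.card_congr
    { toFun := fun Z => ⟨V * Z.1, ?_⟩
      invFun := fun Z => ⟨V⁻¹ * Z.1, ?_⟩
      left_inv := fun Z => ?_
      right_inv := fun Z => ?_ }
  · refine Eq.trans ?_ Z.2
    simp only [Matrix.transpose_mul, Matrix.mul_assoc]
  · have e : (V⁻¹ * Z.1)ᵀ * (Vᵀ * B * V) * (V⁻¹ * Z.1) = (V * (V⁻¹ * Z.1))ᵀ * B * (V * (V⁻¹ * Z.1)) := by
      simp only [Matrix.transpose_mul, Matrix.mul_assoc]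
    rw [e, ← Matrix.mul_assoc V, Matrix.mul_nonsing_inv _ hV, Matrix.one_mul]
    exact Z.2
  · apply Subtype.ext
    show V⁻¹ * (V * Z.1) = Z.1
    rw [← Matrix.mul_assoc, Matrix.nonsing_inv_mul _ hV, Matrix.one_mul]
  · apply Subtype.ext
    show V * (V⁻¹ * Z.1) = Z.1
    rw [← Matrix.mul_assoc, Matrix.mul_nonsing_inv _ hV, Matrix.one_mul]

theorem InGenus_of_isom {B B' : TernMat} (hB : IsLat B) (h : LatIsom B B') : InGenus B B' :=
  ⟨LatIsom_isLat hB h, fun p hp => by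
    haveI : Fact p.Prime := ⟨hp⟩
    exact padic_of_lat h⟩

theorem nb_gen (h2 : Odd q) {B : TernMat} (hB : IsLat B) (hd : ¬ (q : ℤ) ∣ B.det) :
    ∃ C : Option (Option (ZMod q)) → TernMat, (∀ j, InGenus B (C j)) ∧
      (∀ D : TernMat, D.det = B.det → NN q B D = ∑ j, thom (C j) D) ∧
      (∀ n : ℤ, ∑ j, (rRep n (C j) : ℝ) = rRep (n * (q : ℤ) ^ 2) B + kap q (-(B.det * n)) * rRep n B +
      ((q : ℝ) + 1 - kap q (-(B.det * n))) *
        (if (q : ℤ) ^ 2 ∣ n then (rRep (n / (q : ℤ) ^ 2) B : ℝ) else 0)) := by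
  obtain ⟨B', hBB, hS⟩ := exists_std h2 hB hd
  have hB' := LatIsom_isLat hB hBB
  have hdet := LatIsom_det hBB
  rw [← hdet] at hS hd ⊢
  have hC := fun j => nbT_C h2 hB'.1 hS j
  choose C hC using hC
  have hG : ∀ j, InGenus B' (C j) := fun j => sim_genus hB' h2 hd (hC j) (nbT_det2 j)
  refine ⟨C, fun j => InGenus_trans (InGenus_of_isom hB hBB) (hG j), ?_, ?_⟩
  · intro D hD
    rw [NN_isom hBB]
    exact std_NN h2 hB' hd hS C hC (fun j => (hG j).1) D hD
  · intro n
    rw [rRep_isom hBB, rRep_isom hBB, rRep_isom hBB]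
    exact std_rep h2 hB' hd hS C hC n

theorem gen_inv (h2 : Odd q) {B : TernMat} (hB : IsLat B) (hd : ¬ (q : ℤ) ∣ B.det)
    {Z D : TernMat} (h : Zᵀ * B * Z = ((q : ℤ) ^ 2) • D)
    (hD : D.det = B.det) : ∃ Z', Z * Z' = ((q : ℤ) ^ 2) • (1 : TernMat) := by
  obtain ⟨B', hBB, hS⟩ := exists_std h2 hB hd
  have hB' := LatIsom_isLat hB hBB
  have hdet := LatIsom_det hBB
  rw [← hdet] at hS hd hD
  obtain ⟨V, hV, rfl⟩ := hBB
  have e : (V⁻¹ * Z)ᵀ * (Vᵀ * B * V) * (V⁻¹ * Z) = (V * (V⁻¹ * Z))ᵀ * B * (V * (V⁻¹ * Z)) := by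
    simp only [Matrix.transpose_mul, Matrix.mul_assoc]
  rw [← Matrix.mul_assoc V, Matrix.mul_nonsing_inv _ hV, Matrix.one_mul, h] at e
  obtain ⟨Z', hZ'⟩ := std_inv h2 hB' hd hS e hD
  refine ⟨Z' * V⁻¹, ?_⟩
  have h3 := congrArg (fun X => V * X * V⁻¹) hZ'
  simp only [Matrix.mul_smul, Matrix.mul_one, Matrix.smul_mul, Matrix.mul_nonsing_inv _ hV] at h3
  rw [← h3]
  simp only [← Matrix.mul_assoc, Matrix.mul_nonsing_inv _ hV, Matrix.one_mul]

theorem NN_le (h2 : Odd q) {B D : TernMat} (hB : IsLat B) (hDL : IsLat D) (hd : ¬ (q : ℤ) ∣ B.det)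
    (hD : D.det = B.det) : NN q B D ≤ NN q D B := by
  have hq0 : (q : ℤ) ^ 2 ≠ 0 := pow_ne_zero _ (by exact_mod_cast hq.1.ne_zero)
  have hfin : Finite {Z : TernMat // Zᵀ * D * Z = ((q : ℤ) ^ 2) • B} := hom_finite hDL _
  have hex : ∀ Z : {Z : TernMat // Zᵀ * B * Z = ((q : ℤ) ^ 2) • D},
      ∃ Z', Z.1 * Z' = ((q : ℤ) ^ 2) • (1 : TernMat) := fun Z => gen_inv h2 hB hd Z.2 hD
  choose g hg using hex
  refine Nat.card_le_card_of_injective (fun Z => ⟨g Z, ?_⟩) ?_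
  · apply smul_cancel hq0
    have : ((q : ℤ) ^ 2) • ((g Z)ᵀ * D * g Z) = (Z.1 * g Z)ᵀ * B * (Z.1 * g Z) := by
      have hz := Z.2
      generalize Z.1 = Y at hz ⊢
      rw [← Matrix.smul_mul, ← Matrix.mul_smul, ← hz]
      simp only [Matrix.transpose_mul, Matrix.mul_assoc]
    rw [this, hg]
    simp only [Matrix.transpose_smul, Matrix.transpose_one, Matrix.smul_mul, Matrix.one_mul,
      Matrix.mul_smul, Matrix.mul_one]
  · intro Z Y h
    have h' : g Z = g Y := congrArg Subtype.val h
    have e1 := hg Z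
    have e2 := hg Y
    rw [← h'] at e2
    have hdet : (g Z).det ≠ 0 := by
      intro h0
      have := congrArg Matrix.det e1
      rw [Matrix.det_mul, h0, mul_zero, Matrix.det_smul, Matrix.det_one, mul_one] at this
      exact pow_ne_zero _ hq0 this.symm
    have e3 : (g Z)ᵀ * (Z.1)ᵀ = (g Z)ᵀ * (Y.1)ᵀ := by
      rw [← Matrix.transpose_mul, ← Matrix.transpose_mul, e1, e2]
    exact Subtype.ext (Matrix.transpose_injective
      (mat_cancel (by rw [Matrix.det_transpose]; exact hdet) e3))

theorem RG_rec (h2 : Odd q) {A : TernMat} (hA : IsLat A) (hd : ¬ (q : ℤ) ∣ A.det) (n : ℤ) :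
    ((q : ℝ) + 2) * RG A n = RG A (n * (q : ℤ) ^ 2) + kap q (-(A.det * n)) * RG A n +
      ((q : ℝ) + 1 - kap q (-(A.det * n))) *
        (if (q : ℤ) ^ 2 ∣ n then RG A (n / (q : ℤ) ^ 2) else 0) := by
  have hfin := g_finite hA
  have hdX : ∀ B : {B : TernMat // InGenus A B}, B.1.det = A.det := fun B => InGenus_det hA B.2
  have hgen := fun B : {B : TernMat // InGenus A B} =>
    nb_gen h2 B.2.1 (by rw [hdX B]; exact hd)
  choose C hC1 hC2 hC3 using hgen
  have hcls : ∀ (F : {B : TernMat // InGenus A B} → ℝ) (hF : ∀ x y, grel A x y → F x = F y)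
      (B : {B : TernMat // InGenus A B}),
      ∑ j, F ⟨C B j, InGenus_trans B.2 (hC1 B j)⟩ =
        csum (grel A) (fun B => numAut B.1) (fun y => F y * (NN q B.1 y.1 : ℕ)) := by
    intro F hF B
    refine class_sum (grel_equiv A) (fun x y => thom x.1 y.1) (fun B => numAut B.1)
      (fun x => numAut_pos x.2.1) (fun x y h => thom_of_isom h) (fun x y h => thom_not h) F hF
      (fun j => ⟨C B j, InGenus_trans B.2 (hC1 B j)⟩) (fun y => NN q B.1 y.1) ?_
    intro y
    exact hC2 B y.1 (by rw [hdX, hdX])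
  have hone : ∀ B : {B : TernMat // InGenus A B},
      csum (grel A) (fun B => numAut B.1) (fun y => 1 * (NN q B.1 y.1 : ℕ)) = (q : ℝ) + 2 := by
    intro B
    rw [← hcls (fun _ => 1) (fun _ _ _ => rfl) B]
    simp only [Finset.sum_const, Finset.card_univ, Fintype.card_option, ZMod.card]
    simp; ring
  have hsym : ∀ B D : {B : TernMat // InGenus A B}, NN q B.1 D.1 = NN q D.1 B.1 := by
    intro B D
    exact le_antisymm (NN_le h2 B.2.1 D.2.1 (by rw [hdX]; exact hd) (by rw [hdX, hdX]))
      (NN_le h2 D.2.1 B.2.1 (by rw [hdX]; exact hd) (by rw [hdX, hdX]))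
  have hdc := double_count (r := grel A) (s := grel A) (a := fun B => numAut B.1)
    (b := fun B => numAut B.1) (fun _ => (1 : ℝ)) (fun y => (rRep n y.1 : ℝ)) (fun x y => NN q x.1 y.1)
  have hR : csum (grel A) (fun B => numAut B.1) (fun y => (rRep n y.1 : ℝ) *
      csum (grel A) (fun B => numAut B.1) (fun x => (1 : ℝ) * (NN q x.1 y.1 : ℕ))) =
      ((q : ℝ) + 2) * RG A n := by
    unfold RG
    rw [← csum_mul]
    apply csum_congr
    intro y
    rw [← hone y, mul_comm]
    congr 1
    apply csum_congr
    intro x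
    rw [hsym]
  rw [← hR, ← hdc]
  have hL : ∀ x : {B : TernMat // InGenus A B}, (1 : ℝ) * csum (grel A) (fun B => numAut B.1)
      (fun y => (rRep n y.1 : ℝ) * (NN q x.1 y.1 : ℕ)) =
      rRep (n * (q : ℤ) ^ 2) x.1 + (kap q (-(A.det * n)) * rRep n x.1 +
      ((q : ℝ) + 1 - kap q (-(A.det * n))) *
        (if (q : ℤ) ^ 2 ∣ n then (rRep (n / (q : ℤ) ^ 2) x.1 : ℝ) else 0)) := by
    intro x
    rw [one_mul, ← hcls (fun y => (rRep n y.1 : ℝ)) (fun x y h => by rw [rRep_isom h]) x]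
    rw [hC3 x n, hdX x, add_assoc]
  rw [csum_congr hL, csum_add, csum_add, csum_mul, csum_mul]
  unfold RG
  rw [add_assoc]
  congr 3
  split_ifs
  · rfl
  · unfold csum; simp

end

section
variable {q : ℕ} [hq : Fact q.Prime]

theorem kap_scale (h2 : Odd q) {x y f : ℤ} (hf : ¬ (q : ℤ) ∣ f) (h : x * f ^ 2 = 4 * y) :
    kap q x = kap q y := by
  have hf0 : (f : ZMod q) ≠ 0 := by rwa [Ne, ZMod.intCast_zmod_eq_zero_iff_dvd]
  have h20 : (2 : ZMod q) ≠ 0 := by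
    have := q_not_two h2
    rw [← ZMod.intCast_zmod_eq_zero_iff_dvd] at this
    simpa using this
  have h' : (x : ZMod q) * f ^ 2 = 2 ^ 2 * y := by
    have := congrArg (Int.cast : ℤ → ZMod q) h
    push_cast at this
    rw [this]; ring
  unfold kap
  refine Nat.card_congr
    { toFun := fun t => ⟨t.1 * f / 2, ?_⟩
      invFun := fun t => ⟨t.1 * 2 / f, ?_⟩
      left_inv := fun t => ?_
      right_inv := fun t => ?_ }
  · rw [div_pow, mul_pow, t.2, h']; field_simp
  · rw [div_pow, mul_pow, t.2, mul_comm, ← h']; field_simp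
  · apply Subtype.ext; simp only; field_simp
  · apply Subtype.ext; simp only; field_simp

theorem ratio_key (h2 : Odd q) {A : TernMat} (hA : IsLat A) (hd : ¬ (q : ℤ) ∣ A.det) (f : ℕ)
    (hf : ¬ (q : ℤ) ∣ f) : ∀ n N : ℕ, 0 < n → 0 < N → (N : ℤ) * (f : ℤ) ^ 2 = 4 * (A.det * n) →
    RG A n * WB (N * q ^ 2) = RG A (n * (q : ℤ) ^ 2) * WB N := by
  intro n
  induction n using Nat.strong_induction_on with
  | _ n ih =>
  intro N hn hN h
  have hqp := Nat.prime_iff_prime_int.1 hq.1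
  have hne2 : q ≠ 2 := by rintro rfl; exact absurd h2 (by decide)
  have r1 := RG_rec h2 hA hd (n : ℤ)
  have r2 := WB_rec hne2 hN
  have hk : kap q (-(N : ℤ)) = kap q (-(A.det * n)) := kap_scale h2 hf (by linear_combination -h)
  rw [hk] at r2
  have hdv : (q : ℤ) ^ 2 ∣ (n : ℤ) ↔ q ^ 2 ∣ N := by
    rw [← Int.natCast_dvd_natCast (m := q ^ 2) (n := N)]
    push_cast
    constructor
    · intro h1
      have : (q : ℤ) ^ 2 ∣ (f : ℤ) ^ 2 * N := by
        rw [mul_comm, h]; exact (h1.mul_left _).mul_left _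
      exact q2_dvd_mul this (fun h => hf (hqp.dvd_of_dvd_pow h))
    · intro h1
      have h3 : (q : ℤ) ^ 2 ∣ (4 * A.det) * n := by
        rw [mul_assoc, ← h]; exact h1.mul_right _
      refine q2_dvd_mul h3 ?_
      intro h4
      rcases hqp.dvd_or_dvd h4 with h5 | h5
      · have : (q : ℤ) ∣ 2 ^ 2 := by norm_num; exact h5
        exact q_not_two h2 (hqp.dvd_of_dvd_pow this)
      · exact hd h5
  by_cases hc : q ^ 2 ∣ N
  · rw [if_pos (hdv.2 hc)] at r1
    rw [if_pos hc] at r2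
    obtain ⟨n', hn'⟩ : q ^ 2 ∣ n := by
      have := hdv.2 hc
      exact_mod_cast this
    obtain ⟨N', hN'⟩ := hc
    have hq2 : 0 < q ^ 2 := pow_pos hq.1.pos 2
    have hn0 : 0 < n' := Nat.pos_of_ne_zero (by rintro rfl; simp at hn'; omega)
    have hN0 : 0 < N' := Nat.pos_of_ne_zero (by rintro rfl; simp at hN'; omega)
    have hlt : n' < n := by
      rw [hn']
      have : 1 < q ^ 2 := Nat.one_lt_pow two_ne_zero hq.1.one_lt
      nlinarith
    have hi := ih n' hlt N' hn0 hN0 (by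
      have hq0 : (q : ℤ) ^ 2 ≠ 0 := pow_ne_zero _ (by exact_mod_cast hq.1.ne_zero)
      apply mul_left_cancel₀ hq0
      rw [hn', hN'] at h
      push_cast at h
      linear_combination h)
    have e1 : (n : ℤ) / (q : ℤ) ^ 2 = n' := by
      rw [hn']; push_cast
      exact Int.mul_ediv_cancel_left _ (pow_ne_zero _ (by exact_mod_cast hq.1.ne_zero))
    have e2 : N / q ^ 2 = N' := by rw [hN']; exact Nat.mul_div_cancel_left _ hq2
    rw [e1] at r1
    rw [e2] at r2
    have e3 : (n' : ℤ) * (q : ℤ) ^ 2 = n := by rw [hn']; push_cast; ring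
    have e4 : N' * q ^ 2 = N := by rw [hN']; ring
    rw [e3, e4] at hi
    linear_combination WB N * r1 - RG A n * r2 + ((q : ℝ) + 1 - kap q (-(A.det * n))) * hi
  · rw [if_neg (fun h => hc (hdv.1 h))] at r1
    rw [if_neg hc] at r2
    linear_combination WB N * r1 - RG A n * r2

end

theorem final_of_pos (A : TernMat) (hA : IsLat A)
    (q : ℕ) (hq : q.Prime) (hqd : Nat.Coprime q (2 * A.det).natAbs)
    (n : ℕ) (hn : 0 < n) (hpos : 0 < RG A n)
    (f : ℕ) (hf : 0 < f) (hfq : Nat.Coprime f q)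
    (hH : hurwitz ((4 * (A.det : ℚ) * (n : ℚ)) / (f : ℚ) ^ 2) ≠ 0) :
    rGenus ((n : ℤ) * (q : ℤ) ^ 2) A / rGenus (n : ℤ) A =
      (hurwitz ((4 * (A.det : ℚ) * (n : ℚ) * (q : ℚ) ^ 2) / (f : ℚ) ^ 2) : ℝ) /
        (hurwitz ((4 * (A.det : ℚ) * (n : ℚ)) / (f : ℚ) ^ 2) : ℝ) := by
  haveI : Fact q.Prime := ⟨hq⟩
  have hcop : ∀ m : ℤ, (q : ℤ) ∣ m → ¬ m ∣ 2 * A.det := by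
    intro m h1 h3
    have h4 : q ∣ (2 * A.det).natAbs := Int.natCast_dvd.1 (h1.trans h3)
    have := Nat.eq_one_of_dvd_coprimes hqd dvd_rfl h4
    exact hq.one_lt.ne' this
  have hd : ¬ (q : ℤ) ∣ A.det := fun h => hcop _ h (Dvd.intro_left _ rfl)
  have h2 : Odd q := by
    rcases hq.eq_two_or_odd' with h | h
    · exact absurd (Dvd.intro _ rfl) (hcop 2 (by rw [h]; norm_num))
    · exact h
  have hfq' : ¬ (q : ℤ) ∣ f := by
    intro h
    have h' : q ∣ f := by exact_mod_cast h
    exact hq.one_lt.ne' (Nat.eq_one_of_dvd_coprimes hfq h' dvd_rfl)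
  have hf0 : (f : ℚ) ^ 2 ≠ 0 := pow_ne_zero _ (by exact_mod_cast hf.ne')
  set x : ℚ := (4 * (A.det : ℚ) * (n : ℚ)) / (f : ℚ) ^ 2 with hx
  have hxq : (4 * (A.det : ℚ) * (n : ℚ) * (q : ℚ) ^ 2) / (f : ℚ) ^ 2 = x * (q : ℚ) ^ 2 := by
    rw [hx]; ring
  rw [hxq]
  by_cases hc : x.den = 1 ∧ 0 ≤ x.num
  swap
  · exact absurd (by unfold hurwitz; rw [if_neg hc]) hH
  obtain ⟨N, hN⟩ : ∃ N : ℕ, x = N := by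
    refine ⟨x.num.toNat, ?_⟩
    have h1 : (x.num : ℚ) = x := Rat.den_eq_one_iff x |>.1 hc.1
    have h3 : ((x.num.toNat : ℕ) : ℤ) = x.num := Int.toNat_of_nonneg hc.2
    rw [← h1]
    exact_mod_cast congrArg (Int.cast : ℤ → ℚ) h3.symm
  have hh : ∀ M : ℕ, hurwitz (M : ℚ) = hurwitzNat M := by
    intro M
    unfold hurwitz
    rw [if_pos]
    · simp
    · simp
  have hxq2 : x * (q : ℚ) ^ 2 = ((N * q ^ 2 : ℕ) : ℚ) := by rw [hN]; push_cast; ring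
  rw [hxq2, hN, hh, hh]
  rw [hN, hh] at hH
  have hNN : 0 < N ∧ (N % 4 = 0 ∨ N % 4 = 3) := by
    by_contra h
    exact hH (by unfold hurwitzNat; rw [if_neg h])
  have hq4 : q ^ 2 % 4 = 1 := by
    obtain ⟨k, rfl⟩ := h2
    have : (2 * k + 1) ^ 2 = 4 * (k ^ 2 + k) + 1 := by ring
    omega
  have hNq : (N * q ^ 2) % 4 = N % 4 := by
    rw [Nat.mul_mod, hq4]; omega
  have hrel : (N : ℤ) * (f : ℤ) ^ 2 = 4 * (A.det * n) := by
    have : (N : ℚ) * (f : ℚ) ^ 2 = 4 * (A.det * n) := by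
      rw [← hN, hx]; field_simp
    exact_mod_cast this
  have key := ratio_key h2 hA hd f hfq' n N hn hNN.1 hrel
  have w1 := hurwitz_eq hNN.1 hNN.2
  have w2 := hurwitz_eq (N := N * q ^ 2) (Nat.mul_pos hNN.1 (pow_pos hq.pos 2)) (by rw [hNq]; exact hNN.2)
  have hm := massOf_pos hA
  have hw : WB N ≠ 0 := by
    intro h0
    rw [h0, mul_zero] at w1
    exact hH (by exact_mod_cast w1)
  rw [w1, w2, rGenus_eq, rGenus_eq, mul_div_mul_left _ _ (inv_ne_zero hm.ne'),
    mul_div_mul_left _ _ two_ne_zero, div_eq_div_iff hpos.ne' hw]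
  linear_combination -key

/-! ### P7a: reciprocity and Dirichlet's theorem -/

theorem jac_arith (n d E t a : ℕ) (hE : 0 < E)
    (ht : t ≡ 1 [MOD 8 * n * d * E]) (ha : Nat.Coprime a (2 * n * d))
    (b s : ℤ) (hb : IsCoprime b (t : ℤ)) (h1 : (t : ℤ) ∣ E * a + b ^ 2)
    (h2 : (a : ℤ) ∣ n * t * d + s ^ 2) : jacobiSym (-((n * d : ℕ) : ℤ)) a = 1 := by
  have ht4 : t ≡ 1 [MOD 4 * E] := ht.of_dvd ⟨2 * n * d, by ring⟩
  have ht4' : t % 4 = 1 := ht.of_dvd ⟨2 * n * d * E, by ring⟩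
  have hto : Odd t := Nat.odd_iff.2 (by omega)
  have hao : Odd a := by
    rw [← Nat.coprime_two_right]
    exact ha.coprime_dvd_right ⟨n * d, by ring⟩
  have e1 : jacobiSym (-1) t = 1 := by
    rw [jacobiSym.at_neg_one hto]
    rw [ZMod.χ₄_nat_one_mod_four ht4']
  have e2 : jacobiSym (E : ℤ) t = 1 := by
    rw [jacobiSym.mod_right' E hto, ht4, Nat.mod_eq_of_lt (by omega), jacobiSym.one_right]
  have e3 : jacobiSym (-1 * (E : ℤ) * a) t = 1 := by
    have : jacobiSym (-1 * (E : ℤ) * a) t = jacobiSym (b ^ 2) t := by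
      apply jacobiSym.mod_left'
      apply Int.ModEq.symm
      rw [Int.modEq_iff_dvd]
      have := h1.neg_right
      ring_nf at this ⊢
      exact this
    rw [this]
    apply jacobiSym.sq_one'
    exact Int.isCoprime_iff_gcd_eq_one.1 hb
  rw [jacobiSym.mul_left, jacobiSym.mul_left, e1, e2, one_mul, one_mul] at e3
  have e4 : jacobiSym t a = 1 := by
    rw [jacobiSym.quadratic_reciprocity_one_mod_four ht4' hao, e3]
  have hta : Nat.Coprime t a := by
    by_contra hne
    haveI : NeZero a := ⟨by rintro rfl; simp at hao⟩
    have h0 : jacobiSym (t : ℤ) a = 0 := jacobiSym.eq_zero_iff_not_coprime.2 (by simpa using hne)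
    rw [e4] at h0; exact one_ne_zero h0
  have hsa : IsCoprime s (a : ℤ) := by
    have h3 : IsCoprime ((n * t * d : ℤ)) (a : ℤ) := by
      have : Nat.Coprime (n * t * d) a := by
        refine Nat.Coprime.mul_left (Nat.Coprime.mul_left ?_ hta) ?_
        · exact (ha.coprime_dvd_right ⟨2 * d, by ring⟩).symm
        · exact (ha.coprime_dvd_right ⟨2 * n, by ring⟩).symm
      exact_mod_cast Nat.isCoprime_iff_coprime.2 this
    obtain ⟨c, hc⟩ := h2
    have h4 : IsCoprime (s ^ 2) (a : ℤ) := by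
      have : s ^ 2 = -(n * t * d : ℤ) + a * c := by linear_combination hc
      rw [this]
      exact (IsCoprime.add_mul_left_left_iff).2 h3.neg_left
    exact (IsCoprime.pow_left_iff (by norm_num)).1 h4
  have e5 : jacobiSym (-((n * d : ℕ) : ℤ) * t) a = 1 := by
    have : jacobiSym (-((n * d : ℕ) : ℤ) * t) a = jacobiSym (s ^ 2) a := by
      apply jacobiSym.mod_left'
      rw [← Int.ModEq, Int.modEq_iff_dvd]
      push_cast
      ring_nf at h2 ⊢
      exact h2
    rw [this]
    exact jacobiSym.sq_one' (Int.isCoprime_iff_gcd_eq_one.1 hsa)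
  rw [jacobiSym.mul_left, e4, mul_one] at e5
  exact e5

theorem dirichlet_arith (n d a M : ℕ) (hM : 0 < M) (hnd : 4 * (n * d) ∣ M) (h2 : 2 ∣ M)
    (ha : Nat.Coprime a M) (hJ : jacobiSym (-((n * d : ℕ) : ℤ)) a = 1) :
    ∃ l : ℕ, l.Prime ∧ (M : ℤ) ∣ l - a ∧ ¬ l ∣ M ∧ ∃ β : ℤ, (l : ℤ) ∣ β ^ 2 + n * d := by
  obtain ⟨l, hl, hlp, hla⟩ := Nat.forall_exists_prime_gt_and_modEq M hM.ne' ha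
  haveI : Fact l.Prime := ⟨hlp⟩
  have hlM : ¬ l ∣ M := fun h => absurd (Nat.le_of_dvd hM h) (by omega)
  refine ⟨l, hlp, ?_, hlM, ?_⟩
  · exact (Int.natCast_modEq_iff.2 hla.symm).dvd
  have hao : Odd a := by
    rw [← Nat.coprime_two_right]; exact ha.coprime_dvd_right h2
  have hlo : Odd l := by
    rw [← Nat.coprime_two_right]
    refine ((Nat.coprime_primes hlp Nat.prime_two).2 ?_)
    rintro rfl; exact hlM h2
  have e : jacobiSym (-((n * d : ℕ) : ℤ)) l = 1 := by
    rw [jacobiSym.mod_right _ hlo]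
    rw [jacobiSym.mod_right _ hao] at hJ
    rw [Int.natAbs_neg, Int.natAbs_natCast] at hJ ⊢
    rw [show l % (4 * (n * d)) = a % (4 * (n * d)) from hla.of_dvd hnd]
    exact hJ
  obtain ⟨r, hr⟩ := ZMod.isSquare_of_jacobiSym_eq_one e
  refine ⟨r.val, ?_⟩
  rw [← ZMod.intCast_zmod_eq_zero_iff_dvd]
  push_cast
  rw [ZMod.natCast_val, ZMod.cast_id]
  push_cast at hr
  linear_combination -hr

/-! ### P7b: the binary minors of a ternary Gram matrix along its first vector -/

section Minors
variable {R : Type*} [CommRing R]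

def phM (X : Matrix (Fin 3) (Fin 3) R) : R := X 0 0 * X 1 1 - X 0 1 ^ 2
def psM (X : Matrix (Fin 3) (Fin 3) R) : R := X 0 0 * X 1 2 - X 0 1 * X 0 2
def ptM (X : Matrix (Fin 3) (Fin 3) R) : R := X 0 0 * X 2 2 - X 0 2 ^ 2

theorem minor_id (X : Matrix (Fin 3) (Fin 3) R) (hX : X.IsSymm) :
    phM X * ptM X - psM X ^ 2 = X 0 0 * X.det := by
  rw [det_symm X hX, phM, psM, ptM]; ring

theorem isSymm_tr (X V : Matrix (Fin 3) (Fin 3) R) (hX : X.IsSymm) : (Vᵀ * X * V).IsSymm := by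
  show (Vᵀ * X * V)ᵀ = _
  rw [Matrix.transpose_mul, Matrix.transpose_mul, Matrix.transpose_transpose, hX.eq,
    Matrix.mul_assoc]

theorem tr_entry (X V : Matrix (Fin 3) (Fin 3) R) (i j : Fin 3) :
    (Vᵀ * X * V) i j = ∑ k, ∑ l, V k i * X k l * V l j := by
  simp only [Matrix.mul_apply, Matrix.transpose_apply, Fin.sum_univ_three]; ring

theorem tr_zero (X V : Matrix (Fin 3) (Fin 3) R) :
    (Vᵀ * X * V) 0 0 = quadVal X (fun i => V i 0) := by
  rw [tr_entry]; rfl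

theorem complete_unit (y : Fin 3 → R) (h : ∃ i, IsUnit (y i)) :
    ∃ V : Matrix (Fin 3) (Fin 3) R, V.det = 1 ∧ (fun i => V i 0) = y := by
  obtain ⟨i, hi⟩ := h
  obtain ⟨z, hz⟩ := hi.exists_right_inv
  fin_cases i
  · simp only [Fin.zero_eta] at hz
    refine ⟨!![y 0, 0, 0; y 1, z, 0; y 2, 0, 1], ?_, ?_⟩
    · rw [Matrix.det_fin_three]; simp; linear_combination hz
    · funext j; fin_cases j <;> simp
  · simp only [Fin.mk_one] at hz
    refine ⟨!![y 0, -z, 0; y 1, 0, 0; y 2, 0, 1], ?_, ?_⟩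
    · rw [Matrix.det_fin_three]; simp; linear_combination hz
    · funext j; fin_cases j <;> simp
  · simp only [Fin.reduceFinMk] at hz
    refine ⟨!![y 0, 1, 0; y 1, 0, z; y 2, 0, 0], ?_, ?_⟩
    · rw [Matrix.det_fin_three]; simp; linear_combination hz
    · funext j; fin_cases j <;> simp

theorem make_ph [IsDomain R] [CharZero R] (A : Matrix (Fin 3) (Fin 3) R) (hA : A.IsSymm)
    (hd : A.det ≠ 0) (n : R) (hn : n ≠ 0) (y : Fin 3 → R) (hy : ∃ i, IsUnit (y i))
    (hq : quadVal A y = n) :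
    ∃ V : Matrix (Fin 3) (Fin 3) R, V.det = 1 ∧ (Vᵀ * A * V) 0 0 = n ∧ phM (Vᵀ * A * V) ≠ 0 := by
  obtain ⟨V, hV, hVy⟩ := complete_unit y hy
  have h00 : (Vᵀ * A * V) 0 0 = n := by rw [tr_zero, hVy, hq]
  have hXs := isSymm_tr A V hA
  have hXd : (Vᵀ * A * V).det = A.det := by simp [hV]
  have hid := minor_id _ hXs
  rw [hXd, h00] at hid
  have hc : ∀ T : Matrix (Fin 3) (Fin 3) R,
      (V * T)ᵀ * A * (V * T) = Tᵀ * (Vᵀ * A * V) * T := by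
    intro T; simp only [Matrix.transpose_mul, Matrix.mul_assoc]
  generalize Vᵀ * A * V = X at *
  have s10 := hXs.apply 0 1
  have s20 := hXs.apply 0 2
  have s21 := hXs.apply 1 2
  by_cases h1 : phM X ≠ 0
  · exact ⟨V, hV, by have := hc 1; simp at this; rw [this]; exact h00,
      by have := hc 1; simp at this; rw [this]; exact h1⟩
  by_cases h2 : ptM X ≠ 0
  · refine ⟨V * !![1,0,0;0,0,-1;0,1,0], ?_, ?_, ?_⟩
    · rw [Matrix.det_mul, hV, Matrix.det_fin_three]; simp
    · rw [hc, tr_entry]; simp [Fin.sum_univ_three, h00]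
    · rw [hc, phM, tr_entry, tr_entry, tr_entry]; simp [Fin.sum_univ_three]
      exact h2
  push Not at h1 h2
  rw [h1, h2] at hid
  refine ⟨V * !![1,0,0;0,1,0;0,1,1], ?_, ?_, ?_⟩
  · rw [Matrix.det_mul, hV, Matrix.det_fin_three]; simp
  · rw [hc, tr_entry]; simp [Fin.sum_univ_three, h00]
  · have : phM (!![1,0,0;0,1,0;0,1,1]ᵀ * X * !![1,0,0;0,1,0;0,1,1]) = phM X + 2 * psM X + ptM X := by
      rw [phM, tr_entry, tr_entry, tr_entry]; simp [Fin.sum_univ_three, phM, psM, ptM]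
      rw [s21]; ring
    rw [hc, this, h1, h2]
    intro h3
    have h4 : psM X = 0 := by simpa using h3
    rw [h4] at hid
    have : n * A.det = 0 := by rw [← hid]; ring
    rcases mul_eq_zero.1 this with h | h
    · exact hn h
    · exact hd h

theorem minor_isom [IsDomain R] (X Y : Matrix (Fin 3) (Fin 3) R) (hX : X.IsSymm) (hY : Y.IsSymm)
    (n u v k w1 w2 : R) (hn : n ≠ 0) (hX0 : X 0 0 = n) (hY0 : Y 0 0 = n) (huv : u * v = 1)
    (hph : phM X ≠ 0) (h1 : phM Y = u ^ 2 * phM X) (h2 : psM Y = u * (k * phM X + v * psM X))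
    (hd : X.det = Y.det) (hb : Y 0 1 = n * w1 + X 0 1 * u)
    (hc : Y 0 2 = n * w2 + X 0 1 * k + X 0 2 * v) :
    ∃ T : Matrix (Fin 3) (Fin 3) R, T.det = 1 ∧ Tᵀ * X * T = Y := by
  refine ⟨!![1, w1, w2; 0, u, k; 0, 0, v], ?_, ?_⟩
  · rw [Matrix.det_fin_three]; simp; exact huv
  have hZs := isSymm_tr X !![1, w1, w2; 0, u, k; 0, 0, v] hX
  have hZd : (!![1, w1, w2; 0, u, k; 0, 0, v]ᵀ * X * !![1, w1, w2; 0, u, k; 0, 0, v]).det = X.det := by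
    rw [Matrix.det_mul, Matrix.det_mul, Matrix.det_transpose, Matrix.det_fin_three !![1, w1, w2; 0, u, k; 0, 0, v]]
    simp
    linear_combination (u * v + 1) * X.det * huv
  have s10 := hX.apply 0 1
  have s20 := hX.apply 0 2
  have s21 := hX.apply 1 2
  have z00 : (!![1, w1, w2; 0, u, k; 0, 0, v]ᵀ * X * !![1, w1, w2; 0, u, k; 0, 0, v]) 0 0 = n := by
    rw [tr_entry]; simp [Fin.sum_univ_three, hX0]
  have z01 : (!![1, w1, w2; 0, u, k; 0, 0, v]ᵀ * X * !![1, w1, w2; 0, u, k; 0, 0, v]) 0 1 = Y 0 1 := by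
    rw [tr_entry, hb, ← hX0]; simp [Fin.sum_univ_three]
  have z02 : (!![1, w1, w2; 0, u, k; 0, 0, v]ᵀ * X * !![1, w1, w2; 0, u, k; 0, 0, v]) 0 2 = Y 0 2 := by
    rw [tr_entry, hc, ← hX0]; simp [Fin.sum_univ_three]
  have zph : phM (!![1, w1, w2; 0, u, k; 0, 0, v]ᵀ * X * !![1, w1, w2; 0, u, k; 0, 0, v]) = phM Y := by
    rw [h1, phM, phM, tr_entry, tr_entry, tr_entry]; simp [Fin.sum_univ_three, s10, s20, s21]
    ring
  have zps : psM (!![1, w1, w2; 0, u, k; 0, 0, v]ᵀ * X * !![1, w1, w2; 0, u, k; 0, 0, v]) = psM Y := by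
    rw [h2, psM, psM, phM, tr_entry, tr_entry, tr_entry, tr_entry]
    simp [Fin.sum_univ_three, s10, s20, s21]
    ring
  have hid1 := minor_id _ hZs
  have hid2 := minor_id _ hY
  generalize !![1, w1, w2; 0, u, k; 0, 0, v]ᵀ * X * !![1, w1, w2; 0, u, k; 0, 0, v] = Z at *
  have hphY : phM Y ≠ 0 := by
    rw [h1]
    exact mul_ne_zero (pow_ne_zero _ (left_ne_zero_of_mul_eq_one huv)) hph
  have zpt : ptM Z = ptM Y := by
    apply mul_left_cancel₀ hphY
    rw [zph, zps, z00, hZd] at hid1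
    rw [hY0, ← hd] at hid2
    linear_combination hid1 - hid2
  have z11 : Z 1 1 = Y 1 1 := by
    apply mul_left_cancel₀ hn
    rw [phM, phM, z00, z01, hY0] at zph; linear_combination zph
  have z12 : Z 1 2 = Y 1 2 := by
    apply mul_left_cancel₀ hn
    rw [psM, psM, z00, z01, z02, hY0] at zps; linear_combination zps
  have z22 : Z 2 2 = Y 2 2 := by
    apply mul_left_cancel₀ hn
    rw [ptM, ptM, z00, z02, hY0] at zpt; linear_combination zpt
  have t10 := hZs.apply 0 1
  have t20 := hZs.apply 0 2
  have t21 := hZs.apply 1 2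
  have y10 := hY.apply 0 1
  have y20 := hY.apply 0 2
  have y21 := hY.apply 1 2
  ext i j
  fin_cases i <;> fin_cases j <;>
    simp only [Fin.zero_eta, Fin.mk_one, Fin.reduceFinMk, z00, z01, z02, z11, z12, z22, hY0, t10, t20, t21, y10, y20, y21]

end Minors

/-! ### P7c: a global approximation and an auxiliary prime -/

theorem exists_E (S : Finset ℕ) (hS : ∀ p ∈ S, p.Prime) (z : ∀ (p : ℕ) (_ : Fact p.Prime), ℤ_[p])
    (hz : ∀ p hp, z p hp ≠ 0) : ∃ E : ℕ, 0 < E ∧ (∀ p : ℕ, p.Prime → p ∣ E → p ∈ S) ∧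
      ∀ p (hp : Fact p.Prime), p ∈ S → ∃ w : ℤ_[p], IsUnit w ∧ z p hp = (E : ℤ_[p]) * w := by
  induction S using Finset.induction_on with
  | empty =>
    exact ⟨1, one_pos, fun p hp h => absurd (Nat.dvd_one.1 h) hp.one_lt.ne', by simp⟩
  | insert r S hr ih =>
    obtain ⟨E, hE, h1, h2⟩ := ih (fun p hp => hS p (Finset.mem_insert_of_mem hp))
    have hrp : r.Prime := hS r (Finset.mem_insert_self _ _)
    refine ⟨E * r ^ (haveI : Fact r.Prime := ⟨hrp⟩; (z r ⟨hrp⟩).valuation), ?_, ?_, ?_⟩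
    · exact Nat.mul_pos hE (pow_pos hrp.pos _)
    · intro p hp hpd
      rcases hp.dvd_mul.1 hpd with h | h
      · exact Finset.mem_insert_of_mem (h1 p hp h)
      · rw [(Nat.prime_dvd_prime_iff_eq hp hrp).1 (hp.dvd_of_dvd_pow h)]
        exact Finset.mem_insert_self _ _
    · intro p hp hpS
      by_cases hpr : p = r
      · subst hpr
        have hu : IsUnit ((E : ℕ) : ℤ_[p]) := padic_unit_nat (fun h => hr (h1 p hrp h))
        obtain ⟨e, he⟩ := hu.exists_right_inv
        have hs := PadicInt.unitCoeff_spec (hz p hp)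
        refine ⟨(PadicInt.unitCoeff (hz p hp) : ℤ_[p]) * e, ?_, ?_⟩
        · exact (Units.isUnit _).mul (IsUnit.of_mul_eq_one_right _ he)
        · refine hs.trans ?_
          push_cast
          linear_combination -(PadicInt.unitCoeff (hz p hp) : ℤ_[p]) * (p : ℤ_[p]) ^ (z p hp).valuation * he
      · have hpS' : p ∈ S := (Finset.mem_insert.1 hpS).resolve_left hpr
        obtain ⟨w, hw, hzw⟩ := h2 p hp hpS'
        have hu : IsUnit ((r : ℕ) : ℤ_[p]) :=
          padic_unit_nat (fun h => hpr ((Nat.prime_dvd_prime_iff_eq hp.1 hrp).1 h))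
        obtain ⟨e, he⟩ := (hu.pow (haveI : Fact r.Prime := ⟨hrp⟩; (z r ⟨hrp⟩).valuation)).exists_right_inv
        refine ⟨w * e, hw.mul (IsUnit.of_mul_eq_one_right _ he), ?_⟩
        rw [hzw]
        push_cast
        linear_combination -(E : ℤ_[p]) * w * he

theorem tr_cong {R : Type*} [CommRing R] (X W V : Matrix (Fin 3) (Fin 3) R) (M : R)
    (h : ∀ i j, M ∣ W i j - V i j) (i j : Fin 3) : M ∣ (Wᵀ * X * W) i j - (Vᵀ * X * V) i j := by
  rw [tr_entry, tr_entry, ← Finset.sum_sub_distrib]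
  refine Finset.dvd_sum fun k _ => ?_
  rw [← Finset.sum_sub_distrib]
  refine Finset.dvd_sum fun l _ => ?_
  have : W k i * X k l * W l j - V k i * X k l * V l j =
    (W k i - V k i) * (X k l * W l j) + (W l j - V l j) * (V k i * X k l) := by ring
  rw [this]
  exact dvd_add ((h k i).mul_right _) ((h l j).mul_right _)

theorem prime_dvd_cast_one {r : ℕ} (hr : r.Prime) (h : (r : ℤ) ∣ 1) : False :=
  hr.one_lt.ne' (Nat.dvd_one.1 (Int.natCast_dvd_natCast.1 (by rw [Nat.cast_one]; exact h)))

theorem global_approx (A : TernMat) (hA : IsLat A) (n m : ℕ) (hn : 0 < n) (hm : 0 < m)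
    (hnm : n ∣ m) (hdm : A.det ∣ m)
    (V : ∀ (p : ℕ) (_ : Fact p.Prime), Matrix (Fin 3) (Fin 3) ℤ_[p])
    (hV : ∀ p hp, (V p hp).det = 1)
    (h00 : ∀ p (hp : Fact p.Prime), ((V p hp)ᵀ * padicMat p A * V p hp) 0 0 = n) :
    ∃ A' : TernMat, IsLat A' ∧ A'.det = A.det ∧
      (∀ p (hp : Fact p.Prime), p ∣ n * m → ∀ i j, ((n * m : ℕ) : ℤ_[p]) ∣
        (A' i j : ℤ_[p]) - ((V p hp)ᵀ * padicMat p A * V p hp) i j) ∧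
      ∃ t : ℕ, A' 0 0 = n * t ∧ t ≡ 1 [MOD m] ∧ IsCoprime (A' 0 1) (t : ℤ) := by
  have hM : n * m ≠ 0 := (Nat.mul_pos hn hm).ne'
  obtain ⟨W, hW, hWV⟩ := SA_padic (n * m) hM V hV
  have key : ∀ W : TernMat, W.det = 1 → (∀ p (hp : Fact p.Prime), p ∣ n * m → ∀ i j,
      ((n * m : ℕ) : ℤ_[p]) ∣ (W i j : ℤ_[p]) - V p hp i j) →
      IsLat (Wᵀ * A * W) ∧ (Wᵀ * A * W).det = A.det ∧
      (∀ p (hp : Fact p.Prime), p ∣ n * m → ∀ i j, ((n * m : ℕ) : ℤ_[p]) ∣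
        ((Wᵀ * A * W) i j : ℤ_[p]) - ((V p hp)ᵀ * padicMat p A * V p hp) i j) := by
    intro W hW hWV
    refine ⟨LatIsom_isLat hA ⟨W, by simp [hW], rfl⟩, by simp [hW], ?_⟩
    intro p hp hpM i j
    have := tr_cong (padicMat p A) (padicMat p W) (V p hp) _ (fun i j => hWV p hp hpM i j) i j
    rw [← padicMat_tr, ← padicMat_mul, ← padicMat_mul] at this
    exact this
  obtain ⟨k1, k2, k3⟩ := key W hW hWV
  have hdv : ((n * m : ℕ) : ℤ) ∣ (Wᵀ * A * W) 0 0 - n := by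
    apply dvd_of_padic hM
    intro p hp hpM
    have := k3 p hp hpM 0 0
    rw [h00] at this
    push_cast at this ⊢
    exact this
  obtain ⟨s, hs⟩ := hdv
  have hpos : 0 < (Wᵀ * A * W) 0 0 := ((isLat_iff _).1 k1).2.1
  have hA0 : (Wᵀ * A * W) 0 0 = n * (1 + m * s) := by push_cast at hs; linear_combination hs
  have ht0 : 0 < 1 + m * s := by
    rw [hA0] at hpos
    exact pos_of_mul_pos_right hpos (by positivity)
  obtain ⟨t, ht⟩ := Int.eq_ofNat_of_zero_le ht0.le
  rw [ht] at hA0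
  obtain ⟨k, hk⟩ := exists_coprime_add ((Wᵀ * A * W) 0 1) ((n * m : ℕ) * (Wᵀ * A * W) 0 2) t
    (by rw [← ht]; exact ht0.ne') (by
      intro r hr h1 h2 h3
      have hri := Nat.prime_iff_prime_int.1 hr
      have hrm : ¬ (r : ℤ) ∣ m := by
        intro h
        apply prime_dvd_cast_one hr
        have h4 : (1 : ℤ) = t - m * s := by linear_combination ht
        rw [h4]
        exact dvd_sub h3 (h.mul_right _)
      have h5 : (r : ℤ) ∣ (Wᵀ * A * W) 0 2 := by
        rcases hri.dvd_or_dvd h2 with h | h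
        · push_cast at h
          rcases hri.dvd_or_dvd h with h | h
          · exact absurd (h.trans (Int.natCast_dvd_natCast.2 hnm)) hrm
          · exact absurd h hrm
        · exact h
      apply hrm
      refine dvd_trans ?_ hdm
      rw [← k2, Matrix.det_fin_three, hA0]
      generalize Wᵀ * A * W = Z at *
      have e : (n * t : ℤ) * Z 1 1 * Z 2 2 - n * t * Z 1 2 * Z 2 1 - Z 0 1 * Z 1 0 * Z 2 2 +
          Z 0 1 * Z 1 2 * Z 2 0 + Z 0 2 * Z 1 0 * Z 2 1 - Z 0 2 * Z 1 1 * Z 2 0 =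
        t * (n * (Z 1 1 * Z 2 2 - Z 1 2 * Z 2 1)) + Z 0 1 * (Z 1 2 * Z 2 0 - Z 1 0 * Z 2 2) +
          Z 0 2 * (Z 1 0 * Z 2 1 - Z 1 1 * Z 2 0) := by ring
      rw [e]
      exact dvd_add (dvd_add (h3.mul_right _) (h1.mul_right _)) (h5.mul_right _))
  set T : TernMat := !![1, 0, 0; 0, 1, 0; 0, k * (n * m : ℕ), 1] with hT
  have hTd : T.det = 1 := by rw [Matrix.det_fin_three]; simp [hT]
  obtain ⟨l1, l2, l3⟩ := key (W * T) (by rw [Matrix.det_mul, hW, hTd, one_mul]) (by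
    intro p hp hpM i j
    have h := hWV p hp hpM i j
    have e : (W * T) i j = W i j + (if j = 1 then (n * m : ℕ) * (k * W i 2) else 0) := by
      rw [Matrix.mul_apply, Fin.sum_univ_three]
      fin_cases j <;> simp [hT]
      ring
    rw [e]
    split_ifs
    · rw [Int.cast_add, Int.cast_mul, Int.cast_natCast, add_sub_right_comm]
      exact dvd_add h (dvd_mul_right _ _)
    · simpa using h)
  have hc : (W * T)ᵀ * A * (W * T) = Tᵀ * (Wᵀ * A * W) * T := by
    simp only [Matrix.transpose_mul, Matrix.mul_assoc]
  refine ⟨_, l1, l2, l3, t, ?_, ?_, ?_⟩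
  · rw [hc, ← hA0, tr_entry]; simp [Fin.sum_univ_three, hT]
  · apply Nat.ModEq.symm
    rw [← Int.natCast_modEq_iff, Int.modEq_iff_dvd]
    exact ⟨s, by push_cast; linear_combination -ht⟩
  · have e : ((W * T)ᵀ * A * (W * T)) 0 1 = (Wᵀ * A * W) 0 1 + k * ((n * m : ℕ) * (Wᵀ * A * W) 0 2) := by
      rw [hc, tr_entry]; simp [Fin.sum_univ_three, hT]; ring
    rw [e]; exact hk

theorem dvd_phM {R : Type*} [CommRing R] (X Y : Matrix (Fin 3) (Fin 3) R) (M : R)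
    (h : ∀ i j, M ∣ X i j - Y i j) : M ∣ phM X - phM Y := by
  have : phM X - phM Y = (X 0 0 - Y 0 0) * X 1 1 + (X 1 1 - Y 1 1) * Y 0 0 -
    (X 0 1 - Y 0 1) * (X 0 1 + Y 0 1) := by rw [phM, phM]; ring
  rw [this]
  exact dvd_sub (dvd_add ((h 0 0).mul_right _) ((h 1 1).mul_right _)) ((h 0 1).mul_right _)

theorem aux_prime (A : TernMat) (hA : IsLat A) (n d E : ℕ) (hn : 0 < n) (hd : 0 < d) (hE : 0 < E)
    (hAd : A.det = d) (hEp : ∀ p : ℕ, p.Prime → p ∣ E → p ∣ 2 * n * d)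
    (V : ∀ (p : ℕ) (_ : Fact p.Prime), Matrix (Fin 3) (Fin 3) ℤ_[p])
    (hV : ∀ p hp, (V p hp).det = 1)
    (h00 : ∀ p (hp : Fact p.Prime), ((V p hp)ᵀ * padicMat p A * V p hp) 0 0 = n)
    (w : ∀ (p : ℕ) (_ : Fact p.Prime), ℤ_[p])
    (hw : ∀ p (hp : Fact p.Prime), p ∣ 2 * n * d → IsUnit (w p hp) ∧
      phM ((V p hp)ᵀ * padicMat p A * V p hp) = (E : ℤ_[p]) * w p hp) :
    ∃ l : ℕ, l.Prime ∧ ¬ l ∣ 2 * n * d ∧ (∃ β : ℤ, (l : ℤ) ∣ β ^ 2 + n * d) ∧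
      ∀ p (hp : Fact p.Prime), p ∣ 2 * n * d → ((8 * n * n * d : ℕ) : ℤ_[p]) ∣ (l : ℤ_[p]) - w p hp := by
  obtain ⟨A', hA', hA'd, hcong, t, ht0, ht1, htc⟩ := global_approx A hA n (8 * n * d * E) hn
    (by positivity) ⟨8 * d * E, by ring⟩ (by rw [hAd]; exact ⟨8 * n * E, by push_cast; ring⟩) V hV h00
  have hM : n * (8 * n * d * E) ≠ 0 := by positivity
  have hph : ∀ p (hp : Fact p.Prime), p ∣ 2 * n * d → ((n * (8 * n * d * E) : ℕ) : ℤ_[p]) ∣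
      ((phM A' : ℤ) : ℤ_[p]) - E * w p hp := by
    intro p hp hpd
    rw [← (hw p hp hpd).2]
    have h1 := dvd_phM (padicMat p A') _ _ (hcong p hp (hpd.trans ⟨4 * n * E, by ring⟩))
    have h2 : phM (padicMat p A') = ((phM A' : ℤ) : ℤ_[p]) := by
      simp [phM, padicMat]
    rw [h2] at h1
    exact h1
  have hEd : (E : ℤ) ∣ phM A' := by
    apply dvd_of_padic hE.ne'
    intro p hp hpE
    have h1 := hph p hp (hEp p hp.1 hpE)
    have h2 : (E : ℤ_[p]) ∣ ((n * (8 * n * d * E) : ℕ) : ℤ_[p]) := ⟨n * 8 * n * d, by push_cast; ring⟩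
    exact (dvd_sub_left (dvd_mul_right _ _)).1 (h2.trans h1)
  obtain ⟨a0, ha0⟩ := hEd
  have hphp : 0 < phM A' := ((isLat_iff _).1 hA').2.2.1
  have ha0p : 0 < a0 := by
    rw [ha0] at hphp; exact pos_of_mul_pos_right hphp (by positivity)
  obtain ⟨a, rfl⟩ := Int.eq_ofNat_of_zero_le ha0p.le
  have haw : ∀ p (hp : Fact p.Prime), p ∣ 2 * n * d → ((8 * n * n * d : ℕ) : ℤ_[p]) ∣
      (a : ℤ_[p]) - w p hp := by
    intro p hp hpd
    obtain ⟨c, hc⟩ := hph p hp hpd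
    refine ⟨c, ?_⟩
    have hE0 : (E : ℤ_[p]) ≠ 0 := by exact_mod_cast hE.ne'
    apply mul_left_cancel₀ hE0
    rw [ha0] at hc
    push_cast at hc ⊢
    linear_combination hc
  have hacop : Nat.Coprime a (2 * n * d) := by
    apply Nat.Coprime.symm
    apply Nat.coprime_of_dvd
    intro p hp h1 h2
    haveI hpf : Fact p.Prime := ⟨hp⟩
    have hun := (hw p hpf h1).1
    rw [unit_iff_not_dvd] at hun
    apply hun
    have h3 : (p : ℤ_[p]) ∣ ((8 * n * n * d : ℕ) : ℤ_[p]) :=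
      Nat.cast_dvd_cast (h1.trans ⟨4 * n, by ring⟩)
    have h4 := h3.trans (haw p hpf h1)
    have h5 : (p : ℤ_[p]) ∣ (a : ℤ_[p]) := Nat.cast_dvd_cast h2
    exact (dvd_sub_right h5).1 h4
  have hJ := jac_arith n d E t a hE ht1 hacop (A' 0 1) (psM A') htc
    ⟨n * A' 1 1, by
      have : phM A' = A' 0 0 * A' 1 1 - A' 0 1 ^ 2 := rfl
      rw [ha0, ht0] at this
      linear_combination this⟩
    ⟨E * ptM A', by
      have := minor_id A' hA'.1
      rw [ha0, ht0, hA'd, hAd] at this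
      linear_combination -this⟩
  have hacM : Nat.Coprime a (8 * n * n * d) := by
    have h2 := hacop.coprime_dvd_right (⟨n * d, by ring⟩ : 2 ∣ 2 * n * d)
    have hnn := hacop.coprime_dvd_right (⟨2 * d, by ring⟩ : n ∣ 2 * n * d)
    have hdd := hacop.coprime_dvd_right (⟨2 * n, by ring⟩ : d ∣ 2 * n * d)
    have h8 : Nat.Coprime a 8 := by
      have := h2.pow_right 3; norm_num at this; exact this
    exact ((h8.mul_right hnn).mul_right hnn).mul_right hdd
  obtain ⟨l, hl, hla, hlM, hβ⟩ := dirichlet_arith n d a (8 * n * n * d) (by positivity)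
    ⟨2 * n, by ring⟩ ⟨4 * n * n * d, by ring⟩ hacM hJ
  refine ⟨l, hl, fun h => hlM (h.trans ⟨4 * n, by ring⟩), hβ, ?_⟩
  intro p hp hpd
  have h1 : ((8 * n * n * d : ℕ) : ℤ_[p]) ∣ (l : ℤ_[p]) - a := by
    obtain ⟨c, hc⟩ := hla
    refine ⟨c, ?_⟩
    have := congrArg (Int.cast : ℤ → ℤ_[p]) hc
    push_cast at this ⊢
    exact this
  have := dvd_add h1 (haw p hp hpd)
  rwa [sub_add_sub_cancel] at this

/-! ### P7d: construction of a lattice in the genus representing `n` -/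

theorem gam_local {R : Type*} [CommRing R] [IsDomain R] (X : Matrix (Fin 3) (Fin 3) R)
    (hX : X.IsSymm) (n u v k e g b : R) (h0 : X 0 0 = n) (huv : u * v = 1) (hph : phM X ≠ 0)
    (he : e = u ^ 2 * phM X) (hb : b = u * (k * phM X + v * psM X))
    (hg : e * g = b ^ 2 + n * X.det) :
    g = k ^ 2 * phM X + 2 * k * v * psM X + v ^ 2 * ptM X := by
  have hid := minor_id X hX
  rw [h0] at hid
  have hu : u ≠ 0 := left_ne_zero_of_mul_eq_one huv
  apply mul_left_cancel₀ (mul_ne_zero (pow_ne_zero 2 hu) hph)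
  rw [← he, hg, hb, ← hid, he]
  linear_combination (-(u * v + 1) * phM X * ptM X + (u * v + 1) * psM X ^ 2) * huv

theorem exists_local_u {p : ℕ} [Fact p.Prime] (n d l : ℕ) (hp : p ∣ 2 * n * d) (w : ℤ_[p])
    (hw : IsUnit w) (hl : ((8 * n * n * d : ℕ) : ℤ_[p]) ∣ (l : ℤ_[p]) - w) :
    ∃ u v : ℤ_[p], u * v = 1 ∧ u ^ 2 * w = l := by
  obtain ⟨w', hw'⟩ := hw.exists_right_inv
  obtain ⟨c, hc⟩ := hl
  have h4 : (4 * p : ℤ_[p]) ∣ ((8 * n * n * d : ℕ) : ℤ_[p]) := by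
    have : 4 * p ∣ 8 * n * n * d :=
      (Nat.mul_dvd_mul_left 4 hp).trans ⟨n, by ring⟩
    have := Nat.cast_dvd_cast (α := ℤ_[p]) this
    push_cast at this ⊢
    exact this
  obtain ⟨u, hu, hu2⟩ := sq_near_one (p := p) ((l : ℤ_[p]) * w') (by
    have : (l : ℤ_[p]) * w' - 1 = ((8 * n * n * d : ℕ) : ℤ_[p]) * (c * w') := by
      linear_combination w' * hc + hw'
    rw [this]
    exact h4.mul_right _)
  obtain ⟨v, hv⟩ := hu.exists_right_inv
  exact ⟨u, v, hv, by rw [hu2]; linear_combination (l : ℤ_[p]) * hw'⟩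

/-- From the two minors and the first row, build the Gram matrix. -/
theorem build_B (n d e : ℕ) (hn : 0 < n) (hd : 0 < d) (he : 0 < e) (b c β γ : ℤ)
    (hg : e * γ = β ^ 2 + n * d) (h1 : (n : ℤ) ∣ e + b ^ 2) (h2 : (n : ℤ) ∣ β + b * c)
    (h3 : (n : ℤ) ∣ γ + c ^ 2) :
    ∃ B : TernMat, IsLat B ∧ B.det = d ∧ B 0 0 = n ∧ B 0 1 = b ∧ B 0 2 = c ∧ phM B = e ∧
      psM B = β := by
  obtain ⟨x, hx⟩ := h1
  obtain ⟨y, hy⟩ := h2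
  obtain ⟨z, hz⟩ := h3
  have hn0 : (n : ℤ) ≠ 0 := by exact_mod_cast hn.ne'
  set B : TernMat := !![(n : ℤ), b, c; b, x, y; c, y, z] with hB
  have hs : B.IsSymm := by
    ext i j; fin_cases i <;> fin_cases j <;> simp [hB]
  have e00 : B 0 0 = n := by simp [hB]
  have e1 : phM B = e := by simp [phM, hB]; linear_combination -hx
  have e2 : psM B = β := by simp [psM, hB]; linear_combination -hy
  have e3 : ptM B = γ := by simp [ptM, hB]; linear_combination -hz
  have hdet : B.det = d := by
    have hid := minor_id B hs
    rw [e1, e2, e3, e00] at hid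
    apply mul_left_cancel₀ hn0
    linear_combination -hid + hg
  refine ⟨B, ?_, hdet, e00, by simp [hB], by simp [hB], e1, e2⟩
  rw [isLat_iff]
  refine ⟨hs, ?_, ?_, ?_⟩
  · rw [e00]; exact_mod_cast hn
  · have : B 0 0 * B 1 1 - B 0 1 ^ 2 = e := e1
    rw [this]; exact_mod_cast he
  · rw [hdet]; exact_mod_cast hd

theorem int_cast_eq {p : ℕ} [Fact p.Prime] {x y : ℤ} (h : x = y) : (x : ℤ_[p]) = (y : ℤ_[p]) := by
  rw [h]

theorem construct (A : TernMat) (hA : IsLat A) (n d E : ℕ) (hn : 0 < n) (hd : 0 < d) (hE : 0 < E)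
    (hAd : A.det = d) (hEp : ∀ p : ℕ, p.Prime → p ∣ E → p ∣ 2 * n * d)
    (V : ∀ (p : ℕ) (_ : Fact p.Prime), Matrix (Fin 3) (Fin 3) ℤ_[p])
    (hV : ∀ p hp, (V p hp).det = 1)
    (X : ∀ (p : ℕ) (_ : Fact p.Prime), Matrix (Fin 3) (Fin 3) ℤ_[p])
    (hXV : ∀ p (hp : Fact p.Prime), (V p hp)ᵀ * padicMat p A * V p hp = X p hp)
    (h00 : ∀ p (hp : Fact p.Prime), X p hp 0 0 = n)
    (hph : ∀ p (hp : Fact p.Prime), phM (X p hp) ≠ 0)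
    (w : ∀ (p : ℕ) (_ : Fact p.Prime), ℤ_[p])
    (hw : ∀ p (hp : Fact p.Prime), p ∣ 2 * n * d → IsUnit (w p hp) ∧
      phM (X p hp) = (E : ℤ_[p]) * w p hp)
    (l : ℕ) (hl : l.Prime) (hl2 : ¬ l ∣ 2 * n * d) (hβ : ∃ β : ℤ, (l : ℤ) ∣ β ^ 2 + n * d)
    (hlw : ∀ p (hp : Fact p.Prime), p ∣ 2 * n * d →
      ((8 * n * n * d : ℕ) : ℤ_[p]) ∣ (l : ℤ_[p]) - w p hp) :
    ∃ B : TernMat, InGenus A B ∧ B 0 0 = n := by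
  have hAs : ∀ p (hp : Fact p.Prime), (padicMat p A).IsSymm := by
    intro p hp
    show (padicMat p A)ᵀ = _
    rw [← padicMat_tr, hA.1.eq]
  have hXs : ∀ p (hp : Fact p.Prime), (X p hp).IsSymm := by
    intro p hp; rw [← hXV]; exact isSymm_tr _ _ (hAs p hp)
  have hXd : ∀ p (hp : Fact p.Prime), (X p hp).det = d := by
    intro p hp
    rw [← hXV, Matrix.det_mul, Matrix.det_mul, Matrix.det_transpose, hV, padicMat_det, hAd]
    simp
  set M : ℕ := E * (8 * n * n * d) with hMdef
  have hM0 : M ≠ 0 := by positivity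
  have hnM : n ∣ M := ⟨E * 8 * n * d, by rw [hMdef]; ring⟩
  have hEM : E ∣ M := ⟨_, hMdef⟩
  have hMp : ∀ p : ℕ, p ∣ 2 * n * d → p ∣ M := fun p h => h.trans ⟨E * 4 * n, by rw [hMdef]; ring⟩
  have huv : ∀ p (hp : Fact p.Prime), ∃ u v : ℤ_[p], p ∣ 2 * n * d → u * v = 1 ∧ u ^ 2 * w p hp = l := by
    intro p hp
    by_cases h : p ∣ 2 * n * d
    · obtain ⟨u, v, h1, h2⟩ := exists_local_u n d l h _ (hw p hp h).1 (hlw p hp h)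
      exact ⟨u, v, fun _ => ⟨h1, h2⟩⟩
    · exact ⟨0, 0, fun h' => absurd h' h⟩
  choose u v huv using huv
  have hue : ∀ p (hp : Fact p.Prime), p ∣ 2 * n * d →
      ((E * l : ℕ) : ℤ_[p]) = u p hp ^ 2 * phM (X p hp) := by
    intro p hp h
    rw [(hw p hp h).2]
    push_cast
    linear_combination -(E : ℤ_[p]) * (huv p hp h).2
  -- the second minor
  obtain ⟨β₀, hβ₀⟩ := hβ
  obtain ⟨β₁, hβ₁⟩ := crt_padic M hM0 (fun p hp => psM (X p hp))
  have hlM : Nat.Coprime M l := by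
    apply Nat.Coprime.symm
    rw [Nat.Prime.coprime_iff_not_dvd hl]
    intro h
    rcases hl.dvd_mul.1 h with h | h
    · exact hl2 (hEp l hl h)
    · have h' : l ∣ (2 * n * d) ^ 3 := h.trans ⟨n * d * d, by ring⟩
      exact hl2 (hl.dvd_of_dvd_pow h')
  obtain ⟨x, y, hxy⟩ := Nat.isCoprime_iff_coprime.2 hlM
  set β : ℤ := β₁ + M * (x * (β₀ - β₁)) with hβdef
  have hβM : ∀ p (hp : Fact p.Prime), p ∣ 2 * n * d → (M : ℤ_[p]) ∣ (β : ℤ_[p]) - psM (X p hp) := by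
    intro p hp h
    have h1 := hβ₁ p hp (hMp p h)
    have e : (β : ℤ_[p]) - psM (X p hp) =
        ((β₁ : ℤ_[p]) - psM (X p hp)) + M * (x * (β₀ - β₁)) := by
      rw [hβdef]; push_cast; ring
    rw [e]
    exact dvd_add h1 (dvd_mul_right _ _)
  have hβl : (l : ℤ) ∣ β ^ 2 + n * d := by
    have e : β ^ 2 + n * d = (β₀ ^ 2 + n * d) + l * ((β₁ - β₀) * y * (β + β₀)) := by
      have : β - β₀ = l * ((β₁ - β₀) * y) := by
        rw [hβdef]; linear_combination (β₀ - β₁) * hxy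
      linear_combination (β + β₀) * this
    rw [e]
    exact dvd_add hβ₀ (dvd_mul_right _ _)
  have hβE : (E : ℤ) ∣ β ^ 2 + n * d := by
    apply dvd_of_padic hE.ne'
    intro p hp hpE
    have h := hEp p hp.1 hpE
    have h1 : (E : ℤ_[p]) ∣ (β : ℤ_[p]) - psM (X p hp) :=
      (Nat.cast_dvd_cast hEM).trans (hβM p hp h)
    have hid := minor_id _ (hXs p hp)
    rw [(hw p hp h).2, h00, hXd] at hid
    have e : ((β ^ 2 + n * d : ℤ) : ℤ_[p]) = ((β : ℤ_[p]) - psM (X p hp)) * (β + psM (X p hp)) +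
        E * (w p hp * ptM (X p hp)) := by
      push_cast
      linear_combination -hid
    rw [e]
    exact dvd_add (h1.mul_right _) (dvd_mul_right _ _)
  have hElc : IsCoprime (E : ℤ) (l : ℤ) :=
    Nat.isCoprime_iff_coprime.2 (hlM.coprime_dvd_left hEM)
  obtain ⟨γ, hγ⟩ := hElc.mul_dvd hβE hβl
  have hk : ∀ p (hp : Fact p.Prime), ∃ k : ℤ_[p], p ∣ 2 * n * d →
      (β : ℤ_[p]) = u p hp * (k * phM (X p hp) + v p hp * psM (X p hp)) := by
    intro p hp
    by_cases h : p ∣ 2 * n * d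
    · obtain ⟨w', hw'⟩ := (hw p hp h).1.exists_right_inv
      obtain ⟨e, he⟩ := hβM p hp h
      refine ⟨v p hp * w' * (8 * n * n * d) * e, fun _ => ?_⟩
      rw [(hw p hp h).2]
      rw [hMdef] at he
      push_cast at he
      have h1 := (huv p hp h).1
      linear_combination he - (u p hp * v p hp * 8 * n * n * d * e * E) * hw' -
        (8 * n * n * d * e * E + psM (X p hp)) * h1
    · exact ⟨0, fun h' => absurd h' h⟩
  choose k hk using hk
  obtain ⟨b, hb⟩ := crt_padic M hM0 (fun p hp => u p hp * X p hp 0 1)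
  obtain ⟨c, hc⟩ := crt_padic M hM0 (fun p hp => k p hp * X p hp 0 1 + v p hp * X p hp 0 2)
  have hb' : ∀ p (hp : Fact p.Prime), p ∣ 2 * n * d → ∃ w1 : ℤ_[p], (b : ℤ_[p]) = n * w1 + u p hp * X p hp 0 1 := by
    intro p hp h
    obtain ⟨e, he⟩ := (Nat.cast_dvd_cast hnM).trans (hb p hp (hMp p h))
    exact ⟨e, by linear_combination he⟩
  have hc' : ∀ p (hp : Fact p.Prime), p ∣ 2 * n * d → ∃ w2 : ℤ_[p], (c : ℤ_[p]) = n * w2 +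
      (k p hp * X p hp 0 1 + v p hp * X p hp 0 2) := by
    intro p hp h
    obtain ⟨e, he⟩ := (Nat.cast_dvd_cast hnM).trans (hc p hp (hMp p h))
    exact ⟨e, by linear_combination he⟩
  have hpn : ∀ p : ℕ, p ∣ n → p ∣ 2 * n * d := fun p h => h.trans ⟨2 * d, by ring⟩
  obtain ⟨B, hB, hBd, hB0, hB1, hB2, hBph, hBps⟩ := build_B n d (E * l) hn hd
    (Nat.mul_pos hE hl.pos) b c β γ (by push_cast; exact hγ.symm) (by
      apply dvd_of_padic hn.ne'
      intro p hp h
      obtain ⟨w1, hw1⟩ := hb' p hp (hpn p h)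
      have h1 := hue p hp (hpn p h)
      rw [phM, h00] at h1
      rw [Int.cast_add, Int.cast_pow, Int.cast_natCast, h1, hw1]
      exact ⟨u p hp ^ 2 * X p hp 1 1 + n * w1 ^ 2 + 2 * w1 * (u p hp * X p hp 0 1), by ring⟩) (by
      apply dvd_of_padic hn.ne'
      intro p hp h
      obtain ⟨w1, hw1⟩ := hb' p hp (hpn p h)
      obtain ⟨w2, hw2⟩ := hc' p hp (hpn p h)
      have h1 := hk p hp (hpn p h)
      rw [phM, psM, h00] at h1
      rw [Int.cast_add, Int.cast_mul, h1, hw1, hw2]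
      exact ⟨u p hp * k p hp * X p hp 1 1 + u p hp * v p hp * X p hp 1 2 +
        w1 * (n * w2 + (k p hp * X p hp 0 1 + v p hp * X p hp 0 2)) + u p hp * X p hp 0 1 * w2, by ring⟩) (by
      apply dvd_of_padic hn.ne'
      intro p hp h
      obtain ⟨w2, hw2⟩ := hc' p hp (hpn p h)
      have h1 := gam_local (X p hp) (hXs p hp) n (u p hp) (v p hp) (k p hp)
        ((E * l : ℕ) : ℤ_[p]) (γ : ℤ_[p]) (β : ℤ_[p]) (h00 p hp) (huv p hp (hpn p h)).1 (hph p hp)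
        (hue p hp (hpn p h)) (hk p hp (hpn p h)) (by
          have := int_cast_eq (p := p) hγ
          rw [hXd]
          push_cast at this ⊢
          exact this.symm)
      rw [phM, psM, ptM, h00] at h1
      rw [Int.cast_add, Int.cast_pow, h1, hw2]
      exact ⟨k p hp ^ 2 * X p hp 1 1 + 2 * k p hp * v p hp * X p hp 1 2 + v p hp ^ 2 * X p hp 2 2 +
        n * w2 ^ 2 + 2 * w2 * (k p hp * X p hp 0 1 + v p hp * X p hp 0 2), by ring⟩)
  refine ⟨B, ⟨hB, fun p hp' => ?_⟩, hB0⟩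
  haveI hp : Fact p.Prime := ⟨hp'⟩
  show PadicIsomP p (padicMat p A) (padicMat p B)
  have hBs : (padicMat p B).IsSymm := by
    show (padicMat p B)ᵀ = _
    rw [← padicMat_tr, hB.1.eq]
  by_cases h : p ∣ 2 * n * d
  · have h1 : PadicIsomP p (padicMat p A) (X p hp) := ⟨V p hp, by rw [hV]; exact isUnit_one, hXV p hp⟩
    refine PadicIsomP_trans h1 ?_
    obtain ⟨w1, hw1⟩ := hb' p hp h
    obtain ⟨w2, hw2⟩ := hc' p hp h
    have hent : ∀ i j, padicMat p B i j = (B i j : ℤ_[p]) := fun i j => rfl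
    obtain ⟨T, hT, hT'⟩ := minor_isom (X p hp) (padicMat p B) (hXs p hp) hBs n (u p hp) (v p hp)
      (k p hp) w1 w2 (by exact_mod_cast hn.ne') (h00 p hp) (by rw [hent, hB0]; simp)
      (huv p hp h).1 (hph p hp)
      (by
        rw [← hue p hp h]
        have := int_cast_eq (p := p) hBph
        rw [Int.cast_natCast] at this
        rw [← this]; simp [phM, hent])
      (by
        rw [← hk p hp h, ← hBps]
        simp [psM, hent])
      (by rw [hXd, padicMat_det, hBd]; simp)
      (by rw [hent, hB1, hw1]; ring)
      (by rw [hent, hB2, hw2]; ring)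
    exact ⟨T, by rw [hT]; exact isUnit_one, hT'⟩
  · refine unimod_isom ?_ _ _ (hAs p hp) hBs ?_ ?_
    · rintro rfl; exact h ⟨n * d, by ring⟩
    · rw [padicMat_det, hAd, Int.cast_natCast]
      exact padic_unit_nat (fun hh => h (hh.trans ⟨2 * n, by ring⟩))
    · rw [padicMat_det, padicMat_det, hBd, hAd]

/-! ### P7e: local representability implies representation by the genus -/

theorem exists_rep_prim (A : TernMat) (hA : IsLat A) (n : ℕ) (hn : 0 < n)
    (hy : ∀ p (hp : Fact p.Prime), ∃ y : Fin 3 → ℤ_[p], (∃ i, IsUnit (y i)) ∧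
      quadVal (padicMat p A) y = n) : ∃ B, InGenus A B ∧ ∃ x, quadVal B x = n := by
  have hdp : 0 < A.det := ((isLat_iff _).1 hA).2.2.2
  obtain ⟨d, hd⟩ := Int.eq_ofNat_of_zero_le hdp.le
  have hd0 : 0 < d := by rw [hd] at hdp; exact_mod_cast hdp
  have hV : ∀ p (hp : Fact p.Prime), ∃ V : Matrix (Fin 3) (Fin 3) ℤ_[p], V.det = 1 ∧
      (Vᵀ * padicMat p A * V) 0 0 = n ∧ phM (Vᵀ * padicMat p A * V) ≠ 0 := by
    intro p hp
    obtain ⟨y, hyu, hyq⟩ := hy p hp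
    refine make_ph _ ?_ ?_ _ ?_ y hyu hyq
    · show (padicMat p A)ᵀ = _
      rw [← padicMat_tr, hA.1.eq]
    · rw [padicMat_det, hd]; simpa using hd0.ne'
    · exact_mod_cast hn.ne'
  choose V hV1 hV2 hV3 using hV
  obtain ⟨E, hE, hEp, hEw⟩ := exists_E (2 * n * d).primeFactors
    (fun p hp => Nat.prime_of_mem_primeFactors hp)
    (fun p hp => phM ((V p hp)ᵀ * padicMat p A * V p hp)) hV3
  have h0 : 2 * n * d ≠ 0 := by positivity
  have hEp' : ∀ p : ℕ, p.Prime → p ∣ E → p ∣ 2 * n * d := fun p hp h =>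
    Nat.dvd_of_mem_primeFactors (hEp p hp h)
  have hEw' : ∀ p (hp : Fact p.Prime), ∃ w : ℤ_[p], p ∣ 2 * n * d → IsUnit w ∧
      phM ((V p hp)ᵀ * padicMat p A * V p hp) = (E : ℤ_[p]) * w := by
    intro p hp
    by_cases h : p ∣ 2 * n * d
    · obtain ⟨w, h1, h2⟩ := hEw p hp (Nat.mem_primeFactors.2 ⟨hp.1, h, h0⟩)
      exact ⟨w, fun _ => ⟨h1, h2⟩⟩
    · exact ⟨0, fun h' => absurd h' h⟩
  choose w hw using hEw'
  obtain ⟨l, hl, hl2, hβ, hlw⟩ := aux_prime A hA n d E hn hd0 hE hd hEp' V hV1 hV2 w hw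
  obtain ⟨B, hB, hB0⟩ := construct A hA n d E hn hd0 hE hd hEp' V hV1 _ (fun _ _ => rfl) hV2 hV3 w hw
    l hl hl2 hβ hlw
  refine ⟨B, hB, ![1, 0, 0], ?_⟩
  rw [← hB0]
  simp [quadVal, Fin.sum_univ_three]

theorem exists_rep (A : TernMat) (hA : IsLat A) : ∀ n : ℕ, 0 < n → LocallyRepresented n A →
    ∃ B, InGenus A B ∧ ∃ x, quadVal B x = (n : ℤ) := by
  intro n
  induction n using Nat.strong_induction_on with
  | _ n ih =>
  intro hn hloc
  by_cases hred : ∃ (r m : ℕ) (hr : r.Prime), n = r ^ 2 * m ∧ RepresentedAt r hr m A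
  · obtain ⟨r, m, hr, hnm, hrm⟩ := hred
    have hm : 0 < m := by
      rcases Nat.eq_zero_or_pos m with h | h
      · rw [h] at hnm; omega
      · exact h
    have hlt : m < n := by
      rw [hnm]
      have : 1 < r ^ 2 := Nat.one_lt_pow (by norm_num) hr.one_lt
      nlinarith
    obtain ⟨B, hB, x, hx⟩ := ih m hlt hm (by
      intro p hp
      by_cases hpr : p = r
      · subst hpr; exact hrm
      · haveI : Fact p.Prime := ⟨hp⟩
        obtain ⟨y, hy⟩ := hloc p hp
        have hu : IsUnit ((r : ℕ) : ℤ_[p]) :=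
          padic_unit_nat (fun hh => hpr ((Nat.prime_dvd_prime_iff_eq hp hr).1 hh))
        obtain ⟨z, hz⟩ := hu.exists_right_inv
        refine ⟨z • y, ?_⟩
        rw [quadVal_smul, hy, hnm]
        push_cast
        linear_combination (r * z + 1 : ℤ_[p]) * m * hz)
    refine ⟨B, hB, (r : ℤ) • x, ?_⟩
    rw [quadVal_smul, hx, hnm]
    push_cast; ring
  · refine exists_rep_prim A hA n hn ?_
    intro p hp
    obtain ⟨y, hy⟩ := hloc p hp.1
    refine ⟨y, ?_, by simpa using hy⟩
    by_contra hne
    push Not at hne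
    have h1 : ∀ i, ∃ z, y i = (p : ℤ_[p]) * z := by
      intro i
      have := hne i
      rw [unit_iff_not_dvd, not_not] at this
      exact this
    choose z hz using h1
    have hyz : y = (p : ℤ_[p]) • z := by funext i; simpa using hz i
    rw [hyz, quadVal_smul] at hy
    have h2 : ((p : ℤ) ^ 2) ∣ (n : ℤ) := by
      rw [← PadicInt.pow_p_dvd_int_iff]
      exact ⟨_, hy.symm⟩
    have h3 : p ^ 2 ∣ n := by exact_mod_cast h2
    obtain ⟨m, hm⟩ := h3
    refine hred ⟨p, m, hp.1, hm, z, ?_⟩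
    have hp0 : (p : ℤ_[p]) ^ 2 ≠ 0 := pow_ne_zero _ (by exact_mod_cast hp.1.ne_zero)
    apply mul_left_cancel₀ hp0
    rw [hy, hm]; push_cast; ring

/-- For a prime `q` coprime to `2 d_L` and `n` locally represented by `L`,
`r(n q², gen(L)) / r(n, gen(L)) = H(4 d_L n q² / f²) / H(4 d_L n / f²)`. -/
theorem rGenus_ratio_coprime_prime (A : TernMat) (hA : IsLat A)
    (q : ℕ) (hq : q.Prime) (hqd : Nat.Coprime q (2 * A.det).natAbs)
    (n : ℕ) (hn : 0 < n) (hloc : LocallyRepresented n A)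
    (f : ℕ) (hf : 0 < f) (hfq : Nat.Coprime f q)
    (hH : hurwitz ((4 * (A.det : ℚ) * (n : ℚ)) / (f : ℚ) ^ 2) ≠ 0) :
    rGenus ((n : ℤ) * (q : ℤ) ^ 2) A / rGenus (n : ℤ) A =
      (hurwitz ((4 * (A.det : ℚ) * (n : ℚ) * (q : ℚ) ^ 2) / (f : ℚ) ^ 2) : ℝ) /
        (hurwitz ((4 * (A.det : ℚ) * (n : ℚ)) / (f : ℚ) ^ 2) : ℝ) := by
  obtain ⟨B, hB, x, hx⟩ := exists_rep A hA n hn hloc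
  exact final_of_pos A hA q hq hqd n hn (RG_pos hA hB hx) f hf hfq hH
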